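/- arXiv:math/0006177 — 4 statements merged into one kernel-verified Lean document; each statement's English description precedes it below -/
import Mathlib

section
/- A word w in the alphabet {x_1^{±1},…,x_d^{±1}} represents an element of the second derived subgroup F_d'' of the free group F_d (equivalently, represents the identity of Sol_d = F_d/F_d'') if and only if its signed crossing count w(v,i) is zero for every oriented edge (v,i) of the lattice ℤ^d. -/
open scoped BigOperators

/-- Lattice points of `ℤ^d`. -/
abbrev Pt (d : ℕ) : Type := Fin d → ℤ

/-- Oriented edges of the grid: `(v, i)` is the edge from `v` to `v + eᵢ`. -/
abbrev Edg (d : ℕ) : Type := (Fin d → ℤ) × Fin d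

/-- The `i`-th standard basis vector of `ℤ^d`. -/
def latE (d : ℕ) (i : Fin d) : Pt d := fun j => if j = i then 1 else 0

/-- Zero-divergence condition defining `1`-cycles on the grid. -/
def IsCycle (d : ℕ) (f : Edg d →₀ ℤ) : Prop :=
  ∀ u : Pt d, ∑ i : Fin d, (f (u, i) - f (u - latE d i, i)) = 0

/-- `B_d`: the additive group of `1`-cycles on the grid. -/
noncomputable def Bgrp (d : ℕ) : AddSubgroup (Edg d →₀ ℤ) where
  carrier := {f | IsCycle d f}
  zero_mem' := by intro u; simp
  add_mem' := by
    intro f g hf hg u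
    have h1 := hf u
    have h2 := hg u
    calc ∑ i : Fin d, ((f + g) (u, i) - (f + g) (u - latE d i, i))
        = ∑ i : Fin d, ((f (u, i) - f (u - latE d i, i))
            + (g (u, i) - g (u - latE d i, i))) := by
          refine Finset.sum_congr rfl fun i _ => ?_
          simp only [Finsupp.add_apply]; ring
      _ = 0 := by rw [Finset.sum_add_distrib, h1, h2, add_zero]
  neg_mem' := by
    intro f hf u
    have h1 := hf u
    calc ∑ i : Fin d, ((-f) (u, i) - (-f) (u - latE d i, i))
        = ∑ i : Fin d, -((f (u, i) - f (u - latE d i, i))) := by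
          refine Finset.sum_congr rfl fun i _ => ?_
          simp only [Finsupp.neg_apply]; ring
      _ = 0 := by rw [Finset.sum_neg_distrib, h1, neg_zero]

/-- Translation of `ℤ^d` on edges. -/
def edgeShift (d : ℕ) (u : Pt d) : Edg d ≃ Edg d where
  toFun p := (p.1 + u, p.2)
  invFun p := (p.1 - u, p.2)
  left_inv p := by simp
  right_inv p := by simp

/-- The translation action of `ℤ^d` on integer functions on edges:
`(u · f)(v, i) = f (v - u, i)`. -/
noncomputable def shiftF (d : ℕ) (u : Pt d) (f : Edg d →₀ ℤ) : Edg d →₀ ℤ :=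
  Finsupp.equivMapDomain (edgeShift d u) f

/-- One step of a lattice path: the letter `(i, b)` moves by `eᵢ` if `b` and by `-eᵢ`
otherwise. -/
def stepFn (d : ℕ) (p : Pt d) (s : Fin d × Bool) : Pt d :=
  p + (if s.2 then latE d s.1 else -latE d s.1)

/-- Total displacement of a word (= endpoint of the associated lattice path started at `0`). -/
def disp (d : ℕ) (w : List (Fin d × Bool)) : Pt d :=
  (w.map fun s => if s.2 then latE d s.1 else -latE d s.1).sum

/-- The signed edge-crossing count function of the lattice path spelled by the word `w`
starting at the point `p`. -/
noncomputable def crossFrom (d : ℕ) : Pt d → List (Fin d × Bool) → (Edg d →₀ ℤ)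
  | _, [] => 0
  | p, s :: rest =>
      (if s.2 then Finsupp.single (p, s.1) (1 : ℤ)
        else Finsupp.single (p - latE d s.1, s.1) (-1))
      + crossFrom d (stepFn d p s) rest

/-- The reversed path: spell the word backwards with all signs flipped. -/
def wordInv (d : ℕ) (w : List (Fin d × Bool)) : List (Fin d × Bool) :=
  w.reverse.map fun s => (s.1, !s.2)

/-- The 2-cocycle associated to a path system `τ`: the signed edge-crossing count of the
closed path `τ_v ⬝ (v + τ_w) ⬝ (τ_{v+w})⁻¹`. -/
noncomputable def betaCocycle (d : ℕ) (τ : Pt d → List (Fin d × Bool)) (v w : Pt d) : Edg d →₀ ℤ :=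
  crossFrom d 0 (τ v ++ τ w ++ wordInv d (τ (v + w)))

/-- The elementary `(i,j)`-placket at `v`. -/
noncomputable def placket (d : ℕ) (v : Pt d) (i j : Fin d) : Edg d →₀ ℤ :=
  Finsupp.single (v, i) 1 + Finsupp.single (v + latE d i, j) 1
    - Finsupp.single (v + latE d j, i) 1 - Finsupp.single (v, j) 1

theorem aux_cross_append (d : ℕ) (u v : List (Fin d × Bool)) : ∀ p : Pt d,
    crossFrom d p (u ++ v) = crossFrom d p u + crossFrom d (p + disp d u) v := by
  induction u with
  | nil => intro p; simp [crossFrom, disp]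
  | cons s u ih =>
    intro p
    have e : stepFn d p s + disp d u = p + disp d (s :: u) := by
      simp [stepFn, disp, add_assoc]
    rw [List.cons_append, crossFrom, crossFrom, ih, e, add_assoc]

theorem aux_disp_append (d : ℕ) (u v : List (Fin d × Bool)) :
    disp d (u ++ v) = disp d u + disp d v := by
  simp [disp]

theorem aux_step (d : ℕ) {u v : List (Fin d × Bool)} (h : FreeGroup.Red.Step u v) :
    disp d u = disp d v ∧ ∀ p, crossFrom d p u = crossFrom d p v := by
  cases h with
  | @not L₁ L₂ x b =>
    have e : disp d ((x, b) :: (x, !b) :: L₂) = disp d L₂ := by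
      cases b <;> simp [disp]
    refine ⟨by rw [aux_disp_append, aux_disp_append, e], fun p => ?_⟩
    rw [aux_cross_append, aux_cross_append]
    congr 1
    generalize p + disp d L₁ = q
    cases b
    · simp [crossFrom, stepFn, ← add_assoc, ← sub_eq_add_neg]
    · simp [crossFrom, stepFn, ← add_assoc, ← sub_eq_add_neg]

theorem aux_red (d : ℕ) {u v : List (Fin d × Bool)} (h : FreeGroup.Red u v) :
    disp d u = disp d v ∧ ∀ p, crossFrom d p u = crossFrom d p v := by
  induction h with
  | refl => exact ⟨rfl, fun _ => rfl⟩
  | tail _ h ih =>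
    have h2 := aux_step d h
    exact ⟨ih.1.trans h2.1, fun p => (ih.2 p).trans (h2.2 p)⟩

theorem aux_mk (d : ℕ) {u v : List (Fin d × Bool)} (h : FreeGroup.mk u = FreeGroup.mk v) :
    disp d u = disp d v ∧ ∀ p, crossFrom d p u = crossFrom d p v := by
  obtain ⟨c, h1, h2⟩ := FreeGroup.Red.exact.1 h
  have h1 := aux_red d h1
  have h2 := aux_red d h2
  exact ⟨h1.1.trans h2.1.symm, fun p => (h1.2 p).trans (h2.2 p).symm⟩

/-- Displacement as a homomorphism. -/
noncomputable def auxD (d : ℕ) : FreeGroup (Fin d) →* Multiplicative (Pt d) where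
  toFun g := Multiplicative.ofAdd (disp d g.toWord)
  map_one' := by simp [disp]
  map_mul' g h := by
    rw [← ofAdd_add, ← aux_disp_append]
    congr 1
    apply (aux_mk d _).1
    rw [← FreeGroup.mul_mk]; simp [FreeGroup.mk_toWord]

theorem aux_c_mul (d : ℕ) (p : Pt d) (g h : FreeGroup (Fin d)) :
    crossFrom d p (g * h).toWord =
      crossFrom d p g.toWord + crossFrom d (p + (auxD d g).toAdd) h.toWord := by
  have : crossFrom d p (g * h).toWord = crossFrom d p (g.toWord ++ h.toWord) := by
    apply (aux_mk d _).2
    rw [← FreeGroup.mul_mk]; simp [FreeGroup.mk_toWord]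
  rw [this, aux_cross_append]; rfl

open scoped commutatorElement in
theorem aux_forward (d : ℕ) (g : FreeGroup (Fin d))
    (hg : g ∈ derivedSeries (FreeGroup (Fin d)) 2) (p : Pt d) :
    crossFrom d p g.toWord = 0 := by
  have hD : ∀ g ∈ derivedSeries (FreeGroup (Fin d)) 1, auxD d g = 1 := by
    intro g hg
    rw [derivedSeries_one] at hg
    exact Abelianization.commutator_subset_ker (auxD d) hg
  let C : derivedSeries (FreeGroup (Fin d)) 1 →* Multiplicative (Edg d →₀ ℤ) :=
    MonoidHom.mk' (fun g => Multiplicative.ofAdd (crossFrom d p g.1.toWord)) (by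
      rintro ⟨a, ha⟩ ⟨b, hb⟩
      simp only [Subgroup.coe_mul, aux_c_mul, hD a ha, ← ofAdd_add, toAdd_one, add_zero])
  have key : derivedSeries (FreeGroup (Fin d)) 2 ≤ C.ker.map (Subgroup.subtype _) := by
    rw [derivedSeries_succ, Subgroup.commutator_le]
    intro a ha b hb
    refine ⟨⁅(⟨a, ha⟩ : derivedSeries (FreeGroup (Fin d)) 1), ⟨b, hb⟩⁆, ?_, rfl⟩
    show C _ = 1
    rw [map_commutatorElement, commutatorElement_eq_one_iff_mul_comm, mul_comm]
  obtain ⟨x, hx, rfl⟩ := key hg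
  exact hx

theorem aux_disp_zero (d : ℕ) (w : List (Fin d × Bool)) : ∀ p : Pt d,
    disp d w = (Finsupp.liftAddHom fun e : Edg d => (zmultiplesHom (Pt d)) (latE d e.2))
      (crossFrom d p w) := by
  induction w with
  | nil => intro p; simp [crossFrom, disp]
  | cons s w ih =>
    intro p
    have : disp d (s :: w) = (if s.2 then latE d s.1 else -latE d s.1) + disp d w := by
      simp [disp]
    rw [this, crossFrom, map_add, ← ih]
    congr 1
    rcases s with ⟨i, _ | _⟩
    · simp [Finsupp.liftAddHom_apply_single, -Finsupp.single_neg, -Finsupp.liftAddHom_apply]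
    · simp

theorem aux_section (d : ℕ) : ∃ σ : Pt d → FreeGroup (Fin d), ∀ v i,
    σ v * FreeGroup.of i * (σ (v + latE d i))⁻¹ ∈ commutator (FreeGroup (Fin d)) := by
  have hs : Function.Surjective (Abelianization.of (G := FreeGroup (Fin d))) :=
    QuotientGroup.mk_surjective
  choose σ hσ using fun v : Pt d =>
    hs (∏ i, Abelianization.of (FreeGroup.of i) ^ v i)
  refine ⟨σ, fun v i => ?_⟩
  rw [← Abelianization.ker_of, MonoidHom.mem_ker, map_mul, map_mul, map_inv, hσ, hσ]
  simp only [Pi.add_apply, zpow_add, Finset.prod_mul_distrib]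
  rw [mul_inv_eq_one]
  congr 1
  rw [Finset.prod_eq_single i]
  · simp [latE]
  · intro j _ hj
    simp [latE, hj]
  · simp

theorem aux_backward (d : ℕ) (σ : Pt d → FreeGroup (Fin d)) (hσ : ∀ v i,
    σ v * FreeGroup.of i * (σ (v + latE d i))⁻¹ ∈ commutator (FreeGroup (Fin d)))
    (Φ : (Edg d →₀ ℤ) →+ Additive (Abelianization (commutator (FreeGroup (Fin d)))))
    (hΦ : ∀ v i, Φ (Finsupp.single (v, i) 1) =
      Additive.ofMul (Abelianization.of ⟨_, hσ v i⟩))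
    (w : List (Fin d × Bool)) : ∀ p : Pt d, ∃ h : commutator (FreeGroup (Fin d)),
      h.1 = σ p * FreeGroup.mk w * (σ (p + disp d w))⁻¹ ∧
      Additive.ofMul (Abelianization.of h) = Φ (crossFrom d p w) := by
  induction w with
  | nil =>
    intro p
    refine ⟨1, ?_, ?_⟩
    · simp [disp, ← FreeGroup.one_eq_mk]
    · simp [crossFrom]
  | cons s w ih =>
    intro p
    obtain ⟨h, h1, h2⟩ := ih (stepFn d p s)
    have e : stepFn d p s + disp d w = p + disp d (s :: w) := by
      simp [stepFn, disp, add_assoc]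
    have e2 : FreeGroup.mk (s :: w) = FreeGroup.mk [s] * FreeGroup.mk w := by
      rw [FreeGroup.mul_mk]; rfl
    rw [e] at h1
    rcases s with ⟨i, _ | _⟩
    · refine ⟨⟨_, hσ (p - latE d i) i⟩⁻¹ * h, ?_, ?_⟩
      · have e3 : FreeGroup.mk [(i, false)] = (FreeGroup.of i)⁻¹ := rfl
        rw [Subgroup.coe_mul, Subgroup.coe_inv, h1, e2, e3]
        simp [stepFn, mul_assoc, sub_eq_add_neg]
      · rw [crossFrom, map_add, ← h2]
        have e4 : Φ (Finsupp.single (p - latE d i, i) (-1)) = -Additive.ofMul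
            (Abelianization.of ⟨_, hσ (p - latE d i) i⟩) := by
          rw [Finsupp.single_neg, map_neg, hΦ]
        rw [map_mul, map_inv, ofMul_mul, ofMul_inv, ← e4]
        rfl
    · refine ⟨⟨_, hσ p i⟩ * h, ?_, ?_⟩
      · have e3 : FreeGroup.mk [(i, true)] = FreeGroup.of i := rfl
        rw [Subgroup.coe_mul, h1, e2, e3]
        simp [stepFn, mul_assoc]
      · rw [crossFrom, map_add, ← h2]
        simp [← hΦ]

/-- A word in the alphabet `{x₁^{±1}, …, x_d^{±1}}` represents an element
of the second derived subgroup `F_d''` of the free group (equivalently, the identity of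
`Sol_d = F_d/F_d''`) if and only if its signed crossing count vanishes at every oriented
edge `(v,i)` of the lattice `ℤ^d`. -/
theorem word_mem_second_derived_iff_crossings_zero (d : ℕ) (w : List (Fin d × Bool)) :
    FreeGroup.mk w ∈ derivedSeries (FreeGroup (Fin d)) 2
      ↔ ∀ (v : Pt d) (i : Fin d), crossFrom d 0 w (v, i) = 0 := by
  constructor
  · intro h v i
    rw [(aux_mk d (FreeGroup.mk_toWord (x := FreeGroup.mk w)).symm).2 0, aux_forward d _ h 0]
    rfl
  · intro h
    have h0 : crossFrom d 0 w = 0 := by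
      ext ⟨v, i⟩
      exact h v i
    have hd : disp d w = 0 := by rw [aux_disp_zero d w 0, h0, map_zero]
    obtain ⟨σ, hσ⟩ := aux_section d
    obtain ⟨g, h1, h2⟩ := aux_backward d σ hσ
      (Finsupp.liftAddHom fun e : Edg d => (zmultiplesHom _)
        (Additive.ofMul (Abelianization.of ⟨_, hσ e.1 e.2⟩)))
      (by intro v i; simp) w 0
    rw [h0, map_zero] at h2
    rw [hd, add_zero] at h1
    have h3 : g ∈ commutator (commutator (FreeGroup (Fin d))) := by
      rw [← Abelianization.ker_of (commutator (FreeGroup (Fin d)))]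
      exact h2
    have h4 : (g : FreeGroup (Fin d)) ∈ derivedSeries (FreeGroup (Fin d)) 2 := by
      rw [derivedSeries_succ, derivedSeries_one]
      have := Subgroup.mem_map_of_mem (Subgroup.subtype _) h3
      rwa [commutator_def (commutator (FreeGroup (Fin d))), Subgroup.map_commutator,
        ← MonoidHom.range_eq_map, Subgroup.range_subtype] at this
    rw [h1] at h4
    have := (derivedSeries_normal (FreeGroup (Fin d)) 2).conj_mem _ h4 (σ 0)⁻¹
    simpa [mul_assoc] using this
end

section
/- Let d ∈ {1,2}. For almost every ω in the Bernoulli path space of the simple random walk on ℤ^d, every oriented edge (v,i) of the lattice is traversed infinitely often in each direction: there are infinitely many k with p_{k−1}=v and p_k=v+e_i, and infinitely many k with p_{k−1}=v+e_i and p_k=v. -/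
open MeasureTheory in
/-- `μ` is the Bernoulli product on `ℕ → S` of the uniform measure on the finite set `S`:
it is a probability measure under which the coordinates are i.i.d. uniform on `S`, i.e.
every cylinder of length `n` has measure `|S|^{-n}`. -/
def IsUniformBernoulli (S : Type*) [Fintype S] [MeasurableSpace S]
    (μ : Measure (ℕ → S)) : Prop :=
  IsProbabilityMeasure μ ∧
    ∀ (n : ℕ) (f : Fin n → S),
      μ {ω | ∀ k : Fin n, ω (k : ℕ) = f k} = ((Fintype.card S : ENNReal))⁻¹ ^ n

/-- The position of the lattice path spelled by the letter sequence `ω` after `n` steps. -/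
def walkPos (d : ℕ) (ω : ℕ → Fin d × Bool) : ℕ → Pt d
  | 0 => 0
  | n + 1 => stepFn d (walkPos d ω n) (ω n)

open MeasureTheory

/-- displacement vector of a letter -/
def sv (d : ℕ) (s : Fin d × Bool) : Pt d := if s.2 then latE d s.1 else -latE d s.1

lemma walkPos_eq_sum (d : ℕ) (ω : ℕ → Fin d × Bool) (n : ℕ) :
    walkPos d ω n = ∑ i : Fin n, sv d (ω i) := by
  induction n with
  | zero => simp [walkPos]
  | succ n ih => rw [Fin.sum_univ_castSucc]; simp [walkPos, stepFn, ih, sv]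

lemma walkPos_add (d : ℕ) (ω : ℕ → Fin d × Bool) (n m : ℕ) :
    walkPos d ω (n + m) = walkPos d ω n + walkPos d (fun k => ω (n + k)) m := by
  induction m with
  | zero => simp [walkPos]
  | succ m ih => rw [← add_assoc]; simp [walkPos, stepFn, ih, add_assoc]

lemma measurable_walkPos (d : ℕ) (n : ℕ) :
    Measurable (fun ω : ℕ → Fin d × Bool => walkPos d ω n) := by
  simp only [walkPos_eq_sum]
  refine Finset.measurable_sum _ fun i _ => ?_
  exact (Measurable.of_discrete (f := sv d)).comp (measurable_pi_apply _)

/-- cylinder -/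
def cyl {S : Type*} (n : ℕ) (f : Fin n → S) : Set (ℕ → S) := {ω | ∀ k : Fin n, ω (k : ℕ) = f k}

lemma mem_cyl_append {S : Type*} {n m : ℕ} (f : Fin n → S) (g : Fin m → S) (ω : ℕ → S) :
    ω ∈ cyl (n + m) (Fin.append f g) ↔ ω ∈ cyl n f ∧ (fun k => ω (n + k)) ∈ cyl m g := by
  constructor
  · intro h
    refine ⟨fun k => ?_, fun k => ?_⟩
    · simpa using h (Fin.castAdd m k)
    · simpa using h (Fin.natAdd n k)
  · rintro ⟨h1, h2⟩ k
    refine Fin.addCases (fun i => ?_) (fun i => ?_) k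
    · simpa using h1 i
    · simpa using h2 i

set_option linter.unusedSectionVars false

section
variable {S : Type*} [Fintype S] [MeasurableSpace S] [DiscreteMeasurableSpace S]

lemma measurableSet_cyl (n : ℕ) (f : Fin n → S) : MeasurableSet (cyl n f) := by
  have : cyl n f = ⋂ k : Fin n, (fun ω : ℕ → S => ω k) ⁻¹' {f k} := by
    ext ω; simp [cyl]
  rw [this]
  exact MeasurableSet.iInter fun k => measurable_pi_apply _ (MeasurableSet.of_discrete)

lemma isPiSystem_cyl : IsPiSystem {s : Set (ℕ → S) | ∃ n f, s = cyl n f} := by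
  have key : ∀ (n m : ℕ) (f : Fin n → S) (g : Fin m → S), n ≤ m →
      (cyl n f ∩ cyl m g).Nonempty → cyl n f ∩ cyl m g = cyl m g := by
    rintro n m f g h ⟨x, hx1, hx2⟩
    apply Set.inter_eq_right.2
    intro ω hω k
    have a := hx1 k
    have b := hx2 ⟨k, k.2.trans_le h⟩
    have c := hω ⟨k, k.2.trans_le h⟩
    simp only at b c
    rw [c, ← b, a]
  rintro _ ⟨n, f, rfl⟩ _ ⟨m, g, rfl⟩ hne
  rcases le_total n m with h | h
  · exact ⟨m, g, key n m f g h hne⟩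
  · rw [Set.inter_comm] at hne ⊢
    exact ⟨n, f, key m n g f h hne⟩

lemma generate_cyl : (MeasurableSpace.pi : MeasurableSpace (ℕ → S)) =
    MeasurableSpace.generateFrom {s : Set (ℕ → S) | ∃ n f, s = cyl n f} := by
  apply le_antisymm
  · refine iSup_le fun k => ?_
    rintro _ ⟨A, -, rfl⟩
    have : (fun ω : ℕ → S => ω k) ⁻¹' A =
        ⋃ f : {f : Fin (k + 1) → S // f (Fin.last k) ∈ A}, cyl (k + 1) f.1 := by
      ext ω
      simp only [Set.mem_preimage, Set.mem_iUnion]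
      constructor
      · intro h
        exact ⟨⟨fun i => ω i, by simpa using h⟩, fun i => rfl⟩
      · rintro ⟨f, hf⟩
        have := hf (Fin.last k)
        simp only [Fin.val_last] at this
        rw [this]; exact f.2
    rw [this]
    refine MeasurableSet.iUnion fun f => ?_
    exact MeasurableSpace.measurableSet_generateFrom ⟨_, _, rfl⟩
  · apply MeasurableSpace.generateFrom_le
    rintro _ ⟨n, f, rfl⟩
    exact measurableSet_cyl n f

lemma measurable_shift (n : ℕ) : Measurable (fun (ω : ℕ → S) k => ω (n + k)) :=
  measurable_pi_lambda _ fun _ => measurable_pi_apply _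

lemma markov {μ : Measure (ℕ → S)} (hμ : IsUniformBernoulli S μ) (n : ℕ) (f : Fin n → S)
    {B : Set (ℕ → S)} (hB : MeasurableSet B) :
    μ (cyl n f ∩ (fun (ω : ℕ → S) k => ω (n + k)) ⁻¹' B) =
      ((Fintype.card S : ENNReal))⁻¹ ^ n * μ B := by
  have := hμ.1
  have hc : ∀ n (f : Fin n → S), μ (cyl n f) = ((Fintype.card S : ENNReal))⁻¹ ^ n := hμ.2
  have : (μ.restrict (cyl n f)).map (fun (ω : ℕ → S) k => ω (n + k)) =
      ((Fintype.card S : ENNReal))⁻¹ ^ n • μ := by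
    refine ext_of_generate_finite _ generate_cyl isPiSystem_cyl ?_ ?_
    · rintro _ ⟨m, g, rfl⟩
      rw [Measure.map_apply (measurable_shift n) (measurableSet_cyl m g),
        Measure.restrict_apply ((measurable_shift n) (measurableSet_cyl m g))]
      have : (fun (ω : ℕ → S) k => ω (n + k)) ⁻¹' cyl m g ∩ cyl n f =
          cyl (n + m) (Fin.append f g) := by
        ext ω; rw [mem_cyl_append, and_comm]; rfl
      rw [this, hc, Measure.smul_apply, hc, pow_add, smul_eq_mul]
    · rw [Measure.map_apply (measurable_shift n) MeasurableSet.univ]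
      simp [hc]
  have h2 := congrArg (fun ν => ν B) this
  simp only [Measure.smul_apply, smul_eq_mul] at h2
  rw [Measure.map_apply (measurable_shift n) hB,
    Measure.restrict_apply (measurable_shift n hB), Set.inter_comm] at h2
  exact h2

lemma shift_null {μ : Measure (ℕ → S)} (hμ : IsUniformBernoulli S μ) (n : ℕ)
    {B : Set (ℕ → S)} (hB : MeasurableSet B) (h0 : μ B = 0) :
    μ ((fun (ω : ℕ → S) k => ω (n + k)) ⁻¹' B) = 0 := by
  refine measure_mono_null (t := ⋃ f : Fin n → S, (cyl n f ∩ (fun (ω : ℕ → S) k => ω (n + k)) ⁻¹' B))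
    ?_ ?_
  · intro ω hω
    exact Set.mem_iUnion.2 ⟨fun i => ω i, fun i => rfl, hω⟩
  · rw [measure_iUnion_null_iff]
    intro f
    rw [markov hμ n f hB, h0, mul_zero]
end

/-- at time `j` the walk is at `0` and reads the word `g`. -/
def evA (d : ℕ) {m : ℕ} (g : Fin m → Fin d × Bool) (j : ℕ) : Set (ℕ → Fin d × Bool) :=
  {ω | walkPos d ω j = 0 ∧ (fun k => ω (j + k)) ∈ cyl m g}

lemma measurableSet_evA (d : ℕ) {m : ℕ} (g : Fin m → Fin d × Bool) (j : ℕ) :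
    MeasurableSet (evA d g j) :=
  ((measurable_walkPos d j) (MeasurableSet.of_discrete (s := {0}))).inter
    (measurable_shift j (measurableSet_cyl m g))

/-- never `evA`. -/
def evB (d : ℕ) {m : ℕ} (g : Fin m → Fin d × Bool) : Set (ℕ → Fin d × Bool) :=
  ⋂ j, (evA d g j)ᶜ

lemma measurableSet_evB (d : ℕ) {m : ℕ} (g : Fin m → Fin d × Bool) :
    MeasurableSet (evB d g) :=
  MeasurableSet.iInter fun j => (measurableSet_evA d g j).compl

lemma walkPos_cyl (d : ℕ) {m : ℕ} (g : Fin m → Fin d × Bool) (ω : ℕ → Fin d × Bool)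
    (h : ω ∈ cyl m g) : walkPos d ω m = ∑ i, sv d (g i) := by
  rw [walkPos_eq_sum]
  exact Finset.sum_congr rfl fun i _ => by rw [h i]

lemma shift_evA (d : ℕ) {m : ℕ} (g : Fin m → Fin d × Bool) (hg : ∑ i, sv d (g i) = 0)
    (k j : ℕ) (ω : ℕ → Fin d × Bool) (h : ω ∈ evA d g k) :
    (fun l => ω (k + m + l)) ∈ evA d g j ↔ ω ∈ evA d g (k + m + j) := by
  have h1 : walkPos d ω (k + m) = 0 := by
    rw [walkPos_add, h.1, walkPos_cyl d g _ h.2, hg, add_zero]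
  simp only [evA, Set.mem_ofPred_eq, walkPos_add d ω (k + m) j, h1, zero_add]
  simp only [add_assoc]

/-- `evA` at `k`, never later (after the word has been read). -/
def evD (d : ℕ) {m : ℕ} (g : Fin m → Fin d × Bool) (k : ℕ) : Set (ℕ → Fin d × Bool) :=
  evA d g k ∩ (fun ω l => ω (k + m + l)) ⁻¹' (evB d g)

def loops (d n : ℕ) : Finset (Fin n → Fin d × Bool) := {f | ∑ i, sv d (f i) = 0}

lemma measure_evD (d : ℕ) {m : ℕ} (g : Fin m → Fin d × Bool)
    (μ : Measure (ℕ → Fin d × Bool)) (hμ : IsUniformBernoulli (Fin d × Bool) μ) (k : ℕ) :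
    ((loops d k).card : ENNReal) *
      (((Fintype.card (Fin d × Bool) : ENNReal))⁻¹ ^ (k + m) * μ (evB d g)) ≤ μ (evD d g k) := by
  have hs : (⋃ f ∈ loops d k, (cyl (k + m) (Fin.append f g) ∩
      (fun ω l => ω (k + m + l)) ⁻¹' (evB d g))) ⊆ evD d g k := by
    intro ω hω
    simp only [Set.mem_iUnion] at hω
    obtain ⟨f, hf, h1, h2⟩ := hω
    rw [mem_cyl_append] at h1
    refine ⟨⟨?_, h1.2⟩, h2⟩
    rw [walkPos_cyl d f ω h1.1]
    simpa [loops] using hf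
  refine le_trans (le_of_eq ?_) (measure_mono hs)
  rw [measure_biUnion_finset]
  · simp_rw [markov hμ (k + m) _ (measurableSet_evB d g)]
    rw [Finset.sum_const, nsmul_eq_mul]
  · intro f _ f' _ hne
    refine Set.disjoint_left.2 ?_
    rintro ω ⟨h1, -⟩ ⟨h2, -⟩
    rw [mem_cyl_append] at h1 h2
    exact hne (funext fun i => by rw [← h1.1 i, ← h2.1 i])
  · intro f _
    exact (measurableSet_cyl _ _).inter (measurable_shift _ (measurableSet_evB d g))

lemma measurableSet_evD (d : ℕ) {m : ℕ} (g : Fin m → Fin d × Bool) (k : ℕ) :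
    MeasurableSet (evD d g k) :=
  (measurableSet_evA d g k).inter (measurable_shift _ (measurableSet_evB d g))

lemma evD_disj (d : ℕ) {m : ℕ} (g : Fin m → Fin d × Bool) (hg : ∑ i, sv d (g i) = 0)
    {k k' : ℕ} (h : k + m ≤ k') : Disjoint (evD d g k) (evD d g k') := by
  refine Set.disjoint_left.2 ?_
  rintro ω ⟨h1, h2⟩ ⟨h3, -⟩
  obtain ⟨j, rfl⟩ := Nat.exists_eq_add_of_le h
  exact (Set.mem_iInter.1 h2 j) ((shift_evA d g hg k j ω h1).2 h3)

lemma evB_null (d : ℕ) {m : ℕ} (hm : 0 < m) (g : Fin m → Fin d × Bool)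
    (hg : ∑ i, sv d (g i) = 0)
    (hl : ∀ N, 0 < N → (2 * d) ^ (2 * N) ≤ 4 * N * (loops d (2 * N)).card)
    (μ : Measure (ℕ → Fin d × Bool)) (hμ : IsUniformBernoulli (Fin d × Bool) μ) :
    μ (evB d g) = 0 := by
  have := hμ.1
  by_contra hr
  set c : ENNReal := (Fintype.card (Fin d × Bool) : ENNReal) with hc
  have hS : 0 < Fintype.card (Fin d × Bool) := Fintype.card_pos_iff.2 ⟨g ⟨0, hm⟩⟩
  have hc0 : c ≠ 0 := by rw [hc]; exact_mod_cast hS.ne'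
  have hct : c ≠ ⊤ := by rw [hc]; exact ENNReal.natCast_ne_top _
  set q : ENNReal := c⁻¹ ^ m * μ (evB d g) with hq
  have hq0 : q ≠ 0 := mul_ne_zero (pow_ne_zero _ (ENNReal.inv_ne_zero.2 hct)) hr
  have hlow : ∀ n : ℕ, ((n + 1 : ℕ) : ENNReal)⁻¹ * ((4 * m : ℕ) : ENNReal)⁻¹ * q ≤
      μ (evD d g (2 * (m * (n + 1)))) := by
    intro n
    refine le_trans ?_ (measure_evD d g μ hμ _)
    have e : ((loops d (2 * (m * (n + 1)))).card : ENNReal) *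
        (c⁻¹ ^ (2 * (m * (n + 1)) + m) * μ (evB d g)) =
        ((loops d (2 * (m * (n + 1)))).card : ENNReal) * c⁻¹ ^ (2 * (m * (n + 1))) * q := by
      rw [hq]; ring
    rw [← hc, e]
    refine mul_le_mul' ?_ le_rfl
    have h1 := hl (m * (n + 1)) (by positivity)
    have hcd : c = ((2 * d : ℕ) : ENNReal) := by
      rw [hc]; simp [mul_comm]
    have h2 : c ^ (2 * (m * (n + 1))) ≤
        ((n + 1 : ℕ) : ENNReal) * ((4 * m : ℕ) : ENNReal) * ((loops d (2 * (m * (n + 1)))).card : ENNReal) := by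
      rw [hcd]
      have h3 : (2 * d) ^ (2 * (m * (n + 1))) ≤
        (n + 1) * (4 * m) * (loops d (2 * (m * (n + 1)))).card := by
        refine h1.trans (le_of_eq ?_); ring
      exact_mod_cast h3
    rw [← ENNReal.mul_inv (by simp) (by simp), ← ENNReal.inv_pow, ← div_eq_mul_inv]
    rw [ENNReal.le_div_iff_mul_le (Or.inl (pow_ne_zero _ hc0)) (Or.inl (ENNReal.pow_ne_top hct))]
    rw [mul_comm, ← div_eq_mul_inv]
    refine ENNReal.div_le_of_le_mul ?_
    rwa [mul_comm (Finset.card _ : ENNReal)]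
  have hsum : ∑' n : ℕ, μ (evD d g (2 * (m * (n + 1)))) ≤ 1 := by
    rw [← measure_iUnion]
    · exact prob_le_one
    · have key : ∀ a b : ℕ, a < b →
          Disjoint (evD d g (2 * (m * (a + 1)))) (evD d g (2 * (m * (b + 1)))) := by
        intro a b hab
        apply evD_disj d g hg
        nlinarith [Nat.mul_le_mul_left m (Nat.succ_le_of_lt hab)]
      intro a b hab
      rcases lt_or_gt_of_ne hab with h | h
      · exact key a b h
      · exact (key b a h).symm
    · exact fun n => measurableSet_evD d g _
  have htop : ∑' n : ℕ, ((n + 1 : ℕ) : ENNReal)⁻¹ * ((4 * m : ℕ) : ENNReal)⁻¹ * q = ⊤ := by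
    simp_rw [mul_assoc]
    rw [ENNReal.tsum_mul_right]
    have h1 : ∑' n : ℕ, ((n + 1 : ℕ) : ENNReal)⁻¹ = ⊤ := by
      by_contra hne
      have h2 : Summable (fun n : ℕ => (((n + 1 : ℕ) : ENNReal)⁻¹).toReal) :=
        ENNReal.summable_toReal hne
      have h3 : Summable (fun n : ℕ => ((n + 1 : ℕ) : ℝ)⁻¹) := by
        refine h2.congr fun n => ?_
        rw [ENNReal.toReal_inv, ENNReal.toReal_natCast]
      have h4 := (summable_nat_add_iff (f := fun n : ℕ => (n : ℝ)⁻¹) 1).1 h3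
      exact Real.not_summable_natCast_inv h4
    rw [h1]
    exact ENNReal.top_mul (mul_ne_zero (ENNReal.inv_ne_zero.2 (ENNReal.natCast_ne_top _)) hq0)
  have := (ENNReal.tsum_le_tsum hlow).trans hsum
  rw [htop] at this
  simp at this

lemma evA_io (d : ℕ) {m : ℕ} (hm : 0 < m) (g : Fin m → Fin d × Bool)
    (hg : ∑ i, sv d (g i) = 0)
    (hl : ∀ N, 0 < N → (2 * d) ^ (2 * N) ≤ 4 * N * (loops d (2 * N)).card)
    (μ : Measure (ℕ → Fin d × Bool)) (hμ : IsUniformBernoulli (Fin d × Bool) μ) :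
    ∀ᵐ ω ∂μ, {j | ω ∈ evA d g j}.Infinite := by
  have h0 := evB_null d hm g hg hl μ hμ
  have h1 : ∀ᵐ ω ∂μ, ω ∉ evB d g := measure_eq_zero_iff_ae_notMem.1 h0
  have h2 : ∀ᵐ ω ∂μ, ∀ k, (fun l => ω (k + l)) ∉ evB d g :=
    ae_all_iff.2 fun k =>
      measure_eq_zero_iff_ae_notMem.1 (shift_null hμ k (measurableSet_evB d g) h0)
  filter_upwards [h1, h2] with ω h1 h2
  simp only [evB, Set.mem_iInter, Set.mem_compl_iff, not_forall, not_not] at h1 h2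
  obtain ⟨j0, hj0⟩ := h1
  intro hfin
  obtain ⟨k, hk, hmax⟩ := hfin.exists_maximal ⟨j0, hj0⟩
  obtain ⟨j, hj⟩ := h2 (k + m)
  have h3 := (shift_evA d g hg k j ω hk).1 hj
  have := hmax h3 (by omega)
  omega

lemma central_sq (N : ℕ) (hN : 0 < N) : 16 ^ N ≤ 4 * N * N.centralBinom ^ 2 := by
  induction N, hN using Nat.le_induction with
  | base => decide
  | succ n hn ih =>
    have h := Nat.succ_mul_centralBinom_succ n
    have h2 : (n + 1) * (16 ^ (n + 1)) ≤ (n + 1) * (4 * (n + 1) * (n + 1).centralBinom ^ 2) := by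
      calc (n + 1) * (16 ^ (n + 1)) = 16 * (n + 1) * 16 ^ n := by ring
        _ ≤ 16 * (n + 1) * (4 * n * n.centralBinom ^ 2) := by gcongr
        _ = 16 * (4 * n * (n + 1)) * n.centralBinom ^ 2 := by ring
        _ ≤ 16 * ((2 * n + 1) ^ 2) * n.centralBinom ^ 2 := by gcongr; nlinarith
        _ = 4 * (2 * (2 * n + 1) * n.centralBinom) ^ 2 := by ring
        _ = 4 * ((n + 1) * (n + 1).centralBinom) ^ 2 := by rw [h]
        _ = _ := by ring
    exact Nat.le_of_mul_le_mul_left h2 (by omega)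

lemma sum_sign (N : ℕ) (A : Finset (Fin (2 * N))) (hA : A.card = N) :
    ∑ i, (if i ∈ A then (1 : ℤ) else -1) = 0 := by
  have : ∀ i, (if i ∈ A then (1 : ℤ) else -1) = 2 * (if i ∈ A then 1 else 0) - 1 := by
    intro i; split_ifs <;> norm_num
  simp_rw [this]
  rw [Finset.sum_sub_distrib, ← Finset.mul_sum]
  simp [hA]

lemma loops_one (N : ℕ) (hN : 0 < N) :
    (2 * 1) ^ (2 * N) ≤ 4 * N * (loops 1 (2 * N)).card := by
  have h1 : N.centralBinom ≤ (loops 1 (2 * N)).card := by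
    have : (Finset.powersetCard N (Finset.univ : Finset (Fin (2 * N)))).card = N.centralBinom := by
      simp [Nat.centralBinom]
    rw [← this]
    refine Finset.card_le_card_of_injOn
      (fun A i => ((0 : Fin 1), decide (i ∈ A))) ?_ ?_
    · intro A hA
      have hA' : A.card = N := by simpa using hA
      simp only [loops, Finset.coe_filter, Finset.mem_univ, true_and, Set.mem_ofPred_eq]
      funext j
      rw [Finset.sum_apply]
      have := sum_sign N A hA'
      rw [Pi.zero_apply, ← this]
      refine Finset.sum_congr rfl fun i _ => ?_
      fin_cases j
      by_cases h : i ∈ A <;> simp [sv, latE, h]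
    · intro A _ B _ hAB
      ext i
      have := congrFun hAB i
      simpa using this
  have h2 := Nat.four_pow_le_two_mul_self_mul_centralBinom N hN
  rw [pow_mul]
  norm_num
  nlinarith

lemma loops_two (N : ℕ) (hN : 0 < N) :
    (2 * 2) ^ (2 * N) ≤ 4 * N * (loops 2 (2 * N)).card := by
  have h1 : N.centralBinom ^ 2 ≤ (loops 2 (2 * N)).card := by
    have : ((Finset.powersetCard N (Finset.univ : Finset (Fin (2 * N)))) ×ˢ
        (Finset.powersetCard N (Finset.univ : Finset (Fin (2 * N))))).card
        = N.centralBinom ^ 2 := by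
      simp [Nat.centralBinom, sq]
    rw [← this]
    refine Finset.card_le_card_of_injOn
      (fun A i => ((if (i ∈ A.1 ↔ i ∈ A.2) then 0 else 1 : Fin 2), decide (i ∈ A.1))) ?_ ?_
    · rintro ⟨A, B⟩ hA
      have hA' : A.card = N ∧ B.card = N := by simpa using hA
      simp only [loops, Finset.coe_filter, Finset.mem_univ, true_and, Set.mem_ofPred_eq]
      have sA := sum_sign N A hA'.1
      have sB := sum_sign N B hA'.2
      funext j
      rw [Finset.sum_apply, Pi.zero_apply]
      have h2 : ∀ x : ℤ, 2 * x = 0 → x = 0 := by intro x; omega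
      apply h2
      rw [Finset.mul_sum]
      fin_cases j
      · rw [← add_zero (0 : ℤ)]
        nth_rewrite 1 [← sA]
        rw [← sB, ← Finset.sum_add_distrib]
        refine Finset.sum_congr rfl fun i _ => ?_
        by_cases h : i ∈ A <;> by_cases h' : i ∈ B <;> simp [sv, latE, h, h']
      · rw [← sub_zero (0 : ℤ)]
        nth_rewrite 1 [← sA]
        rw [← sB, ← Finset.sum_sub_distrib]
        refine Finset.sum_congr rfl fun i _ => ?_
        by_cases h : i ∈ A <;> by_cases h' : i ∈ B <;> simp [sv, latE, h, h']
    · rintro ⟨A, B⟩ _ ⟨A', B'⟩ _ hAB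
      have key : ∀ i, (i ∈ A ↔ i ∈ A') ∧ (i ∈ B ↔ i ∈ B') := by
        intro i
        have := congrFun hAB i
        simp only [Prod.mk.injEq, decide_eq_decide] at this
        obtain ⟨h3, h4⟩ := this
        by_cases ha : i ∈ A <;> by_cases hb : i ∈ B <;> by_cases hc : i ∈ A' <;>
          by_cases hd : i ∈ B' <;> simp_all
      rw [Prod.mk.injEq]
      exact ⟨Finset.ext fun i => (key i).1, Finset.ext fun i => (key i).2⟩
  have h2 := central_sq N hN
  rw [pow_mul]
  norm_num
  exact h2.trans (Nat.mul_le_mul_left _ h1)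

lemma exists_word (d : ℕ) (v : Pt d) : ∃ w : List (Fin d × Bool), (w.map (sv d)).sum = v := by
  let M : AddSubmonoid (Pt d) :=
    { carrier := {v | ∃ w : List (Fin d × Bool), (w.map (sv d)).sum = v}
      zero_mem' := ⟨[], rfl⟩
      add_mem' := by
        rintro _ _ ⟨a, rfl⟩ ⟨b, rfl⟩
        exact ⟨a ++ b, by simp⟩ }
  have hp : ∀ i, latE d i ∈ M := fun i => ⟨[(i, true)], by simp [sv]⟩
  have hn : ∀ i, -latE d i ∈ M := fun i => ⟨[(i, false)], by simp [sv]⟩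
  have hz : ∀ i (z : ℤ), z • latE d i ∈ M := by
    intro i z
    rcases Int.eq_nat_or_neg z with ⟨n, rfl | rfl⟩
    · rw [natCast_zsmul]; exact M.nsmul_mem (hp i) n
    · rw [neg_smul, natCast_zsmul, ← smul_neg]; exact M.nsmul_mem (hn i) n
  have hv : v = ∑ i, v i • latE d i := by
    funext j
    simp [Finset.sum_apply, latE]
  have : v ∈ M := by
    rw [hv]; exact M.sum_mem fun i _ => hz i _
  exact this

lemma walkPos_list (d : ℕ) (w : List (Fin d × Bool)) : ∀ (ω : ℕ → Fin d × Bool) (j : ℕ),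
    (∀ l (h : l < w.length), ω (j + l) = w[l]) →
    walkPos d ω (j + w.length) = walkPos d ω j + (w.map (sv d)).sum := by
  induction w with
  | nil => intro ω j _; simp
  | cons a w ih =>
    intro ω j h
    have h0 := h 0 (by simp)
    have h1 := ih ω (j + 1) (fun l hl => by
      have := h (l + 1) (by simpa using hl)
      simp only [List.getElem_cons_succ] at this
      rw [← this]; congr 1; ring)
    have e : j + (a :: w).length = j + 1 + w.length := by simp; ring
    rw [e, h1]
    simp only [add_zero, List.getElem_cons_zero] at h0
    simp [walkPos, stepFn, h0, sv, add_assoc]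

/-- For `d ∈ {1,2}`, almost every trajectory of the simple random walk
on `ℤ^d` traverses every oriented edge `(v,i)` infinitely often in each direction. -/
theorem simple_walk_recurrent_edges (d : ℕ) (hd : d = 1 ∨ d = 2)
    (μ : MeasureTheory.Measure (ℕ → Fin d × Bool))
    (hμ : IsUniformBernoulli (Fin d × Bool) μ) :
    ∀ᵐ ω ∂μ, ∀ (v : Pt d) (i : Fin d),
      {n : ℕ | walkPos d ω n = v ∧ walkPos d ω (n + 1) = v + latE d i}.Infinite ∧
      {n : ℕ | walkPos d ω n = v + latE d i ∧ walkPos d ω (n + 1) = v}.Infinite := by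
  have hl : ∀ N, 0 < N → (2 * d) ^ (2 * N) ≤ 4 * N * (loops d (2 * N)).card := by
    rcases hd with rfl | rfl
    · exact loops_one
    · exact loops_two
  rw [ae_all_iff]
  intro v
  rw [ae_all_iff]
  intro i
  obtain ⟨a, ha⟩ := exists_word d v
  obtain ⟨b, hb⟩ := exists_word d (-v)
  set w : List (Fin d × Bool) := a ++ (i, true) :: (i, false) :: b with hw
  have hsum : ∑ k : Fin w.length, sv d (w.get k) = 0 := by
    have h1 : (w.map (sv d)).sum = 0 := by
      simp [hw, ha, hb, sv]
    rw [← h1, ← Fin.sum_univ_fun_getElem]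
    rfl
  filter_upwards [evA_io d (by simp [hw]) w.get hsum hl μ hμ] with ω hω
  have key : ∀ j, ω ∈ evA d w.get j →
      walkPos d ω (j + a.length) = v ∧ walkPos d ω (j + a.length + 1) = v + latE d i ∧
      walkPos d ω (j + a.length + 1 + 1) = v := by
    rintro j ⟨h0, h1⟩
    have h1' : ∀ l (h : l < w.length), ω (j + l) = w[l] := fun l h => h1 ⟨l, h⟩
    have e1 : walkPos d ω (j + a.length) = v := by
      rw [walkPos_list d a ω j, h0, ha, zero_add]
      intro l hla
      rw [h1' l (by simp [hw]; omega)]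
      simp [hw, hla]
    have e2 : ω (j + a.length) = (i, true) := by
      rw [h1' a.length (by simp [hw])]
      simp [hw]
    have e3 : ω (j + a.length + 1) = (i, false) := by
      rw [add_assoc, h1' (a.length + 1) (by simp [hw])]
      simp [hw]
    have e4 : walkPos d ω (j + a.length + 1) = v + latE d i := by
      simp [walkPos, e1, e2, stepFn]
    refine ⟨e1, e4, ?_⟩
    rw [walkPos, e4, e3]
    simp [stepFn]
  constructor
  · refine (hω.image (f := fun j => j + a.length) (fun x _ y _ h => by simpa using h)).mono ?_
    rintro _ ⟨j, hj, rfl⟩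
    exact ⟨(key j hj).1, (key j hj).2.1⟩
  · refine (hω.image (f := fun j => j + a.length + 1) (fun x _ y _ h => by simpa using h)).mono ?_
    rintro _ ⟨j, hj, rfl⟩
    exact ⟨(key j hj).2.1, (key j hj).2.2⟩
end

section
/- Let d ∈ {1,2} and let S ⊂ Sol_d be the symmetric set consisting of the images of x_1,…,x_d and their inverses. Every bounded μ-harmonic function on Sol_d, where μ is the uniform measure on S, is constant; i.e., if h : Sol_d → ℝ is bounded and satisfies h(g) = (2d)^{−1} Σ_{s∈S} h(gs) for all g ∈ Sol_d, then h is constant. -/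
/-- The free metabelian group on `d` generators: `F_d / F_d''`. -/
abbrev Sold (d : ℕ) : Type :=
  FreeGroup (Fin d) ⧸ derivedSeries (FreeGroup (Fin d)) 2

instance (d : ℕ) : (derivedSeries (FreeGroup (Fin d)) 2).Normal :=
  derivedSeries_normal _ _

/-- The `2d` elements of the symmetric generating set of `Sol_d`: the images of the free
generators `x_i` and of their inverses. -/
def solGen (d : ℕ) (s : Fin d × Bool) : Sold d :=
  if s.2 then QuotientGroup.mk (FreeGroup.of s.1)
  else QuotientGroup.mk (FreeGroup.of s.1)⁻¹

open Filter Topology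

/-- The recurrence certificate: `log (x^2+y^2-1)` is strictly superharmonic far away. -/
lemma log_superharm (x y : ℝ) (h : 9 < x ^ 2 + y ^ 2) :
    Real.log ((x + 1) ^ 2 + y ^ 2 - 1) + Real.log ((x - 1) ^ 2 + y ^ 2 - 1)
      + Real.log (x ^ 2 + (y + 1) ^ 2 - 1) + Real.log (x ^ 2 + (y - 1) ^ 2 - 1)
      < 4 * Real.log (x ^ 2 + y ^ 2 - 1) := by
  have h1 : 0 < (x + 1) ^ 2 + y ^ 2 - 1 := by nlinarith [sq_nonneg (x + 2), sq_nonneg y]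
  have h2 : 0 < (x - 1) ^ 2 + y ^ 2 - 1 := by nlinarith [sq_nonneg (x - 2), sq_nonneg y]
  have h3 : 0 < x ^ 2 + (y + 1) ^ 2 - 1 := by nlinarith [sq_nonneg (y + 2), sq_nonneg x]
  have h4 : 0 < x ^ 2 + (y - 1) ^ 2 - 1 := by nlinarith [sq_nonneg (y - 2), sq_nonneg x]
  have h0 : 0 < x ^ 2 + y ^ 2 - 1 := by linarith
  rw [← Real.log_mul h1.ne' h2.ne', ← Real.log_mul (by positivity) h3.ne',
    ← Real.log_mul (by positivity) h4.ne']
  have e : 4 * Real.log (x ^ 2 + y ^ 2 - 1) = Real.log ((x ^ 2 + y ^ 2 - 1) ^ 4) := by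
    rw [Real.log_pow]; norm_num
  rw [e]
  apply Real.log_lt_log (by positivity)
  have e2 : ((x + 1) ^ 2 + y ^ 2 - 1) * ((x - 1) ^ 2 + y ^ 2 - 1) * (x ^ 2 + (y + 1) ^ 2 - 1)
      * (x ^ 2 + (y - 1) ^ 2 - 1)
      = (x ^ 2 + y ^ 2 - 1) ^ 4 - 2 * (x ^ 2 + y ^ 2 - 1) ^ 2 + 1 - 4 * (x ^ 2 - y ^ 2) ^ 2 := by
    ring
  rw [e2]
  nlinarith [sq_nonneg (x ^ 2 - y ^ 2)]

lemma finite_disc (B : ℝ) : {p : ℤ × ℤ | (p.1 : ℝ) ^ 2 + (p.2 : ℝ) ^ 2 ≤ B}.Finite := by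
  obtain ⟨n, hn⟩ := exists_nat_ge B
  apply (Set.finite_Icc ((-(n : ℤ), -(n : ℤ)) : ℤ × ℤ) ((n : ℤ), (n : ℤ))).subset
  rintro ⟨x, y⟩ hp
  have hp' : (x : ℝ) ^ 2 + (y : ℝ) ^ 2 ≤ n := le_trans hp hn
  have hp2 : x ^ 2 + y ^ 2 ≤ (n : ℤ) := by exact_mod_cast hp'
  have hx : |x| ≤ n := by
    have : |x| ≤ x ^ 2 := by
      rw [← sq_abs x]
      exact Int.le_self_sq |x|
    nlinarith [sq_nonneg y]
  have hy : |y| ≤ n := by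
    have : |y| ≤ y ^ 2 := by
      rw [← sq_abs y]
      exact Int.le_self_sq |y|
    nlinarith [sq_nonneg x]
  rw [abs_le] at hx hy
  exact ⟨⟨hx.1, hy.1⟩, ⟨hx.2, hy.2⟩⟩

lemma psi_nonneg (x y : ℤ) : 0 ≤ Real.log ((x : ℝ) ^ 2 + (y : ℝ) ^ 2 - 1) := by
  have : ((x : ℝ) ^ 2 + (y : ℝ) ^ 2 - 1) = ((x ^ 2 + y ^ 2 - 1 : ℤ) : ℝ) := by push_cast; ring
  rw [this]
  exact Real.log_intCast_nonneg _

/-- A subharmonic function on `ℤ²` which is bounded above is constant. -/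
lemma subharm_const (f : ℤ × ℤ → ℝ) (C : ℝ) (hC : ∀ p, f p ≤ C)
    (hs : ∀ x y, 4 * f (x, y) ≤ f (x + 1, y) + f (x - 1, y) + f (x, y + 1) + f (x, y - 1)) :
    ∀ p q, f p = f q := by
  obtain ⟨p0, -, hp0⟩ := Set.exists_max_image _ f (finite_disc 9) ⟨(0, 0), by simp⟩
  have key : ∀ q, f q ≤ f p0 := by
    intro q
    by_contra! hq
    set ψ : ℤ × ℤ → ℝ := fun p => Real.log ((p.1 : ℝ) ^ 2 + (p.2 : ℝ) ^ 2 - 1) with hψ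
    have hψ0 : ∀ p, 0 ≤ ψ p := fun p => psi_nonneg p.1 p.2
    obtain ⟨ε, hε, hεq⟩ : ∃ ε : ℝ, 0 < ε ∧ f p0 < f q - ε * ψ q := by
      refine ⟨(f q - f p0) / (ψ q + 1), div_pos (by linarith) (by linarith [hψ0 q]), ?_⟩
      have h1 : 0 < ψ q + 1 := by linarith [hψ0 q]
      have h2 : (f q - f p0) / (ψ q + 1) * (ψ q + 1) = f q - f p0 := by field_simp
      have h3 : 0 < (f q - f p0) / (ψ q + 1) := div_pos (by linarith) h1
      nlinarith
    set g : ℤ × ℤ → ℝ := fun p => f p - ε * ψ p with hg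
    have hfin : {p | g q ≤ g p}.Finite := by
      apply (finite_disc (max 9 (Real.exp ((C - g q) / ε) + 1))).subset
      intro p hp
      simp only [Set.mem_ofPred_eq] at hp ⊢
      by_cases h9 : (p.1 : ℝ) ^ 2 + (p.2 : ℝ) ^ 2 ≤ 9
      · exact le_max_of_le_left h9
      · apply le_max_of_le_right
        push Not at h9
        have h1 : ψ p ≤ (C - g q) / ε := by
          rw [le_div_iff₀ hε]
          have := hC p
          simp only [hg] at hp ⊢
          linarith
        have h2 := (Real.log_le_iff_le_exp (by linarith)).1 h1
        linarith
    obtain ⟨⟨x, y⟩, hp1, hp1'⟩ := Set.exists_max_image _ g hfin ⟨q, le_refl (g q)⟩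
    have hmax : ∀ p, g p ≤ g (x, y) := by
      intro p
      by_cases h : g q ≤ g p
      · exact hp1' p h
      · exact (not_le.1 h).le.trans hp1
    have hout : 9 < (x : ℝ) ^ 2 + (y : ℝ) ^ 2 := by
      by_contra! h
      have h1 := hp0 (x, y) h
      have h2 : g q ≤ g (x, y) := hp1
      have h3 := mul_nonneg hε.le (hψ0 (x, y))
      simp only [hg] at h2
      linarith
    have hl := log_superharm x y hout
    have a1 := hmax (x + 1, y)
    have a2 := hmax (x - 1, y)
    have a3 := hmax (x, y + 1)
    have a4 := hmax (x, y - 1)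
    have hs' := hs x y
    have hl' := mul_lt_mul_of_pos_left hl hε
    simp only [hg, hψ] at a1 a2 a3 a4
    push_cast at a1 a2 a3 a4
    linarith
  have nb : ∀ x y, f (x, y) = f p0 → f (x + 1, y) = f p0 ∧ f (x - 1, y) = f p0 ∧
      f (x, y + 1) = f p0 ∧ f (x, y - 1) = f p0 := by
    intro x y h
    have := hs x y
    have a1 := key (x + 1, y)
    have a2 := key (x - 1, y)
    have a3 := key (x, y + 1)
    have a4 := key (x, y - 1)
    refine ⟨?_, ?_, ?_, ?_⟩ <;> linarith
  have hx : ∀ k : ℤ, f (p0.1 + k, p0.2) = f p0 := by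
    intro k
    induction k using Int.induction_on with
    | zero => simp
    | succ i ih => rw [← add_assoc]; exact (nb _ _ ih).1
    | pred i ih => rw [← add_sub_assoc]; exact (nb _ _ ih).2.1
  have hy : ∀ k l : ℤ, f (p0.1 + k, p0.2 + l) = f p0 := by
    intro k l
    induction l using Int.induction_on with
    | zero => simpa using hx k
    | succ i ih => rw [← add_assoc]; exact (nb _ _ ih).2.2.1
    | pred i ih => rw [← add_sub_assoc]; exact (nb _ _ ih).2.2.2
  have all : ∀ p, f p = f p0 := by
    rintro ⟨x, y⟩
    have := hy (x - p0.1) (y - p0.2)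
    simpa using this
  intro p q
  rw [all p, all q]

/-- Harmonicity with respect to `a, a⁻¹, b, b⁻¹`. -/
def Harm4 {G : Type*} [Group G] (a b : G) (F : G → ℝ) : Prop :=
  ∀ g, 4 * F g = F (g * a) + F (g * a⁻¹) + F (g * b) + F (g * b⁻¹)

lemma rec_max {G Q : Type*} [Group G] [CommGroup Q] (p : G →* Q) (a b : G)
    (hgen : Subgroup.closure {a, b} = (⊤ : Subgroup G)) (F : G → ℝ) (hF : Harm4 a b F)
    (C : ℝ) (hC : ∀ g, F g ≤ C) (M : ℝ) (hM : ∀ g ∈ p.ker, F g ≤ M) (g : G) : F g ≤ M := by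
  have hne : ∀ z : ℤ × ℤ, ∃ g, p g = p a ^ z.1 * p b ^ z.2 := fun z =>
    ⟨a ^ z.1 * b ^ z.2, by simp⟩
  have hsurj : ∀ g, ∃ z : ℤ × ℤ, p g = p a ^ z.1 * p b ^ z.2 := by
    intro g
    have hg : g ∈ Subgroup.closure {a, b} := by rw [hgen]; trivial
    induction hg using Subgroup.closure_induction with
    | mem x hx =>
      rcases hx with rfl | rfl
      · exact ⟨(1, 0), by simp⟩
      · exact ⟨(0, 1), by simp⟩
    | one => exact ⟨(0, 0), by simp⟩
    | mul x y _ _ ihx ihy =>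
      obtain ⟨z, hz⟩ := ihx
      obtain ⟨w, hw⟩ := ihy
      refine ⟨z + w, ?_⟩
      rw [map_mul, hz, hw, Prod.fst_add, Prod.snd_add, zpow_add, zpow_add]
      exact mul_mul_mul_comm _ _ _ _
    | inv x _ ih =>
      obtain ⟨z, hz⟩ := ih
      refine ⟨-z, ?_⟩
      rw [map_inv, hz]
      simp [mul_comm]
  set Φ : ℤ × ℤ → ℝ := fun z => sSup (F '' {g | p g = p a ^ z.1 * p b ^ z.2}) with hΦ
  have hbdd : ∀ z : ℤ × ℤ, BddAbove (F '' {g | p g = p a ^ z.1 * p b ^ z.2}) := by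
    intro z
    refine ⟨C, ?_⟩
    rintro _ ⟨g, -, rfl⟩
    exact hC g
  have hle : ∀ (z : ℤ × ℤ) g, p g = p a ^ z.1 * p b ^ z.2 → F g ≤ Φ z := fun z g hg =>
    le_csSup (hbdd z) ⟨g, hg, rfl⟩
  have hsup : ∀ (z : ℤ × ℤ) (B : ℝ), (∀ g, p g = p a ^ z.1 * p b ^ z.2 → F g ≤ B) → Φ z ≤ B := by
    intro z B hB
    apply csSup_le
    · obtain ⟨g, hg⟩ := hne z
      exact ⟨_, g, hg, rfl⟩
    · rintro _ ⟨g, hg, rfl⟩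
      exact hB g hg
  have hconst := subharm_const Φ C (fun z => hsup z C fun g _ => hC g) (by
    intro x y
    have : Φ (x, y) ≤ (Φ (x + 1, y) + Φ (x - 1, y) + Φ (x, y + 1) + Φ (x, y - 1)) / 4 := by
      apply hsup
      intro g hg
      simp only at hg
      have a1 := hle (x + 1, y) (g * a) (by
        simp only [map_mul, hg, zpow_add_one]; exact mul_right_comm _ _ _)
      have a2 := hle (x - 1, y) (g * a⁻¹) (by
        simp only [map_mul, map_inv, hg, zpow_sub_one]; exact mul_right_comm _ _ _)
      have a3 := hle (x, y + 1) (g * b) (by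
        simp only [map_mul, hg, zpow_add_one]; exact mul_assoc _ _ _)
      have a4 := hle (x, y - 1) (g * b⁻¹) (by
        simp only [map_mul, map_inv, hg, zpow_sub_one]; exact mul_assoc _ _ _)
      have := hF g
      linarith
    linarith)
  obtain ⟨z, hz⟩ := hsurj g
  calc F g ≤ Φ z := hle z g hz
    _ = Φ (0, 0) := hconst _ _
    _ ≤ M := hsup _ _ (fun g hg => hM g (by simpa [MonoidHom.mem_ker] using hg))

lemma strong_max {G : Type*} [Group G] (a b : G)
    (hgen : Subgroup.closure {a, b} = (⊤ : Subgroup G)) (F : G → ℝ) (hF : Harm4 a b F)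
    (M : ℝ) (hM : ∀ g, F g ≤ M) (h1 : F 1 = M) (g : G) : F g = M := by
  have nb : ∀ g, F g = M → F (g * a) = M ∧ F (g * a⁻¹) = M ∧ F (g * b) = M ∧ F (g * b⁻¹) = M := by
    intro g hg
    have := hF g
    have a1 := hM (g * a)
    have a2 := hM (g * a⁻¹)
    have a3 := hM (g * b)
    have a4 := hM (g * b⁻¹)
    refine ⟨?_, ?_, ?_, ?_⟩ <;> linarith
  have hg : g ∈ Subgroup.closure {a, b} := by rw [hgen]; trivial
  induction hg using Subgroup.closure_induction_right with
  | one => exact h1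
  | mul_right x hx y hy ih =>
    rcases hy with rfl | rfl
    · exact (nb _ ih).1
    · exact (nb _ ih).2.2.1
  | mul_inv_cancel x hx y hy ih =>
    rcases hy with rfl | rfl
    · exact (nb _ ih).2.1
    · exact (nb _ ih).2.2.2

lemma ker_step {G Q : Type*} [Group G] [CommGroup Q] (p : G →* Q) (a b : G)
    (hgen : Subgroup.closure {a, b} = (⊤ : Subgroup G))
    (hcomm : ∀ u ∈ p.ker, ∀ v ∈ p.ker, u * v = v * u)
    (h : G → ℝ) (hh : Harm4 a b h) (C : ℝ) (hC : ∀ g, |h g| ≤ C)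
    (u : G) (hu : u ∈ p.ker) (v : G) (hv : v ∈ p.ker) : h (u * v) ≤ h v := by
  set T : Set ℝ := (fun v => h (u * v) - h v) '' (p.ker : Set G) with hT
  have hTb : BddAbove T := by
    refine ⟨2 * C, ?_⟩
    rintro _ ⟨w, -, rfl⟩
    have h1 := abs_le.1 (hC (u * w))
    have h2 := abs_le.1 (hC w)
    simp only
    linarith
  have hTne : T.Nonempty := ⟨_, 1, p.ker.one_mem, rfl⟩
  set M := sSup T with hM
  have hex : ∀ n : ℕ, ∃ w ∈ p.ker, M - 1 / ((n : ℝ) + 1) < h (u * w) - h w := by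
    intro n
    have hpos : (0 : ℝ) < 1 / ((n : ℝ) + 1) := by positivity
    obtain ⟨_, ⟨w, hw, rfl⟩, hlt⟩ := exists_lt_of_lt_csSup hTne (sub_lt_self M hpos)
    exact ⟨w, hw, hlt⟩
  choose w hw hwM using hex
  have hlim : ∀ g, ∃ L, Tendsto (fun n => h (w n * g)) (hyperfilter ℕ : Filter ℕ) (𝓝 L) := by
    intro g
    obtain ⟨L, -, hL⟩ := (isCompact_Icc (a := -C) (b := C)).ultrafilter_le_nhds
      ((hyperfilter ℕ).map (fun n => h (w n * g))) (by
        rw [le_principal_iff]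
        have hm : ∀ᶠ n in (hyperfilter ℕ : Filter ℕ), h (w n * g) ∈ Set.Icc (-C) C :=
          Filter.Eventually.of_forall (fun n => abs_le.1 (hC (w n * g)))
        exact hm)
    exact ⟨L, hL⟩
  choose H hH using hlim
  have hHh : Harm4 a b H := by
    intro g
    refine tendsto_nhds_unique ((hH g).const_mul 4) ?_
    have := (((hH (g * a)).add (hH (g * a⁻¹))).add (hH (g * b))).add (hH (g * b⁻¹))
    refine this.congr (fun n => ?_)
    have := hh (w n * g)
    simp only [mul_assoc] at this ⊢
    exact this.symm
  have hHC : ∀ g, |H g| ≤ C := fun g =>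
    le_of_tendsto (hH g).abs (Filter.Eventually.of_forall fun n => hC _)
  set F : G → ℝ := fun g => H (u * g) - H g with hFdef
  have hFh : Harm4 a b F := by
    intro g
    have h1 := hHh (u * g)
    have h2 := hHh g
    simp only [hFdef, ← mul_assoc]
    linarith
  have hFt : ∀ g, Tendsto (fun n => h (u * (w n * g)) - h (w n * g)) (hyperfilter ℕ : Filter ℕ)
      (𝓝 (F g)) := by
    intro g
    refine ((hH (u * g)).sub (hH g)).congr (fun n => ?_)
    rw [← mul_assoc, ← mul_assoc, hcomm _ (hw n) u hu]
  have hFker : ∀ g ∈ p.ker, F g ≤ M := fun g hg =>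
    le_of_tendsto (hFt g) (Filter.Eventually.of_forall fun n =>
      le_csSup hTb ⟨w n * g, p.ker.mul_mem (hw n) hg, rfl⟩)
  have hFM : ∀ g, F g ≤ M := rec_max p a b hgen F hFh (2 * C) (by
    intro g
    have h1 := abs_le.1 (hHC (u * g))
    have h2 := abs_le.1 (hHC g)
    simp only [hFdef]
    linarith) M hFker
  have hF1 : F 1 = M := by
    apply le_antisymm (hFM 1)
    have ht : Tendsto (fun n : ℕ => M - 1 / ((n : ℝ) + 1)) (hyperfilter ℕ : Filter ℕ)
        (𝓝 (M - 0)) := by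
      refine (tendsto_const_nhds.sub tendsto_one_div_add_atTop_nhds_zero_nat).mono_left ?_
      exact Nat.hyperfilter_le_atTop
    rw [sub_zero] at ht
    refine le_of_tendsto_of_tendsto' ht (hFt 1) (fun n => ?_)
    rw [mul_one]
    exact (hwM n).le
  have hall := strong_max a b hgen F hFh M hFM hF1
  have hpow : ∀ k : ℕ, H (u ^ k) = H 1 + k * M := by
    intro k
    induction k with
    | zero => simp
    | succ k ih =>
      have := hall (u ^ k)
      simp only [hFdef] at this
      rw [pow_succ']
      push_cast
      linarith
  have hM0 : M ≤ 0 := by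
    by_contra! hpos
    obtain ⟨k, hk⟩ := exists_nat_gt (2 * C / M)
    rw [div_lt_iff₀ hpos] at hk
    have h1 := abs_le.1 (hHC (u ^ k))
    have h2 := abs_le.1 (hHC 1)
    have := hpow k
    linarith
  have : h (u * v) - h v ≤ M := le_csSup hTb ⟨v, hv, rfl⟩
  linarith

lemma abstract_liouville {G Q : Type*} [Group G] [CommGroup Q] (p : G →* Q) (a b : G)
    (hgen : Subgroup.closure {a, b} = (⊤ : Subgroup G))
    (hcomm : ∀ u ∈ p.ker, ∀ v ∈ p.ker, u * v = v * u)
    (h : G → ℝ) (hh : Harm4 a b h) (C : ℝ) (hC : ∀ g, |h g| ≤ C) (g : G) : h g = h 1 := by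
  have hk : ∀ u ∈ p.ker, h u = h 1 := by
    intro u hu
    apply le_antisymm
    · simpa using ker_step p a b hgen hcomm h hh C hC u hu 1 p.ker.one_mem
    · simpa using ker_step p a b hgen hcomm h hh C hC u⁻¹ (p.ker.inv_mem hu) u hu
  apply le_antisymm
  · exact rec_max p a b hgen h hh C (fun g => (abs_le.1 (hC g)).2) (h 1) (fun u hu => (hk u hu).le) g
  · have hh' : Harm4 a b (fun g => - h g) := by
      intro g
      have := hh g
      simp only
      linarith
    have := rec_max p a b hgen (fun g => - h g) hh' C (fun g => by linarith [(abs_le.1 (hC g)).1])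
      (- h 1) (fun u hu => by simp only [hk u hu]; exact le_refl _) g
    linarith

lemma sold_comm (d : ℕ) : ∀ u ∈ (Abelianization.of (G := Sold d)).ker,
    ∀ v ∈ (Abelianization.of (G := Sold d)).ker, u * v = v * u := by
  intro u hu v hv
  rw [Abelianization.ker_of] at hu hv
  have hmap : (commutator (Sold d)) = (commutator (FreeGroup (Fin d))).map
      (QuotientGroup.mk' (derivedSeries (FreeGroup (Fin d)) 2)) := by
    rw [commutator_def, commutator_def, Subgroup.map_commutator,
      Subgroup.map_top_of_surjective _ (QuotientGroup.mk'_surjective _)]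
  rw [hmap] at hu hv
  obtain ⟨x, hx, rfl⟩ := hu
  obtain ⟨y, hy, rfl⟩ := hv
  rw [← map_mul, ← map_mul]
  apply QuotientGroup.eq.2
  have : derivedSeries (FreeGroup (Fin d)) 2
      = ⁅commutator (FreeGroup (Fin d)), commutator (FreeGroup (Fin d))⁆ := by
    rw [derivedSeries_succ, derivedSeries_one]
  rw [this]
  have h2 := Subgroup.commutator_mem_commutator (inv_mem hy) (inv_mem hx)
  rw [commutatorElement_def] at h2
  convert h2 using 1
  group

lemma sold_closure (d : ℕ) (T : Set (Sold d))
    (hT : ∀ i : Fin d, (QuotientGroup.mk (FreeGroup.of i) : Sold d) ∈ T) :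
    Subgroup.closure T = ⊤ := by
  rw [eq_top_iff]
  have h1 : (⊤ : Subgroup (Sold d)) = (⊤ : Subgroup (FreeGroup (Fin d))).map
      (QuotientGroup.mk' (derivedSeries (FreeGroup (Fin d)) 2)) :=
    (Subgroup.map_top_of_surjective _ (QuotientGroup.mk'_surjective _)).symm
  rw [h1, ← FreeGroup.closure_range_of, MonoidHom.map_closure, Subgroup.closure_le]
  rintro _ ⟨_, ⟨i, rfl⟩, rfl⟩
  exact Subgroup.subset_closure (hT i)

/-- For `d ∈ {1,2}`, every bounded harmonic function for the uniform
measure on the symmetric generating set `S = {x_1^{±1}, …, x_d^{±1}}` of the free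
metabelian group `Sol_d` is constant. -/
theorem bounded_harmonic_constant_low_dim (d : ℕ) (hd : d = 1 ∨ d = 2)
    (h : Sold d → ℝ) (hb : ∃ C : ℝ, ∀ g : Sold d, |h g| ≤ C)
    (hh : ∀ g : Sold d,
      h g = (2 * d : ℝ)⁻¹ * ∑ s : Fin d × Bool, h (g * solGen d s)) :
    ∀ g g' : Sold d, h g = h g' := by
  obtain ⟨C, hC⟩ := hb
  suffices hs : ∀ g, h g = h 1 by
    intro g g'
    rw [hs g, hs g']
  rcases hd with rfl | rfl
  · refine abstract_liouville (Abelianization.of (G := Sold 1))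
      (QuotientGroup.mk (FreeGroup.of 0)) 1 (sold_closure 1 _ ?_) (sold_comm 1) h ?_ C hC
    · intro i
      fin_cases i
      exact Or.inl rfl
    · intro g
      have := hh g
      simp only [Fintype.sum_prod_type, Fintype.sum_bool, Finset.univ_unique, Finset.sum_singleton] at this
      have e1 : solGen 1 (default, true) = QuotientGroup.mk (FreeGroup.of 0) := rfl
      have e2 : solGen 1 (default, false) = (QuotientGroup.mk (FreeGroup.of 0))⁻¹ := rfl
      rw [e1, e2] at this
      norm_num at this
      simp only [inv_one, mul_one]
      linarith
  · refine abstract_liouville (Abelianization.of (G := Sold 2))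
      (QuotientGroup.mk (FreeGroup.of 0)) (QuotientGroup.mk (FreeGroup.of 1))
      (sold_closure 2 _ ?_) (sold_comm 2) h ?_ C hC
    · intro i
      fin_cases i
      · exact Or.inl rfl
      · exact Or.inr rfl
    · intro g
      have := hh g
      simp only [Fintype.sum_prod_type, Fintype.sum_bool, Fin.sum_univ_two] at this
      have e1 : solGen 2 (0, true) = QuotientGroup.mk (FreeGroup.of 0) := rfl
      have e2 : solGen 2 (0, false) = (QuotientGroup.mk (FreeGroup.of 0))⁻¹ := rfl
      have e3 : solGen 2 (1, true) = QuotientGroup.mk (FreeGroup.of 1) := rfl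
      have e4 : solGen 2 (1, false) = (QuotientGroup.mk (FreeGroup.of 1))⁻¹ := rfl
      rw [e1, e2, e3, e4] at this
      norm_num at this
      linarith
end

section
/- Let d ≥ 3. Consider the path space Ω = ({x_1^{±1},…,x_d^{±1}})^ℕ with the Bernoulli product of the uniform measure on the 2d letters, let g_n ∈ Sol_d be the image of the word formed by the first n letters, let p_n ∈ ℤ^d be the corresponding lattice position, and let Φ(ω) be the almost-everywhere-defined stabilized edge-count function (v,i) ↦ lim_n γ_n(v,i). Then every bounded measurable function F on Ω that is measurable with respect to the tail σ-algebra ∩_N σ(g_N, g_{N+1}, …) coincides almost everywhere with a measurable function of Φ(ω). -/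
open scoped BigOperators

/-- The element of `Sol_d` spelled by the first `n` letters of `ω`. -/
def solWalk (d : ℕ) (ω : ℕ → Fin d × Bool) (n : ℕ) : Sold d :=
  QuotientGroup.mk (FreeGroup.mk (List.ofFn fun k : Fin n => ω (k : ℕ)))

open Classical in
/-- The stabilized (limiting) signed crossing count of the infinite path `ω` at an edge,
defined (arbitrarily as `0`) when the crossing counts do not stabilize. -/
noncomputable def stabCross (d : ℕ) (ω : ℕ → Fin d × Bool) (e : Edg d) : ℤ :=
  if h : ∃ N : ℕ, ∀ n : ℕ, N ≤ n →
      crossFrom d 0 (List.ofFn fun k : Fin n => ω (k : ℕ)) e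
        = crossFrom d 0 (List.ofFn fun k : Fin N => ω (k : ℕ)) e
  then crossFrom d 0 (List.ofFn fun k : Fin h.choose => ω (k : ℕ)) e
  else 0

/-- The tail σ-algebra `⋂_N σ(g_N, g_{N+1}, …)` of the random walk on `Sol_d`, where
`Sol_d` carries the discrete σ-algebra. -/
def solTail (d : ℕ) : MeasurableSpace (ℕ → Fin d × Bool) :=
  ⨅ N : ℕ, ⨆ n : ℕ, MeasurableSpace.comap (fun ω => solWalk d ω (N + n)) ⊤


namespace SolTail

open MeasureTheory Set

section Entropy

set_option linter.unusedSectionVars false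
set_option linter.unusedVariables false

variable {Ω : Type*} [MeasurableSpace Ω] (μ : Measure Ω)

/-- Finite-range random variables with measurable fibres. -/
def FM {α : Type*} (X : Ω → α) : Prop :=
  (Set.range X).Finite ∧ ∀ a, MeasurableSet (X ⁻¹' {a})

/-- Shannon entropy of a finite-range random variable. -/
noncomputable def ent {α : Type*} (X : Ω → α) : ℝ :=
  ∑ᶠ a, Real.negMulLog (μ.real (X ⁻¹' {a}))

variable {α β δ : Type*} {X : Ω → α} {Y : Ω → β} {Z : Ω → δ}

lemma FM.preimage (hX : FM X) (s : Set α) : MeasurableSet (X ⁻¹' s) := by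
  have : X ⁻¹' s = ⋃ a ∈ (Set.range X ∩ s), X ⁻¹' {a} := by
    ext ω; simp
  rw [this]
  exact MeasurableSet.biUnion (hX.1.subset inter_subset_left).countable fun a _ => hX.2 a

lemma FM.comp (hX : FM X) (f : α → β) : FM (fun ω => f (X ω)) := by
  refine ⟨?_, fun b => hX.preimage (f ⁻¹' {b})⟩
  have : Set.range (fun ω => f (X ω)) = f '' Set.range X := by
    ext b; simp
  rw [this]; exact hX.1.image f

lemma FM.factor (hY : FM Y) (h : ∀ ω ω', Y ω = Y ω' → X ω = X ω') : ∃ f : β → Set α,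
    ∀ ω, f (Y ω) = {X ω} := by
  refine ⟨fun b => {a | ∃ ω, Y ω = b ∧ X ω = a}, fun ω => ?_⟩
  ext a
  simp only [mem_ofPred_eq, mem_singleton_iff]
  constructor
  · rintro ⟨ω', h1, rfl⟩; exact h _ _ h1
  · rintro rfl; exact ⟨ω, rfl, rfl⟩

lemma FM.of_factor (hY : FM Y) (h : ∀ ω ω', Y ω = Y ω' → X ω = X ω') : FM X := by
  obtain ⟨f, hf⟩ := FM.factor hY h
  have := hY.comp f
  simp only [hf] at this
  refine ⟨?_, fun a => ?_⟩
  · have h2 := this.1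
    have h3 : Set.range (fun ω => ({X ω} : Set α)) = singleton '' Set.range X := by
      ext b; simp
    rw [h3] at h2
    exact h2.of_finite_image (singleton_injective.injOn)
  · have h2 := this.2 {a}
    convert h2 using 1
    ext ω; simp

lemma FM.pair (hX : FM X) (hY : FM Y) : FM (fun ω => (X ω, Y ω)) := by
  refine ⟨(hX.1.prod hY.1).subset ?_, fun a => ?_⟩
  · rintro _ ⟨ω, rfl⟩; simp
  · have : (fun ω => (X ω, Y ω)) ⁻¹' {a} = X ⁻¹' {a.1} ∩ Y ⁻¹' {a.2} := by
      ext ω; simp [Prod.ext_iff]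
    rw [this]; exact (hX.2 _).inter (hY.2 _)

lemma FM.pi {ι : Type*} [Finite ι] {α : ι → Type*} {X : ∀ i, Ω → α i} (hX : ∀ i, FM (X i)) :
    FM (fun ω i => X i ω) := by
  refine ⟨(Set.Finite.pi' fun i => (hX i).1).subset ?_, fun a => ?_⟩
  · rintro _ ⟨ω, rfl⟩ i; simp
  · have : (fun ω i => X i ω) ⁻¹' {a} = ⋂ i, X i ⁻¹' {a i} := by
      ext ω; simp [funext_iff]
    rw [this]; exact MeasurableSet.iInter fun i => (hX i).2 _

lemma FM.const (a : α) : FM (fun _ : Ω => a) := by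
  refine ⟨(Set.finite_singleton a).subset ?_, fun b => ?_⟩
  · rintro _ ⟨ω, rfl⟩; simp
  · exact MeasurableSet.const _

lemma ent_eq_sum {s : Finset α} (hs : Set.range X ⊆ s) :
    ent μ X = ∑ a ∈ s, Real.negMulLog (μ.real (X ⁻¹' {a})) := by
  refine finsum_eq_sum_of_support_subset _ ?_
  intro a ha
  apply hs
  by_contra h
  apply ha
  have : X ⁻¹' {a} = ∅ := by
    ext ω; simp; rintro rfl; exact h ⟨ω, rfl⟩
  simp [this]

lemma ent_congr {X' : Ω → α} (h : X =ᵐ[μ] X') : ent μ X = ent μ X' := by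
  refine finsum_congr fun a => ?_
  congr 1
  refine measureReal_congr ?_
  filter_upwards [h] with ω hω
  apply propext
  show X ω ∈ _ ↔ X' ω ∈ _
  rw [hω]

variable [IsProbabilityMeasure μ]

lemma FM.integrable (hX : FM X) (g : α → ℝ) : Integrable (fun ω => g (X ω)) μ := by
  classical
  have h := hX.comp g
  obtain ⟨C, hC⟩ : ∃ C, ∀ ω, ‖g (X ω)‖ ≤ C := by
    obtain ⟨C, hC⟩ := (h.1.image norm).bddAbove
    exact ⟨C, fun ω => hC ⟨_, ⟨ω, rfl⟩, rfl⟩⟩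
  refine Integrable.of_bound (C := C) ?_ (Filter.Eventually.of_forall hC)
  apply Measurable.aestronglyMeasurable
  intro s _
  exact hX.preimage (g ⁻¹' s)

lemma FM.integral (hX : FM X) {s : Finset α} (hs : Set.range X ⊆ s) (g : α → ℝ) :
    ∫ ω, g (X ω) ∂μ = ∑ a ∈ s, μ.real (X ⁻¹' {a}) * g a := by
  classical
  have : ∀ ω, g (X ω) = ∑ a ∈ s, (X ⁻¹' {a}).indicator (fun _ => g a) ω := by
    intro ω
    rw [Finset.sum_eq_single (X ω)]
    · simp
    · intro b _ hb; simp [Set.indicator, hb.symm]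
    · intro h; exact absurd (hs ⟨ω, rfl⟩) h
  simp_rw [this]
  rw [integral_finsetSum]
  · refine Finset.sum_congr rfl fun a _ => ?_
    rw [integral_indicator (hX.2 a)]
    simp
  · intro a _
    exact (integrable_const _).indicator (hX.2 a)

lemma ent_eq_integral (hX : FM X) :
    ent μ X = ∫ ω, - Real.log (μ.real (X ⁻¹' {X ω})) ∂μ := by
  have hs : Set.range X ⊆ hX.1.toFinset := by simp
  rw [ent_eq_sum μ hs, hX.integral μ hs (fun a => - Real.log (μ.real (X ⁻¹' {a})))]
  refine Finset.sum_congr rfl fun a _ => ?_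
  simp [Real.negMulLog]

lemma ae_pos (hX : FM X) : ∀ᵐ ω ∂μ, 0 < μ.real (X ⁻¹' {X ω}) := by
  have : {ω | ¬ 0 < μ.real (X ⁻¹' {X ω})} ⊆ ⋃ a ∈ {a ∈ Set.range X | μ (X ⁻¹' {a}) = 0}, X ⁻¹' {a} := by
    intro ω hω
    simp only [mem_ofPred_eq, not_lt] at hω
    have h0 : μ.real (X ⁻¹' {X ω}) = 0 := le_antisymm hω measureReal_nonneg
    have h1 : μ (X ⁻¹' {X ω}) = 0 := by
      rwa [measureReal_eq_zero_iff] at h0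
    simp only [mem_iUnion]
    exact ⟨X ω, ⟨⟨ω, rfl⟩, h1⟩, rfl⟩
  refine measure_mono_null this ?_
  rw [measure_biUnion_null_iff (hX.1.subset (sep_subset _ _)).countable]
  intro a ha; exact ha.2

/-- Monotonicity of entropy. -/
lemma ent_le_of_factor (hY : FM Y) (h : ∀ ω ω', Y ω = Y ω' → X ω = X ω') :
    ent μ X ≤ ent μ Y := by
  have hX : FM X := hY.of_factor h
  rw [ent_eq_integral μ hX, ent_eq_integral μ hY]
  refine integral_mono_ae (hX.integrable μ fun a => - Real.log (μ.real (X ⁻¹' {a})))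
    (hY.integrable μ fun a => - Real.log (μ.real (Y ⁻¹' {a}))) ?_
  filter_upwards [ae_pos μ hY] with ω hω
  apply neg_le_neg
  apply Real.log_le_log hω
  refine measureReal_mono ?_
  intro ω' h'
  exact h _ _ h'

lemma ent_eq_of_factor (hY : FM Y) (h : ∀ ω ω', Y ω = Y ω' ↔ X ω = X ω') :
    ent μ X = ent μ Y :=
  le_antisymm (ent_le_of_factor μ hY fun ω ω' => (h ω ω').1)
    (ent_le_of_factor μ (hY.of_factor fun ω ω' => (h ω ω').1) fun ω ω' => (h ω ω').2)

lemma ent_const (a : α) : ent μ (fun _ : Ω => a) = 0 := by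
  rw [ent_eq_sum μ (s := {a}) (by rintro _ ⟨ω, rfl⟩; simp)]
  simp [Set.preimage]

lemma sum_inter (hY : FM Y) {s : Finset β} (hs : Set.range Y ⊆ s) {E : Set Ω}
    (hE : MeasurableSet E) :
    ∑ b ∈ s, μ.real (E ∩ Y ⁻¹' {b}) = μ.real E := by
  have : E = ⋃ b ∈ s, (E ∩ Y ⁻¹' {b}) := by
    ext ω; simp; intro _; exact hs ⟨ω, rfl⟩
  conv_rhs => rw [this]
  rw [measureReal_biUnion_finset]
  · intro a _ b _ hab
    refine Set.disjoint_left.2 ?_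
    rintro ω ⟨_, h1⟩ ⟨_, h2⟩
    exact hab (h1.symm.trans h2)
  · intro b _; exact hE.inter (hY.2 b)

lemma preimage_pair (a : α) (b : β) :
    (fun ω => (X ω, Y ω)) ⁻¹' {(a, b)} = X ⁻¹' {a} ∩ Y ⁻¹' {b} := by
  ext ω; simp

/-- Submodularity of entropy. -/
lemma ent_submod (hX : FM X) (hY : FM Y) (hZ : FM Z) :
    ent μ (fun ω => (X ω, Y ω, Z ω)) + ent μ Z ≤
      ent μ (fun ω => (X ω, Z ω)) + ent μ (fun ω => (Y ω, Z ω)) := by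
  classical
  have hT := hX.pair (hY.pair hZ)
  have hXZ := hX.pair hZ
  have hYZ := hY.pair hZ
  set sX := hX.1.toFinset
  set sY := hY.1.toFinset
  set sZ := hZ.1.toFinset
  have hsX : Set.range X ⊆ sX := by simp [sX]
  have hsY : Set.range Y ⊆ sY := by simp [sY]
  have hsZ : Set.range Z ⊆ sZ := by simp [sZ]
  have hsT : Set.range (fun ω => (X ω, Y ω, Z ω)) ⊆ (sX ×ˢ sY ×ˢ sZ : Finset _) := by
    rintro _ ⟨ω, rfl⟩; simp [sX, sY, sZ]
  set T : Ω → α × β × δ := fun ω => (X ω, Y ω, Z ω) with hTdef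
  set pT : α × β × δ → ℝ := fun t => μ.real (T ⁻¹' {t})
  set pXZ : α × δ → ℝ := fun t => μ.real ((fun ω => (X ω, Z ω)) ⁻¹' {t})
  set pYZ : β × δ → ℝ := fun t => μ.real ((fun ω => (Y ω, Z ω)) ⁻¹' {t})
  set pZ : δ → ℝ := fun t => μ.real (Z ⁻¹' {t})
  rw [ent_eq_integral μ hT, ent_eq_integral μ hZ, ent_eq_integral μ hXZ, ent_eq_integral μ hYZ,
    ← integral_add (hT.integrable μ fun t => - Real.log (pT t))
      (hZ.integrable μ fun t => - Real.log (pZ t)),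
    ← integral_add (hXZ.integrable μ fun t => - Real.log (pXZ t))
      (hYZ.integrable μ fun t => - Real.log (pYZ t))]
  have e1 := hT.integral μ hsT (fun t => - Real.log (pT t) + - Real.log (pZ t.2.2))
  have e2 := hT.integral μ hsT
    (fun t => - Real.log (pXZ (t.1, t.2.2)) + - Real.log (pYZ (t.2.1, t.2.2)))
  refine le_of_eq_of_le e1 (le_of_le_of_eq ?_ e2.symm)
  have key : ∀ t : α × β × δ, pT t - pXZ (t.1, t.2.2) * pYZ (t.2.1, t.2.2) / pZ t.2.2 ≤
      pT t * (- Real.log (pXZ (t.1, t.2.2)) + - Real.log (pYZ (t.2.1, t.2.2)))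
      - pT t * (- Real.log (pT t) + - Real.log (pZ t.2.2)) := by
    intro t
    have hp0 : 0 ≤ pT t := measureReal_nonneg
    rcases hp0.eq_or_lt with h0 | hp
    · rw [← h0]; simp
      have : 0 ≤ pXZ (t.1, t.2.2) * pYZ (t.2.1, t.2.2) / pZ t.2.2 :=
        div_nonneg (mul_nonneg measureReal_nonneg measureReal_nonneg) measureReal_nonneg
      simpa using this
    · have h1 : 0 < pXZ (t.1, t.2.2) := lt_of_lt_of_le hp (measureReal_mono (by
        rintro ω hω; simp only [T, mem_preimage, mem_singleton_iff] at hω; simp [← hω]))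
      have h2 : 0 < pYZ (t.2.1, t.2.2) := lt_of_lt_of_le hp (measureReal_mono (by
        rintro ω hω; simp only [T, mem_preimage, mem_singleton_iff] at hω; simp [← hω]))
      have h3 : 0 < pZ t.2.2 := lt_of_lt_of_le hp (measureReal_mono (by
        rintro ω hω; simp only [T, mem_preimage, mem_singleton_iff] at hω; simp [← hω]))
      have hl := Real.log_le_sub_one_of_pos
        (x := pXZ (t.1, t.2.2) * pYZ (t.2.1, t.2.2) / (pZ t.2.2 * pT t)) (by positivity)
      rw [Real.log_div (by positivity) (by positivity), Real.log_mul h1.ne' h2.ne',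
        Real.log_mul h3.ne' hp.ne'] at hl
      have := mul_le_mul_of_nonneg_left hl hp.le
      have e : pT t * (pXZ (t.1, t.2.2) * pYZ (t.2.1, t.2.2) / (pZ t.2.2 * pT t) - 1)
          = pXZ (t.1, t.2.2) * pYZ (t.2.1, t.2.2) / pZ t.2.2 - pT t := by
        field_simp
      rw [e] at this
      linarith
  have hsum := Finset.sum_le_sum (s := sX ×ˢ sY ×ˢ sZ) fun t _ => key t
  rw [Finset.sum_sub_distrib, Finset.sum_sub_distrib] at hsum
  have s1 : ∑ t ∈ sX ×ˢ sY ×ˢ sZ, pT t = 1 := by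
    have := hT.integral μ hsT (fun _ => 1)
    simp at this
    exact this.symm
  have s2 : ∑ t ∈ sX ×ˢ sY ×ˢ sZ, pXZ (t.1, t.2.2) * pYZ (t.2.1, t.2.2) / pZ t.2.2 = 1 := by
    rw [Finset.sum_product_right, Finset.sum_product_right]
    simp only
    have : ∀ z ∈ sZ, (∑ y ∈ sY, ∑ x ∈ sX, pXZ (x, z) * pYZ (y, z) / pZ z) = pZ z := by
      intro z _
      have a1 : ∑ x ∈ sX, pXZ (x, z) = pZ z := by
        refine Eq.trans ?_ (sum_inter μ hX hsX (hZ.2 z))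
        refine Finset.sum_congr rfl fun x _ => ?_
        simp only [pXZ]; rw [preimage_pair, inter_comm]
      have a2 : ∑ y ∈ sY, pYZ (y, z) = pZ z := by
        refine Eq.trans ?_ (sum_inter μ hY hsY (hZ.2 z))
        refine Finset.sum_congr rfl fun x _ => ?_
        simp only [pYZ]; rw [preimage_pair, inter_comm]
      simp_rw [← Finset.sum_div, ← Finset.sum_mul, ← Finset.mul_sum, a1, a2]
      by_cases h : pZ z = 0
      · simp [h]
      · field_simp
    rw [Finset.sum_congr rfl this]
    have := hZ.integral μ hsZ (fun _ => 1)
    simp at this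
    exact this.symm
  rw [s1, s2] at hsum
  simp only [hTdef] at *
  linarith

lemma ent_pair_le (hX : FM X) (hY : FM Y) :
    ent μ (fun ω => (X ω, Y ω)) ≤ ent μ X + ent μ Y := by
  have h := ent_submod μ hX hY (FM.const (Ω := Ω) ())
  rw [ent_const] at h
  rw [ent_eq_of_factor μ (X := fun ω => (X ω, Y ω)) (hX.pair (hY.pair (FM.const (Ω := Ω) ())))
    (by simp), ent_eq_of_factor μ (X := X) (hX.pair (FM.const (Ω := Ω) ())) (by simp),
    ent_eq_of_factor μ (X := Y) (hY.pair (FM.const (Ω := Ω) ())) (by simp)]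
  linarith

/-- Additivity of entropy for independent variables. -/
lemma ent_pair_indep (hX : FM X) (hY : FM Y)
    (h : ∀ a b, μ.real (X ⁻¹' {a} ∩ Y ⁻¹' {b}) = μ.real (X ⁻¹' {a}) * μ.real (Y ⁻¹' {b})) :
    ent μ (fun ω => (X ω, Y ω)) = ent μ X + ent μ Y := by
  rw [ent_eq_integral μ (hX.pair hY), ent_eq_integral μ hX, ent_eq_integral μ hY,
    ← integral_add (hX.integrable μ fun t => - Real.log (μ.real (X ⁻¹' {t})))
      (hY.integrable μ fun t => - Real.log (μ.real (Y ⁻¹' {t})))]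
  refine integral_congr_ae ?_
  filter_upwards [ae_pos μ hX, ae_pos μ hY] with ω h1 h2
  simp only [preimage_pair]
  rw [h, Real.log_mul h1.ne' h2.ne']; ring

lemma ent_pi_le {ι : Type*} (s : Finset ι) {α : ι → Type*} {X : ∀ i, Ω → α i}
    (hX : ∀ i, FM (X i)) :
    ent μ (fun ω (i : s) => X i ω) ≤ ∑ i ∈ s, ent μ (X i) := by
  classical
  induction s using Finset.induction_on with
  | empty =>
    simp only [Finset.sum_empty]
    refine le_trans (ent_le_of_factor μ (FM.const (Ω := Ω) ()) ?_) (ent_const μ ()).le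
    intro ω ω' _; ext ⟨i, hi⟩; simp at hi
  | insert a s ha ih =>
    rw [Finset.sum_insert ha]
    have hs : FM (fun ω (i : s) => X i ω) := FM.pi fun i => hX i
    refine le_trans (ent_le_of_factor μ ((hX a).pair hs) ?_)
      ((ent_pair_le μ (hX a) hs).trans (by linarith))
    intro ω ω' h
    obtain ⟨h1, h2⟩ := Prod.ext_iff.1 h
    funext ⟨i, hi⟩
    rcases Finset.mem_insert.1 hi with rfl | hi
    · exact h1
    · exact congrFun h2 ⟨i, hi⟩

lemma sum_negMulLog_le {ι : Type*} (s : Finset ι) (p : ι → ℝ) (hp : ∀ i ∈ s, 0 ≤ p i) :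
    ∑ i ∈ s, Real.negMulLog (p i) ≤ Real.negMulLog (∑ i ∈ s, p i)
      + (∑ i ∈ s, p i) * Real.log s.card := by
  classical
  rcases s.eq_empty_or_nonempty with rfl | hs
  · simp
  have hc : (0 : ℝ) < s.card := by exact_mod_cast hs.card_pos
  have hj := Real.concaveOn_negMulLog.le_map_sum (t := s) (w := fun _ => (s.card : ℝ)⁻¹) (p := p)
    (fun _ _ => by positivity) (by simp [hc.ne']) (fun i hi => hp i hi)
  simp only [smul_eq_mul, ← Finset.mul_sum] at hj
  rw [Real.negMulLog_mul] at hj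
  have h2 := mul_le_mul_of_nonneg_left hj hc.le
  have h3 : Real.negMulLog (s.card : ℝ)⁻¹ = (s.card : ℝ)⁻¹ * Real.log s.card := by
    simp [Real.negMulLog]
  rw [h3] at h2
  field_simp at h2
  linarith

lemma ent_le_log_card [Fintype α] [Nonempty α] (hX : FM X) :
    ent μ X ≤ Real.log (Fintype.card α) := by
  rw [ent_eq_sum μ (s := Finset.univ) (by simp)]
  have h := sum_negMulLog_le Finset.univ (fun a => μ.real (X ⁻¹' {a}))
    (fun _ _ => measureReal_nonneg)
  have := hX.integral μ (s := Finset.univ) (by simp) (fun _ => 1)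
  simp at this
  rw [← this] at h
  simpa using h

lemma negMulLog_le_sqrt {q : ℝ} (h0 : 0 ≤ q) : Real.negMulLog q ≤ 2 * √q := by
  rcases h0.eq_or_lt with rfl | h
  · simp
  have h1 : 0 < √q := Real.sqrt_pos.2 h
  have h2 := Real.log_le_sub_one_of_pos (x := (√q)⁻¹) (by positivity)
  rw [Real.log_inv, Real.log_sqrt h0] at h2
  have h3 := mul_le_mul_of_nonneg_left h2 h0
  have h4 : q * ((√q)⁻¹ - 1) = √q - q := by
    have := Real.mul_self_sqrt h0
    field_simp
    nlinarith
  rw [h4] at h3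
  simp only [Real.negMulLog]
  nlinarith

lemma negMulLog_one_sub_le {q : ℝ} (h0 : 0 ≤ q) (h1 : q ≤ 1) : Real.negMulLog (1 - q) ≤ √q := by
  have h3 : q ≤ √q := by
    apply Real.le_sqrt_of_sq_le; nlinarith
  refine le_trans ?_ h3
  rcases h1.eq_or_lt with rfl | h
  · simp
  have hp : 0 < 1 - q := by linarith
  have h2 := Real.log_le_sub_one_of_pos (x := (1 - q)⁻¹) (by positivity)
  rw [Real.log_inv] at h2
  have h4 := mul_le_mul_of_nonneg_left h2 hp.le
  have h5 : (1 - q) * ((1 - q)⁻¹ - 1) = q := by field_simp; ring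
  rw [h5] at h4
  simp only [Real.negMulLog]
  linarith

/-- A variable which rarely differs from a default value has small entropy. -/
lemma ent_option_le [Fintype β] [Nonempty β] {V : Ω → Option β} (hV : FM V) :
    ent μ V ≤ √(μ.real {ω | V ω ≠ none}) * (3 + Real.log (Fintype.card β)) := by
  classical
  set q := μ.real {ω | V ω ≠ none} with hq
  have hq0 : 0 ≤ q := measureReal_nonneg
  have hq1 : q ≤ 1 := measureReal_le_one
  have hm : MeasurableSet (V ⁻¹' {none}) := hV.2 none
  have h1 : μ.real (V ⁻¹' {none}) = 1 - q := by
    have : {ω | V ω ≠ none} = (V ⁻¹' {none})ᶜ := by ext; simp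
    rw [hq, this, probReal_compl_eq_one_sub hm]; ring
  have h2 : ∑ b : β, μ.real (V ⁻¹' {some b}) = q := by
    have := hV.integral μ (s := Finset.univ) (by simp) (fun _ => 1)
    simp only [integral_const, probReal_univ, smul_eq_mul, mul_one, Fintype.sum_option, h1] at this
    linarith
  rw [ent_eq_sum μ (s := Finset.univ) (by simp), Fintype.sum_option, h1]
  have h3 := sum_negMulLog_le Finset.univ (fun b : β => μ.real (V ⁻¹' {some b}))
    (fun _ _ => measureReal_nonneg)
  rw [h2] at h3
  have h4 := negMulLog_le_sqrt hq0
  have h5 := negMulLog_one_sub_le hq0 hq1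
  have h6 : q ≤ √q := by
    apply Real.le_sqrt_of_sq_le; nlinarith
  have h7 : 0 ≤ Real.log (Fintype.card β) := Real.log_natCast_nonneg _
  have h8 := mul_le_mul_of_nonneg_right h6 h7
  simp only [Finset.card_univ] at h3
  nlinarith

/-- Small conditional entropy of an event given a variable implies the event is approximable. -/
lemma exists_approx (A : Set Ω) (hA : MeasurableSet A) (hZ : FM Z) :
    ∃ G : Set δ, μ.real (symmDiff A (Z ⁻¹' G)) ≤
      ent μ (fun ω => (ω ∈ A, Z ω)) - ent μ Z := by
  classical
  set sZ := hZ.1.toFinset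
  have hsZ : Set.range Z ⊆ sZ := by simp [sZ]
  have hAF : FM (fun ω => ω ∈ A) := by
    refine ⟨Set.toFinite _, fun p => ?_⟩
    by_cases hp : p
    · convert hA using 1; ext ω; simp [hp]
    · convert hA.compl using 1; ext ω; simp [hp]
  have hP := hAF.pair hZ
  set a : δ → ℝ := fun z => μ.real (A ∩ Z ⁻¹' {z})
  set b : δ → ℝ := fun z => μ.real (Aᶜ ∩ Z ⁻¹' {z})
  have hab : ∀ z, μ.real (Z ⁻¹' {z}) = a z + b z := by
    intro z
    have := measureReal_inter_add_sdiff (μ := μ) (s := Z ⁻¹' {z}) hA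
    simp only [a, b]
    rw [← this, inter_comm, sdiff_eq, inter_comm Aᶜ]
  have ha0 : ∀ z, 0 ≤ a z := fun z => measureReal_nonneg
  have hb0 : ∀ z, 0 ≤ b z := fun z => measureReal_nonneg
  refine ⟨{z | b z ≤ a z}, ?_⟩
  have hsP : Set.range (fun ω => (ω ∈ A, Z ω)) ⊆ ((Finset.univ ×ˢ sZ : Finset (Prop × δ)) : Set _) := by
    rintro _ ⟨ω, rfl⟩; simp [sZ]; exact Classical.em _
  rw [ent_eq_sum μ hsP, ent_eq_sum μ hsZ, Finset.sum_product_right, ← Finset.sum_sub_distrib]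
  have hmD : MeasurableSet (symmDiff A (Z ⁻¹' {z | b z ≤ a z})) := hA.symmDiff (hZ.preimage _)
  rw [← sum_inter μ hZ hsZ hmD]
  refine Finset.sum_le_sum fun z _ => ?_
  have e1 : (fun ω => (ω ∈ A, Z ω)) ⁻¹' {(True, z)} = A ∩ Z ⁻¹' {z} := by
    ext ω; simp
  have e2 : (fun ω => (ω ∈ A, Z ω)) ⁻¹' {(False, z)} = Aᶜ ∩ Z ⁻¹' {z} := by
    ext ω; simp
  rw [show (Finset.univ : Finset Prop) = {True, False} from by ext p; by_cases hp : p <;> simp [hp],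
    Finset.sum_pair (by simp), e1, e2, hab]
  change _ ≤ Real.negMulLog (a z) + Real.negMulLog (b z) - _
  have hmin : μ.real (symmDiff A (Z ⁻¹' {z | b z ≤ a z}) ∩ Z ⁻¹' {z}) ≤ min (a z) (b z) := by
    by_cases h : b z ≤ a z
    · rw [min_eq_right h]
      refine measureReal_mono ?_
      rintro ω ⟨h1, h2⟩
      simp only [mem_preimage, mem_singleton_iff] at h2
      refine ⟨?_, h2⟩
      rcases h1 with h1 | h1
      · exact absurd (by simp [h2, h]) h1.2
      · exact h1.2
    · rw [min_eq_left (not_le.1 h).le]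
      refine measureReal_mono ?_
      rintro ω ⟨h1, h2⟩
      simp only [mem_preimage, mem_singleton_iff] at h2
      refine ⟨?_, h2⟩
      rcases h1 with h1 | h1
      · exact h1.1
      · exact absurd h1.1 (by simp [h2, h])
  refine hmin.trans ?_
  rcases (ha0 z).eq_or_lt with h | h
  · rw [← h]; simp [hb0 z]
  rcases (hb0 z).eq_or_lt with h' | h'
  · rw [← h']; simp
  generalize a z = x at *
  generalize b z = y at *
  have l1 := Real.log_le_sub_one_of_pos (x := x / (x + y)) (by positivity)
  have l2 := Real.log_le_sub_one_of_pos (x := y / (x + y)) (by positivity)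
  rw [Real.log_div h.ne' (by positivity)] at l1
  rw [Real.log_div h'.ne' (by positivity)] at l2
  have m1 := mul_le_mul_of_nonneg_left l1 h.le
  have m2 := mul_le_mul_of_nonneg_left l2 h'.le
  have e3 : x * (x / (x + y) - 1) = - (x * y / (x + y)) := by field_simp; ring
  have e4 : y * (y / (x + y) - 1) = - (x * y / (x + y)) := by field_simp; ring
  rw [e3] at m1
  rw [e4] at m2
  have h5 : min x y ≤ 2 * (x * y / (x + y)) := by
    rw [mul_div_assoc', le_div_iff₀ (by positivity)]
    rcases min_cases x y with ⟨hh, h6⟩ | ⟨hh, h6⟩ <;> rw [hh] <;> nlinarith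
  simp only [Real.negMulLog]
  nlinarith

end Entropy

end SolTail


namespace SolTail

open MeasureTheory Set

section Walk

set_option linter.unusedSectionVars false
set_option linter.unusedVariables false

variable {d : ℕ}

/-- The shift on the path space. -/
def sh {T : Type*} (k : ℕ) (ω : ℕ → T) : ℕ → T := fun n => ω (k + n)

/-- The first `k` letters. -/
def pre {T : Type*} (k : ℕ) (ω : ℕ → T) : Fin k → T := fun i => ω i

/-- The displacement of a letter. -/
def stp (s : Fin d × Bool) : Pt d := if s.2 then latE d s.1 else -latE d s.1

/-- Position after `n` steps. -/
def pos : ℕ → (ℕ → Fin d × Bool) → Pt d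
  | 0, _ => 0
  | n + 1, ω => pos n ω + stp (ω n)

/-- Contribution of a single step to the crossing counts. -/
noncomputable def ev (p : Pt d) (s : Fin d × Bool) (e : Edg d) : ℤ :=
  (if s.2 then Finsupp.single (p, s.1) (1 : ℤ)
        else Finsupp.single (p - latE d s.1, s.1) (-1)) e

/-- Crossing counts after `n` steps. -/
noncomputable def cr : ℕ → (ℕ → Fin d × Bool) → Edg d → ℤ
  | 0, _, _ => 0
  | n + 1, ω, e => cr n ω e + ev (pos n ω) (ω n) e

lemma pos_add (k n : ℕ) (ω : ℕ → Fin d × Bool) :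
    pos (k + n) ω = pos k ω + pos n (sh k ω) := by
  induction n with
  | zero => simp [pos]
  | succ n ih => rw [← add_assoc]; simp only [pos, ih, sh]; rw [add_assoc]

lemma ev_shift (q p : Pt d) (s : Fin d × Bool) (e : Edg d) :
    ev (q + p) s e = ev p s (e.1 - q, e.2) := by
  classical
  obtain ⟨v, i⟩ := e
  simp only [ev]
  split_ifs
  · rw [Finsupp.single_apply, Finsupp.single_apply]
    congr 1
    simp only [Prod.mk.injEq, eq_iff_iff]
    rw [eq_sub_iff_add_eq, add_comm]
  · rw [Finsupp.single_apply, Finsupp.single_apply]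
    congr 1
    simp only [Prod.mk.injEq, eq_iff_iff]
    rw [eq_sub_iff_add_eq, sub_add_eq_add_sub, add_comm]

lemma cr_add (k n : ℕ) (ω : ℕ → Fin d × Bool) (e : Edg d) :
    cr (k + n) ω e = cr k ω e + cr n (sh k ω) (e.1 - pos k ω, e.2) := by
  induction n with
  | zero => simp [cr]
  | succ n ih =>
    rw [← add_assoc]
    simp only [cr, ih, pos_add, ev_shift]
    rw [add_assoc]; rfl

lemma pos_congr (k : ℕ) (ω ω' : ℕ → Fin d × Bool) (h : ∀ n < k, ω n = ω' n) :
    pos k ω = pos k ω' := by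
  induction k with
  | zero => rfl
  | succ k ih => simp only [pos]; rw [ih fun n hn => h n (by omega), h k (by omega)]

lemma cr_congr (k : ℕ) (ω ω' : ℕ → Fin d × Bool) (h : ∀ n < k, ω n = ω' n) :
    cr k ω = cr k ω' := by
  induction k with
  | zero => rfl
  | succ k ih =>
    funext e
    simp only [cr]
    rw [ih fun n hn => h n (by omega), h k (by omega), pos_congr k ω ω' fun n hn => h n (by omega)]

lemma crossFrom_append (p : Pt d) (l : List (Fin d × Bool)) (s : Fin d × Bool) :
    crossFrom d p (l ++ [s]) = crossFrom d p l + crossFrom d (l.foldl (stepFn d) p) [s] := by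
  induction l generalizing p with
  | nil => simp [crossFrom]
  | cons a l ih => simp only [List.cons_append, crossFrom, ih, List.foldl_cons, add_assoc]

lemma foldl_ofFn (n : ℕ) (ω : ℕ → Fin d × Bool) :
    (List.ofFn fun k : Fin n => ω (k : ℕ)).foldl (stepFn d) 0 = pos n ω := by
  induction n with
  | zero => simp [pos]
  | succ n ih =>
    rw [List.ofFn_succ', List.concat_eq_append, List.foldl_append]
    simp only [Fin.val_castSucc, Fin.val_last, ih]
    rfl

lemma crossFrom_ofFn (n : ℕ) (ω : ℕ → Fin d × Bool) (e : Edg d) :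
    crossFrom d 0 (List.ofFn fun k : Fin n => ω (k : ℕ)) e = cr n ω e := by
  induction n with
  | zero => simp [cr, crossFrom]
  | succ n ih =>
    rw [List.ofFn_succ', List.concat_eq_append, crossFrom_append]
    simp only [Fin.val_castSucc, Fin.val_last, Finsupp.add_apply, ih, foldl_ofFn]
    simp [cr, crossFrom, ev]

/-- The walk on the flow group. -/
noncomputable def hh (n : ℕ) (ω : ℕ → Fin d × Bool) : Pt d × (Edg d → ℤ) := (pos n ω, cr n ω)

lemma pre_eq_iff {T : Type*} {k : ℕ} {ω ω' : ℕ → T} :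
    pre k ω = pre k ω' ↔ ∀ n < k, ω n = ω' n := by
  constructor
  · intro h n hn; exact congrFun h ⟨n, hn⟩
  · intro h; funext i; exact h i i.2

lemma hh_of_pre {k : ℕ} {ω ω' : ℕ → Fin d × Bool} (h : pre k ω = pre k ω') :
    hh k ω = hh k ω' := by
  rw [pre_eq_iff] at h
  simp only [hh, pos_congr k ω ω' h, cr_congr k ω ω' h]

end Walk

section Bernoulli

set_option linter.unusedSectionVars false
set_option linter.unusedVariables false

variable {S : Type*} [Fintype S] [MeasurableSpace S] [MeasurableSingletonClass S]

lemma fm_pre (k : ℕ) : FM (pre k : (ℕ → S) → Fin k → S) := by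
  refine ⟨Set.toFinite _, fun a => ?_⟩
  have : (pre k : (ℕ → S) → Fin k → S) ⁻¹' {a} = ⋂ i : Fin k, (fun ω => ω (i : ℕ)) ⁻¹' {a i} := by
    ext ω; simp [funext_iff, pre]
  rw [this]
  exact MeasurableSet.iInter fun i => (measurable_pi_apply _) (measurableSet_singleton _)

lemma measurable_sh (k : ℕ) : Measurable (sh k : (ℕ → S) → ℕ → S) :=
  measurable_pi_lambda _ fun n => measurable_pi_apply _

/-- Cylinders. -/
def cyls (S : Type*) : Set (Set (ℕ → S)) :=
  {∅} ∪ {C | ∃ (n : ℕ) (f : Fin n → S), C = pre n ⁻¹' {f}}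

lemma cyls_pi : IsPiSystem (cyls S) := by
  have key : ∀ (n m : ℕ) (f : Fin n → S) (g : Fin m → S), n ≤ m →
      (pre n ⁻¹' {f} ∩ pre m ⁻¹' {g} : Set (ℕ → S)).Nonempty →
      (pre n ⁻¹' {f} ∩ pre m ⁻¹' {g} : Set (ℕ → S)) = pre m ⁻¹' {g} := by
    rintro n m f g hnm ⟨ω, h1, h2⟩
    apply inter_eq_self_of_subset_right
    intro ω' h'
    simp only [mem_preimage, mem_singleton_iff] at *
    rw [← h1, pre_eq_iff]
    rw [← h2, pre_eq_iff] at h'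
    intro i hi; exact h' i (by omega)
  rintro A (hA | ⟨n, f, rfl⟩) B (hB | ⟨m, g, rfl⟩) hAB
  · simp only [mem_singleton_iff] at hA; subst hA; simp at hAB
  · simp only [mem_singleton_iff] at hA; subst hA; simp at hAB
  · simp only [mem_singleton_iff] at hB; subst hB; simp at hAB
  · right
    rcases le_total n m with h | h
    · exact ⟨m, g, key n m f g h hAB⟩
    · rw [inter_comm] at hAB ⊢
      exact ⟨n, f, key m n g f h hAB⟩

lemma cyls_gen : (MeasurableSpace.pi : MeasurableSpace (ℕ → S)) =
    MeasurableSpace.generateFrom (cyls S) := by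
  apply le_antisymm
  · refine iSup_le fun n => ?_
    rintro _ ⟨s, hs, rfl⟩
    have : (fun ω : ℕ → S => ω n) ⁻¹' s =
        ⋃ f ∈ {f : Fin (n+1) → S | f (Fin.last n) ∈ s}, pre (n+1) ⁻¹' {f} := by
      ext ω
      simp only [mem_preimage, mem_iUnion, mem_ofPred_eq, mem_singleton_iff, exists_prop]
      constructor
      · intro h; exact ⟨pre (n+1) ω, h, rfl⟩
      · rintro ⟨f, h, rfl⟩; exact h
    change @MeasurableSet _ (MeasurableSpace.generateFrom (cyls S)) ((fun ω : ℕ → S => ω n) ⁻¹' s)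
    rw [this]
    refine MeasurableSet.biUnion (Set.toFinite _).countable fun f _ => ?_
    exact MeasurableSpace.measurableSet_generateFrom (Or.inr ⟨_, f, rfl⟩)
  · refine MeasurableSpace.generateFrom_le ?_
    rintro A (hA | ⟨n, f, rfl⟩)
    · simp only [mem_singleton_iff] at hA; subst hA; exact MeasurableSet.empty
    · exact (fm_pre n).2 f

variable {μ : Measure (ℕ → S)}

lemma mu_pre (hμ : IsUniformBernoulli S μ) (n : ℕ) (f : Fin n → S) :
    μ (pre n ⁻¹' {f}) = ((Fintype.card S : ENNReal))⁻¹ ^ n := by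
  rw [← hμ.2 n f]
  congr 1
  ext ω; simp [pre, funext_iff]

lemma mu_pre_sh (hμ : IsUniformBernoulli S μ) (k : ℕ) (w : Fin k → S) {B : Set (ℕ → S)}
    (hB : MeasurableSet B) :
    μ (pre k ⁻¹' {w} ∩ sh k ⁻¹' B) = ((Fintype.card S : ENNReal))⁻¹ ^ k * μ B := by
  have := hμ.1
  have hcyl : ∀ (n : ℕ) (f : Fin n → S), (pre k ⁻¹' {w} ∩ sh k ⁻¹' (pre n ⁻¹' {f}) : Set (ℕ → S))
      = pre (k + n) ⁻¹' {Fin.append w f} := by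
    intro n f
    ext ω
    simp only [mem_inter_iff, mem_preimage, mem_singleton_iff, funext_iff]
    constructor
    · rintro ⟨h1, h2⟩ i
      refine Fin.addCases (fun j => ?_) (fun j => ?_) i
      · rw [Fin.append_left]; exact h1 j
      · rw [Fin.append_right]; exact h2 j
    · intro h
      refine ⟨fun j => ?_, fun j => ?_⟩
      · have := h (Fin.castAdd n j); rw [Fin.append_left] at this; exact this
      · have := h (Fin.natAdd k j); rw [Fin.append_right] at this; exact this
  set ν : Measure (ℕ → S) := (μ.restrict (pre k ⁻¹' {w})).map (sh k) with hν
  have hνB : ∀ B, MeasurableSet B → ν B = μ (pre k ⁻¹' {w} ∩ sh k ⁻¹' B) := by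
    intro B hB
    rw [hν, Measure.map_apply (measurable_sh k) hB, Measure.restrict_apply (measurable_sh k hB),
      inter_comm]
  have hc : ((Fintype.card S : ENNReal))⁻¹ ^ k ≠ ⊤ := by
    rw [← mu_pre hμ k w]; exact measure_ne_top _ _
  have : ν = ((Fintype.card S : ENNReal))⁻¹ ^ k • μ := by
    refine ext_of_generate_finite (cyls S) cyls_gen cyls_pi ?_ ?_
    · rintro A (hA | ⟨n, f, rfl⟩)
      · simp only [mem_singleton_iff] at hA; subst hA; simp
      · rw [hνB _ ((fm_pre n).2 f), hcyl, mu_pre hμ]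
        simp only [Measure.smul_apply, smul_eq_mul]
        rw [mu_pre hμ, pow_add]
    · rw [hνB _ MeasurableSet.univ]; simp [mu_pre hμ]
  rw [← hνB B hB, this]; simp

lemma real_pre_sh (hμ : IsUniformBernoulli S μ) (k : ℕ) (w : Fin k → S) {B : Set (ℕ → S)}
    (hB : MeasurableSet B) :
    μ.real (pre k ⁻¹' {w} ∩ sh k ⁻¹' B) = ((Fintype.card S : ℝ))⁻¹ ^ k * μ.real B := by
  simp only [Measure.real, mu_pre_sh hμ k w hB]
  simp

lemma real_sh (hμ : IsUniformBernoulli S μ) (k : ℕ) {B : Set (ℕ → S)}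
    (hB : MeasurableSet B) : μ.real (sh k ⁻¹' B) = μ.real B := by
  have := hμ.1
  have h1 := sum_inter μ (fm_pre (S := S) k) (s := Finset.univ) (by simp) (measurable_sh k hB)
  have h2 := sum_inter μ (fm_pre (S := S) k) (s := Finset.univ) (by simp) MeasurableSet.univ
  rw [← h1]
  simp_rw [inter_comm (sh k ⁻¹' B), real_pre_sh hμ k _ hB]
  have h3 : ∀ w : Fin k → S, μ.real (univ ∩ pre k ⁻¹' {w}) = ((Fintype.card S : ℝ))⁻¹ ^ k := by
    intro w
    have := real_pre_sh hμ k w MeasurableSet.univ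
    simpa using this
  simp_rw [h3] at h2
  rw [← Finset.sum_mul, h2]; simp

lemma real_indep (hμ : IsUniformBernoulli S μ) (k : ℕ) (E : Set (Fin k → S)) {B : Set (ℕ → S)}
    (hB : MeasurableSet B) :
    μ.real (pre k ⁻¹' E ∩ sh k ⁻¹' B) = μ.real (pre k ⁻¹' E) * μ.real B := by
  classical
  have := hμ.1
  have hE : MeasurableSet (pre k ⁻¹' E : Set (ℕ → S)) := (fm_pre k).preimage E
  have h1 := sum_inter μ (fm_pre (S := S) k) (s := Finset.univ) (by simp)
    (hE.inter (measurable_sh k hB))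
  have h2 := sum_inter μ (fm_pre (S := S) k) (s := Finset.univ) (by simp) hE
  rw [← h1, ← h2, Finset.sum_mul]
  refine Finset.sum_congr rfl fun w _ => ?_
  by_cases hw : w ∈ E
  · have e : (pre k ⁻¹' E ∩ pre k ⁻¹' {w} : Set (ℕ → S)) = pre k ⁻¹' {w} := by
      apply inter_eq_self_of_subset_right
      intro ω hω; simp only [mem_preimage, mem_singleton_iff] at *; rwa [hω]
    rw [inter_right_comm, e, real_pre_sh hμ k w hB]
    have := real_pre_sh hμ k w MeasurableSet.univ
    simp only [preimage_univ, inter_univ, probReal_univ, mul_one] at this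
    rw [this]
  · have e : (pre k ⁻¹' E ∩ pre k ⁻¹' {w} : Set (ℕ → S)) = ∅ := by
      ext ω; simp; intro h1 h2; rw [h2] at h1; exact hw h1
    rw [inter_right_comm, e]; simp

variable {α β : Type*} {X : (ℕ → S) → α} {Y : (ℕ → S) → β}

lemma FM.sh (hY : FM Y) (k : ℕ) : FM (fun ω => Y (sh k ω)) := by
  refine ⟨hY.1.subset ?_, fun a => ?_⟩
  · rintro _ ⟨ω, rfl⟩; exact ⟨_, rfl⟩
  · exact measurable_sh k (hY.2 a)

lemma ent_sh (hμ : IsUniformBernoulli S μ) (hY : FM Y) (k : ℕ) :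
    ent μ (fun ω => Y (sh k ω)) = ent μ Y := by
  refine finsum_congr fun a => ?_
  congr 1
  exact real_sh hμ k (hY.2 a)

lemma ent_indep (hμ : IsUniformBernoulli S μ) (k : ℕ)
    (hX : ∀ ω ω', pre k ω = pre k ω' → X ω = X ω') (hY : FM Y) :
    ent μ (fun ω => (X ω, Y (sh k ω))) = ent μ X + ent μ Y := by
  have := hμ.1
  rw [ent_pair_indep μ ((fm_pre k).of_factor hX) (hY.sh k), ent_sh hμ hY]
  intro a b
  have e : X ⁻¹' {a} = pre k ⁻¹' (pre k '' (X ⁻¹' {a})) := by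
    ext ω; simp only [mem_preimage, mem_singleton_iff, mem_image]
    constructor
    · intro h; exact ⟨ω, h, rfl⟩
    · rintro ⟨ω', h1, h2⟩; rw [← h1]; exact hX _ _ h2.symm
  have := real_indep hμ k (pre k '' (X ⁻¹' {a})) (hY.2 b)
  rw [← e] at this
  rw [show (fun ω => Y (SolTail.sh k ω)) ⁻¹' {b} = SolTail.sh k ⁻¹' (Y ⁻¹' {b}) from rfl, this,
    real_sh hμ k (hY.2 b)]

lemma ent_pre_add (hμ : IsUniformBernoulli S μ) (k n : ℕ) :
    ent μ (pre (k + n)) = ent μ (pre k) + ent μ (pre n) := by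
  have := hμ.1
  rw [← ent_indep hμ k (fun _ _ h => h) (fm_pre n)]
  refine ent_eq_of_factor μ ((fm_pre k).pair ((fm_pre n).sh k)) fun ω ω' => ?_
  simp only [Prod.mk.injEq, pre_eq_iff, sh]
  constructor
  · rintro ⟨h1, h2⟩ i hi
    by_cases h : i < k
    · exact h1 i h
    · have := h2 (i - k) (by omega)
      rwa [show k + (i - k) = i by omega] at this
  · intro h
    exact ⟨fun i hi => h i (by omega), fun i hi => h _ (by omega)⟩

lemma ent_pre_mul (hμ : IsUniformBernoulli S μ) (k J : ℕ) :
    ent μ (pre (k * J)) = J * ent μ (pre k) := by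
  have := hμ.1
  induction J with
  | zero =>
    simp only [mul_zero, Nat.cast_zero, zero_mul]
    refine le_antisymm ?_ ?_
    · refine le_trans (ent_le_of_factor μ (FM.const (Ω := ℕ → S) ()) ?_) (ent_const μ ()).le
      intro ω ω' _; funext i; exact i.elim0
    · refine le_trans (ent_const μ ()).ge (ent_le_of_factor μ (fm_pre 0) ?_)
      intros; rfl
  | succ J ih => rw [mul_add_one, ent_pre_add hμ, ih]; push_cast; ring

end Bernoulli

end SolTail


namespace SolTail

open MeasureTheory Set

section Transience

set_option linter.unusedSectionVars false
set_option linter.unusedVariables false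

variable {d : ℕ}

/-- The shifted squared norm. -/
noncomputable def Rr (x : Pt d) : ℝ := ∑ i, (x i : ℝ) ^ 2 + 10000

/-- The superharmonic function. -/
noncomputable def ff (x : Pt d) : ℝ := (√(√(Rr x)))⁻¹

/-- The averaging operator of the simple random walk. -/
noncomputable def Pop (g : Pt d → ℝ) (x : Pt d) : ℝ :=
  ∑ s : Fin d × Bool, (Fintype.card (Fin d × Bool) : ℝ)⁻¹ * g (x + stp s)

lemma Rr_ge (x : Pt d) : 10000 ≤ Rr x := by
  have : 0 ≤ ∑ i, (x i : ℝ) ^ 2 := Finset.sum_nonneg fun i _ => sq_nonneg _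
  unfold Rr; linarith

lemma ff_pos (x : Pt d) : 0 < ff x := by
  have := Rr_ge x
  unfold ff; positivity

lemma ff_pow (x : Pt d) : ff x ^ 4 * Rr x = 1 := by
  have h := Rr_ge x
  have h1 : √(√(Rr x)) ^ 4 = Rr x := by
    rw [show (4 : ℕ) = 2 * 2 by norm_num, pow_mul, Real.sq_sqrt (Real.sqrt_nonneg _),
      Real.sq_sqrt (by linarith)]
  unfold ff
  rw [inv_pow, h1]
  exact inv_mul_cancel₀ (by linarith)

lemma Rr_step (x : Pt d) (i : Fin d) (c : ℤ) (hc : c ^ 2 = 1) (y : Pt d)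
    (hy : ∀ j, y j = if j = i then c else 0) :
    Rr (x + y) = Rr x + (1 + 2 * c * x i) := by
  unfold Rr
  have : ∀ j, (((x + y) j : ℤ) : ℝ) ^ 2 = (x j : ℝ) ^ 2 + if j = i then (1 + 2 * c * x i : ℝ) else 0 := by
    intro j
    rw [Pi.add_apply, hy j]
    have hc' : (c : ℝ) ^ 2 = 1 := by exact_mod_cast hc
    split_ifs with h
    · subst h; push_cast; linear_combination hc'
    · simp
  simp_rw [this, Finset.sum_add_distrib]
  simp
  ring

lemma poly_bound (u : ℝ) (h1 : -(1/40) ≤ u) (h2 : u ≤ 1/40) :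
    1 ≤ (1 - u / 4 + 0.18 * u ^ 2) ^ 4 * (1 + u) := by
  have h3 : 0 ≤ 1 - u / 4 + 0.18 * u ^ 2 := by nlinarith
  have a1 : 1 - u / 2 + 0.42 * u ^ 2 - 0.09 * u^3 ≤ (1 - u / 4 + 0.18 * u ^ 2) ^ 2 := by
    nlinarith [sq_nonneg (u^2)]
  have a0 : 0 ≤ 1 - u / 2 + 0.42 * u ^ 2 - 0.09 * u^3 := by nlinarith [sq_nonneg u]
  have a2 : (1 - u / 2 + 0.42 * u ^ 2 - 0.09 * u^3)^2 ≤ (1 - u / 4 + 0.18 * u ^ 2) ^ 4 := by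
    rw [show (1 - u / 4 + 0.18 * u ^ 2) ^ 4 = ((1 - u / 4 + 0.18 * u ^ 2) ^ 2) ^ 2 by ring]
    exact pow_le_pow_left₀ a0 a1 2
  have a3 : 1 ≤ (1 - u / 2 + 0.42 * u ^ 2 - 0.09 * u^3)^2 * (1 + u) := by
    have e : (1 - u / 2 + 0.42 * u ^ 2 - 0.09 * u^3)^2 * (1 + u) - 1 =
      u ^ 2 * (0.09 + 0.49 * u - 0.3336 * u ^ 2 + 0.1908 * u ^ 3 - 0.0675 * u ^ 4
        + 0.0081 * u ^ 5) := by ring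
    have hab : |u| ≤ 1 / 40 := abs_le.2 ⟨h1, h2⟩
    have hp : ∀ k : ℕ, |u ^ k| ≤ (1 / 40) ^ k := fun k => by
      rw [abs_pow]; exact pow_le_pow_left₀ (abs_nonneg u) hab k
    have p2 := abs_le.1 (hp 2)
    have p3 := abs_le.1 (hp 3)
    have p4 := abs_le.1 (hp 4)
    have p5 := abs_le.1 (hp 5)
    norm_num at p2 p3 p4 p5
    have hb : 0 ≤ 0.09 + 0.49 * u - 0.3336 * u ^ 2 + 0.1908 * u ^ 3 - 0.0675 * u ^ 4
        + 0.0081 * u ^ 5 := by linarith [p2.1, p2.2, p3.1, p3.2, p4.1, p4.2, p5.1, p5.2]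
    have := mul_nonneg (sq_nonneg u) hb
    linarith
  exact a3.trans (mul_le_mul_of_nonneg_right a2 (by linarith))

lemma ff_step (x : Pt d) (y : Pt d) (u : ℝ) (h1 : -(1/40) ≤ u) (h2 : u ≤ 1/40)
    (hR : Rr y = Rr x * (1 + u)) : ff y ≤ ff x * (1 - u / 4 + 0.18 * u ^ 2) := by
  have hx := ff_pow x
  have hy := ff_pow y
  have hRx := Rr_ge x
  have hRy := Rr_ge y
  have hpx := ff_pos x
  have hp := poly_bound u h1 h2
  have h3 : 0 ≤ 1 - u / 4 + 0.18 * u ^ 2 := by nlinarith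
  refine le_of_pow_le_pow_left₀ (n := 4) (by norm_num) (mul_nonneg hpx.le h3) ?_
  have : ff y ^ 4 * Rr y ≤ (ff x * (1 - u / 4 + 0.18 * u ^ 2)) ^ 4 * Rr y := by
    rw [hy, hR, mul_pow]
    calc 1 ≤ (1 - u / 4 + 0.18 * u ^ 2) ^ 4 * (1 + u) := hp
      _ = (ff x ^ 4 * Rr x) * ((1 - u / 4 + 0.18 * u ^ 2) ^ 4 * (1 + u)) := by rw [hx]; ring
      _ = _ := by ring
  exact le_of_mul_le_mul_right this (by linarith)

lemma Pop_ff (hd : 3 ≤ d) (x : Pt d) : Pop ff x ≤ ff x - 0.009 * ff x ^ 5 := by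
  have hR := Rr_ge x
  have hp := ff_pos x
  have hd' : (3 : ℝ) ≤ d := by exact_mod_cast hd
  set R := Rr x with hRdef
  set g := ff x
  have hgR : g ^ 4 * R = 1 := ff_pow x
  have hR0 : 0 < R := by linarith
  have hterm : ∀ (i : Fin d) (c : ℤ) (hc : c ^ 2 = 1) (y : Pt d)
      (hy : ∀ j, y j = if j = i then c else 0),
      ff (x + y) ≤ g * (1 - (1 + 2 * c * x i) / R / 4 + 0.18 * ((1 + 2 * c * x i) / R) ^ 2) := by
    intro i c hc y hy
    have hxi : (x i : ℝ) ^ 2 ≤ R := by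
      have := Finset.single_le_sum (f := fun i => (x i : ℝ) ^ 2) (fun i _ => sq_nonneg _)
        (Finset.mem_univ i)
      rw [hRdef]; unfold Rr; linarith
    have hc' : (c : ℝ) ^ 2 = 1 := by exact_mod_cast hc
    have hcx : ((c : ℝ) * x i) ^ 2 ≤ R := by rw [mul_pow, hc']; linarith
    refine ff_step x _ _ ?_ ?_ ?_
    · rw [le_div_iff₀ hR0]; nlinarith [sq_nonneg ((c : ℝ) * x i + 100)]
    · rw [div_le_iff₀ hR0]; nlinarith [sq_nonneg ((c : ℝ) * x i - 100)]
    · rw [Rr_step x i c hc y hy, ← hRdef]; field_simp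
  have hpair : ∀ i : Fin d, ff (x + stp (i, true)) + ff (x + stp (i, false)) ≤
      g * (2 - 1 / (2 * R) + 0.36 * (1 / R^2 + 4 * (x i : ℝ)^2 / R^2)) := by
    intro i
    have t1 := hterm i 1 (by norm_num) (stp (i, true)) (by intro j; simp [stp, latE])
    have t2 := hterm i (-1) (by norm_num) (stp (i, false))
      (by intro j; simp only [stp, latE, Bool.false_eq_true, if_false, Pi.neg_apply]; split_ifs <;> simp)
    refine (add_le_add t1 t2).trans (le_of_eq ?_)
    push_cast
    field_simp
    ring
  have hsum : Pop ff x ≤ ((d : ℝ) * 2)⁻¹ * ∑ i : Fin d,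
      g * (2 - 1 / (2 * R) + 0.36 * (1 / R^2 + 4 * (x i : ℝ)^2 / R^2)) := by
    unfold Pop
    rw [← Finset.mul_sum, Fintype.sum_prod_type]
    simp only [Fintype.card_prod, Fintype.card_fin, Fintype.card_bool, Nat.cast_mul, Nat.cast_ofNat]
    refine mul_le_mul_of_nonneg_left (Finset.sum_le_sum fun i _ => ?_) (by positivity)
    rw [Fintype.sum_bool]
    exact hpair i
  refine hsum.trans ?_
  have hs : ∑ i : Fin d, g * (2 - 1 / (2 * R) + 0.36 * (1 / R^2 + 4 * (x i : ℝ)^2 / R^2))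
      = g * (d * (2 - 1 / (2 * R) + 0.36 / R^2) + 1.44 * (∑ i, (x i : ℝ)^2) / R^2) := by
    rw [← Finset.mul_sum, Finset.sum_add_distrib]
    simp only [Finset.sum_const, Finset.card_univ, Fintype.card_fin, nsmul_eq_mul, ← Finset.mul_sum,
      Finset.sum_add_distrib, ← Finset.sum_div]
    ring
  have hQ : ∑ i, (x i : ℝ)^2 = R - 10000 := by rw [hRdef]; unfold Rr; ring
  rw [hs, hQ]
  have h5 : g ^ 5 = g / R := by
    field_simp; linear_combination hgR
  rw [h5]
  have : ((d : ℝ) * 2)⁻¹ * (g * (d * (2 - 1 / (2 * R) + 0.36 / R^2) + 1.44 * (R - 10000) / R^2))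
      = g * (1 - 1 / (4 * R) + 0.18 / R^2 + 0.72 * (R - 10000) / R^2 / d) := by
    field_simp
    ring
  rw [this]
  have h6 : 0.72 * (R - 10000) / R^2 / d ≤ 0.24 * (R - 10000) / R^2 := by
    rw [div_le_iff₀ (by linarith)]
    have : 0 ≤ 0.24 * (R - 10000) / R^2 := by
      apply div_nonneg _ (by positivity); nlinarith
    calc 0.72 * (R - 10000) / R^2 = 0.24 * (R - 10000) / R^2 * 3 := by ring
      _ ≤ _ := mul_le_mul_of_nonneg_left hd' this
  have h7 : 1 - 1 / (4 * R) + 0.18 / R^2 + 0.72 * (R - 10000) / R^2 / d ≤ 1 - 0.009 / R := by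
    refine (add_le_add_right h6 _).trans ?_
    rw [← sub_nonneg]
    have : 1 - 0.009 / R - (1 - 1 / (4 * R) + 0.18 / R^2 + 0.24 * (R - 10000) / R^2) =
      (0.001 * R + 2399.82) / R^2 := by field_simp; ring
    rw [this]; positivity
  calc g * _ ≤ g * (1 - 0.009 / R) := mul_le_mul_of_nonneg_left h7 hp.le
    _ = _ := by ring

lemma card_pos' (hd : 3 ≤ d) : (0 : ℝ) < Fintype.card (Fin d × Bool) := by
  simp; omega

lemma Pop_mono {g g' : Pt d → ℝ} (h : ∀ x, g x ≤ g' x) (x : Pt d) : Pop g x ≤ Pop g' x := by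
  refine Finset.sum_le_sum fun s _ => mul_le_mul_of_nonneg_left (h _) (by positivity)

lemma Pop_nonneg {g : Pt d → ℝ} (h : ∀ x, 0 ≤ g x) (x : Pt d) : 0 ≤ Pop g x :=
  Finset.sum_nonneg fun s _ => mul_nonneg (by positivity) (h _)

lemma Pop_pow (hd : 3 ≤ d) {g : Pt d → ℝ} (h : ∀ x, 0 ≤ g x) (x : Pt d) :
    Pop g x ^ 5 ≤ Pop (fun y => g y ^ 5) x := by
  refine Real.pow_arith_mean_le_arith_mean_pow Finset.univ _ _ (fun _ _ => by positivity) ?_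
    (fun _ _ => h _) 5
  have := card_pos' hd
  rw [Finset.sum_const, nsmul_eq_mul, Finset.card_univ]
  exact mul_inv_cancel₀ this.ne'

/-- Iterated averages of the superharmonic function. -/
noncomputable def Aa (t : ℕ) : Pt d → ℝ := Pop^[t] ff

lemma Aa_succ (t : ℕ) : Aa (t + 1) = Pop (Aa t : Pt d → ℝ) := Function.iterate_succ_apply' _ _ _

lemma Aa_nonneg (t : ℕ) (x : Pt d) : 0 ≤ Aa t x := by
  induction t generalizing x with
  | zero => exact (ff_pos x).le
  | succ t ih => rw [Aa_succ]; exact Pop_nonneg ih x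

lemma Aa_dec (hd : 3 ≤ d) (t : ℕ) (x : Pt d) : Aa (t + 1) x ≤ Aa t x - 0.009 * Aa t x ^ 5 := by
  induction t generalizing x with
  | zero => rw [Aa_succ]; exact Pop_ff hd x
  | succ t ih =>
    rw [Aa_succ (t + 1)]
    have h1 := Pop_mono ih x
    have h2 : Pop (fun x => Aa t x - 0.009 * Aa t x ^ 5) x
        = Pop (Aa t) x - 0.009 * Pop (fun x => Aa t x ^ 5) x := by
      unfold Pop
      rw [Finset.mul_sum, ← Finset.sum_sub_distrib]
      exact Finset.sum_congr rfl fun s _ => by ring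
    have h3 := Pop_pow hd (Aa_nonneg t) x
    rw [h2] at h1
    rw [← Aa_succ t] at h1 h3
    linarith

lemma Aa_sum (hd : 3 ≤ d) (T : ℕ) (x : Pt d) : ∑ t ∈ Finset.range T, Aa t x ^ 5 ≤ 12 := by
  have : 0.009 * ∑ t ∈ Finset.range T, Aa t x ^ 5 + Aa T x ≤ Aa 0 x := by
    induction T with
    | zero => simp
    | succ T ih => rw [Finset.sum_range_succ]; have := Aa_dec hd T x; linarith
  have h0 := Aa_nonneg T x
  have h1 : Aa 0 x ≤ 1 / 10 := by
    show ff x ≤ 1 / 10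
    refine le_of_pow_le_pow_left₀ (n := 4) (by norm_num) (by norm_num) ?_
    have h1 := ff_pow x
    have h2 := Rr_ge x
    have h3 : 0 ≤ ff x ^ 4 := by positivity
    nlinarith
  linarith

variable {μ : Measure (ℕ → Fin d × Bool)}

lemma first_step (hμ : IsUniformBernoulli (Fin d × Bool) μ) (B : Fin d × Bool → Set (ℕ → Fin d × Bool))
    (hB : ∀ s, MeasurableSet (B s)) :
    μ.real {ω | sh 1 ω ∈ B (ω 0)} =
      ∑ s, (Fintype.card (Fin d × Bool) : ℝ)⁻¹ * μ.real (B s) := by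
  have := hμ.1
  have hX : FM (fun ω : ℕ → Fin d × Bool => ω 0) :=
    ⟨Set.toFinite _, fun a => (measurable_pi_apply _) (measurableSet_singleton _)⟩
  have hE : MeasurableSet {ω : ℕ → Fin d × Bool | sh 1 ω ∈ B (ω 0)} := by
    have : {ω : ℕ → Fin d × Bool | sh 1 ω ∈ B (ω 0)} =
        ⋃ s, ((fun ω : ℕ → Fin d × Bool => ω 0) ⁻¹' {s} ∩ sh 1 ⁻¹' (B s)) := by
      ext ω; simp
    rw [this]
    exact MeasurableSet.iUnion fun s => (hX.2 s).inter (measurable_sh 1 (hB s))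
  rw [← sum_inter μ hX (s := Finset.univ) (by simp) hE]
  refine Finset.sum_congr rfl fun s _ => ?_
  have := real_pre_sh hμ 1 (fun _ => s) (hB s)
  rw [pow_one] at this
  rw [← this]
  congr 1
  ext ω
  simp only [mem_inter_iff, mem_preimage, mem_singleton_iff, mem_ofPred_eq, funext_iff, pre]
  constructor
  · rintro ⟨h1, rfl⟩
    exact ⟨fun i => by rw [Fin.val_eq_zero i], h1⟩
  · rintro ⟨h1, h2⟩
    have := h1 0
    simp only [Fin.val_zero] at this
    rw [this]; exact ⟨h2, rfl⟩

lemma measurable_pos (n : ℕ) (x : Pt d) : MeasurableSet {ω : ℕ → Fin d × Bool | pos n ω = x} := by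
  have : FM (pos n : (ℕ → Fin d × Bool) → Pt d) :=
    (fm_pre n).of_factor fun ω ω' h => pos_congr n ω ω' (pre_eq_iff.1 h)
  exact this.2 x

lemma measurable_pos' (n : ℕ) (x y : Pt d) :
    MeasurableSet {ω : ℕ → Fin d × Bool | x + pos n ω = y} := by
  convert measurable_pos n (y - x) using 3
  rw [eq_sub_iff_add_eq, add_comm]

lemma pos_succ' (n : ℕ) (ω : ℕ → Fin d × Bool) : pos (n + 1) ω = stp (ω 0) + pos n (sh 1 ω) := by
  rw [add_comm, pos_add]; simp [pos]

lemma hit_fin (hd : 3 ≤ d) (hμ : IsUniformBernoulli (Fin d × Bool) μ) (T : ℕ) (x : Pt d) :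
    μ.real {ω | ∃ n ≤ T, x + pos n ω = 0} ≤ 10 * ff x := by
  have := hμ.1
  have hx0 : ff (0 : Pt d) = 1 / 10 := by
    have : Rr (0 : Pt d) = 100 ^ 2 := by simp [Rr]; norm_num
    rw [ff, this, Real.sqrt_sq (by norm_num), show (100 : ℝ) = 10 ^ 2 by norm_num,
      Real.sqrt_sq (by norm_num)]
    norm_num
  have hzero : ∀ T, μ.real {ω | ∃ n ≤ T, (0 : Pt d) + pos n ω = 0} ≤ 10 * ff (0 : Pt d) := by
    intro T
    rw [hx0]; norm_num
  induction T generalizing x with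
  | zero =>
    by_cases hx : x = 0
    · subst hx; exact hzero 0
    · have : {ω : ℕ → Fin d × Bool | ∃ n ≤ 0, x + pos n ω = 0} = ∅ := by
        ext ω; simp [pos, hx]
      rw [this]; simp [(ff_pos x).le]
  | succ T ih =>
    by_cases hx : x = 0
    · subst hx; exact hzero _
    · have e : {ω : ℕ → Fin d × Bool | ∃ n ≤ T + 1, x + pos n ω = 0} =
          {ω | sh 1 ω ∈ {ω' | ∃ n ≤ T, (x + stp (ω 0)) + pos n ω' = 0}} := by
        ext ω
        simp only [mem_ofPred_eq]
        constructor
        · rintro ⟨n, hn, h⟩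
          rcases n with _ | n
          · simp [pos, hx] at h
          · refine ⟨n, by omega, ?_⟩
            rw [pos_succ', ← add_assoc] at h; exact h
        · rintro ⟨n, hn, h⟩
          refine ⟨n + 1, by omega, ?_⟩
          rw [pos_succ', ← add_assoc]; exact h
      rw [e, first_step hμ (fun s => {ω' | ∃ n ≤ T, (x + stp s) + pos n ω' = 0})]
      · have h1 := Pop_ff hd x
        have h2 : ∑ s : Fin d × Bool, (Fintype.card (Fin d × Bool) : ℝ)⁻¹ *
            μ.real {ω' | ∃ n ≤ T, (x + stp s) + pos n ω' = 0} ≤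
            ∑ s : Fin d × Bool, (Fintype.card (Fin d × Bool) : ℝ)⁻¹ * (10 * ff (x + stp s)) :=
          Finset.sum_le_sum fun s _ => mul_le_mul_of_nonneg_left (ih _) (by positivity)
        have h3 : ∑ s : Fin d × Bool, (Fintype.card (Fin d × Bool) : ℝ)⁻¹ * (10 * ff (x + stp s))
          = 10 * Pop ff x := by
          unfold Pop; rw [Finset.mul_sum]; exact Finset.sum_congr rfl fun s _ => by ring
        have h4 := ff_pos x
        have h5 : 0 ≤ ff x ^ 5 := by positivity
        linarith
      · intro s
        have : {ω' : ℕ → Fin d × Bool | ∃ n ≤ T, (x + stp s) + pos n ω' = 0} =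
          ⋃ n ∈ {n | n ≤ T}, {ω' | (x + stp s) + pos n ω' = 0} := by ext; simp
        rw [this]
        exact MeasurableSet.biUnion (Set.to_countable _) fun n _ => measurable_pos' _ _ _

lemma hit_inf (hd : 3 ≤ d) (hμ : IsUniformBernoulli (Fin d × Bool) μ) (x : Pt d) :
    μ.real {ω | ∃ n, x + pos n ω = 0} ≤ 10 * ff x := by
  have := hμ.1
  have hU : {ω : ℕ → Fin d × Bool | ∃ n, x + pos n ω = 0} =
      ⋃ T : ℕ, {ω | ∃ n ≤ T, x + pos n ω = 0} := by
    ext ω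
    simp only [mem_ofPred_eq, mem_iUnion]
    constructor
    · rintro ⟨n, h⟩; exact ⟨n, n, le_rfl, h⟩
    · rintro ⟨_, n, _, h⟩; exact ⟨n, h⟩
  have hm : Monotone fun T : ℕ => {ω : ℕ → Fin d × Bool | ∃ n ≤ T, x + pos n ω = 0} := by
    rintro a b hab ω ⟨n, h1, h2⟩; exact ⟨n, h1.trans hab, h2⟩
  have ht := tendsto_measure_iUnion_atTop (μ := μ) hm
  rw [← hU] at ht
  have ht' := (ENNReal.tendsto_toReal (measure_ne_top μ _)).comp ht
  exact le_of_tendsto ht' (Filter.Eventually.of_forall fun T => hit_fin hd hμ T x)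

lemma measurable_late (t : ℕ) (x y : Pt d) :
    MeasurableSet {ω : ℕ → Fin d × Bool | ∃ n ≥ t, x + pos n ω = y} := by
  have : {ω' : ℕ → Fin d × Bool | ∃ n ≥ t, x + pos n ω' = y} =
    ⋃ n ∈ {n | n ≥ t}, {ω' | x + pos n ω' = y} := by ext; simp
  rw [this]
  exact MeasurableSet.biUnion (Set.to_countable _) fun n _ => measurable_pos' _ _ _

lemma hit_late (hd : 3 ≤ d) (hμ : IsUniformBernoulli (Fin d × Bool) μ) (t : ℕ) (x : Pt d) :
    μ.real {ω | ∃ n ≥ t, x + pos n ω = 0} ≤ 10 * Aa t x := by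
  induction t generalizing x with
  | zero => simpa [Aa] using hit_inf hd hμ x
  | succ t ih =>
    have e : {ω : ℕ → Fin d × Bool | ∃ n ≥ t + 1, x + pos n ω = 0} =
        {ω | sh 1 ω ∈ {ω' | ∃ n ≥ t, (x + stp (ω 0)) + pos n ω' = 0}} := by
      ext ω
      simp only [mem_ofPred_eq]
      constructor
      · rintro ⟨n, hn, h⟩
        obtain ⟨n, rfl⟩ : ∃ m, n = m + 1 := ⟨n - 1, by omega⟩
        refine ⟨n, by omega, ?_⟩
        rw [pos_succ', ← add_assoc] at h; exact h
      · rintro ⟨n, hn, h⟩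
        refine ⟨n + 1, by omega, ?_⟩
        rw [pos_succ', ← add_assoc]; exact h
    rw [e, first_step hμ (fun s => {ω' | ∃ n ≥ t, (x + stp s) + pos n ω' = 0})
      (fun s => measurable_late _ _ _), Aa_succ]
    unfold Pop
    rw [Finset.mul_sum]
    refine Finset.sum_le_sum fun s _ => ?_
    have := mul_le_mul_of_nonneg_left (ih (x + stp s))
      (show (0 : ℝ) ≤ (Fintype.card (Fin d × Bool) : ℝ)⁻¹ by positivity)
    linarith

lemma visit_late (hd : 3 ≤ d) (hμ : IsUniformBernoulli (Fin d × Bool) μ) (t : ℕ) (x : Pt d) :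
    μ.real {ω | ∃ n ≥ t, pos n ω = x} ≤ 10 * Aa t (-x) := by
  have h := hit_late hd hμ t (-x)
  have e : {ω : ℕ → Fin d × Bool | ∃ n ≥ t, pos n ω = x} = {ω | ∃ n ≥ t, -x + pos n ω = 0} := by
    ext ω; simp only [mem_ofPred_eq, neg_add_eq_zero, eq_comm (a := x)]
  rw [e]; exact h

lemma ae_transient (hd : 3 ≤ d) (hμ : IsUniformBernoulli (Fin d × Bool) μ) :
    ∀ᵐ ω ∂μ, ∀ x : Pt d, ∃ N, ∀ n ≥ N, pos n ω ≠ x := by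
  have := hμ.1
  rw [ae_all_iff]
  intro x
  have hz : μ.real {ω | ¬ ∃ N, ∀ n ≥ N, pos n ω ≠ x} = 0 := by
    by_contra hne
    have hpos : 0 < μ.real {ω | ¬ ∃ N, ∀ n ≥ N, pos n ω ≠ x} :=
      lt_of_le_of_ne measureReal_nonneg (Ne.symm hne)
    set v := μ.real {ω | ¬ ∃ N, ∀ n ≥ N, pos n ω ≠ x} with hv
    have hle : ∀ t, v / 10 ≤ Aa t (-x) := by
      intro t
      have h1 := visit_late hd hμ t x
      have h2 : v ≤ μ.real {ω | ∃ n ≥ t, pos n ω = x} := by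
        refine measureReal_mono ?_
        intro ω hω
        simp only [mem_ofPred_eq] at *
        push Not at hω
        obtain ⟨n, hn, h⟩ := hω t
        exact ⟨n, hn, h⟩
      linarith
    obtain ⟨T, hT⟩ := exists_nat_gt (12 / (v / 10) ^ 5)
    have h3 := Aa_sum hd T (-x)
    have h4 : (T : ℝ) * (v / 10) ^ 5 ≤ ∑ t ∈ Finset.range T, Aa t (-x) ^ 5 := by
      have := Finset.card_nsmul_le_sum (Finset.range T) (fun t => Aa t (-x) ^ 5) ((v/10)^5)
        (fun t _ => pow_le_pow_left₀ (by positivity) (hle t) 5)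
      simpa using this
    rw [div_lt_iff₀ (by positivity)] at hT
    linarith
  rw [measureReal_eq_zero_iff] at hz
  exact hz

end Transience

end SolTail


namespace SolTail

open MeasureTheory Set

section Magnus

set_option linter.unusedSectionVars false
set_option linter.unusedVariables false

variable {d : ℕ}

lemma sold_comm (a b : Sold d) (ha : a ∈ commutator (Sold d)) (hb : b ∈ commutator (Sold d)) :
    a * b = b * a := by
  have h2 : derivedSeries (Sold d) 2 = ⊥ := by
    rw [← map_derivedSeries_eq (f := QuotientGroup.mk' (derivedSeries (FreeGroup (Fin d)) 2))
      (QuotientGroup.mk'_surjective _) 2]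
    exact (Subgroup.map_eq_bot_iff _).2 (by rw [QuotientGroup.ker_mk'])
  have h3 : ⁅commutator (Sold d), commutator (Sold d)⁆ = ⊥ := by
    rw [← h2, ← derivedSeries_one]; rfl
  rw [Subgroup.commutator_eq_bot_iff_le_centralizer] at h3
  exact (Subgroup.mem_centralizer_iff.1 (h3 ha) b hb).symm

/-- The derived subgroup of the free metabelian group. -/
def KK (d : ℕ) : Type := commutator (Sold d)

noncomputable instance instGroupKK (d : ℕ) : Group (KK d) :=
  inferInstanceAs (Group (commutator (Sold d)))

noncomputable instance instCommGroupKK (d : ℕ) : CommGroup (KK d) :=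
  { instGroupKK d with
    mul_comm := fun a b => Subtype.ext (sold_comm a.1 b.1 a.2 b.2) }

/-- Underlying element. -/
noncomputable def kv : KK d →* Sold d := (commutator (Sold d)).subtype

/-- Generators. -/
def gen (i : Fin d) : Sold d := QuotientGroup.mk (FreeGroup.of i)

/-- Letters. -/
def lett (s : Fin d × Bool) : Sold d := if s.2 then gen s.1 else (gen s.1)⁻¹

/-- Class in the abelianization. -/
noncomputable def thet (v : Pt d) : Abelianization (Sold d) :=
  ∏ i, (Abelianization.of (gen i)) ^ (v i)

lemma thet_add (v w : Pt d) : thet (v + w) = thet v * thet w := by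
  simp [thet, zpow_add, Finset.prod_mul_distrib]

lemma thet_lat (i : Fin d) : thet (latE d i) = Abelianization.of (gen i) := by
  simp [thet, latE]

/-- A section. -/
noncomputable def tau (v : Pt d) : Sold d :=
  (QuotientGroup.mk_surjective (s := commutator (Sold d)) (thet v)).choose

lemma tau_spec (v : Pt d) : Abelianization.of (tau v) = thet v :=
  (QuotientGroup.mk_surjective (s := commutator (Sold d)) (thet v)).choose_spec

lemma cc_mem (e : Edg d) : tau e.1 * gen e.2 * (tau (e.1 + latE d e.2))⁻¹ ∈ commutator (Sold d) := by
  have : Abelianization.of (tau e.1 * gen e.2 * (tau (e.1 + latE d e.2))⁻¹) = 1 := by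
    rw [map_mul, map_mul, map_inv, tau_spec, tau_spec, thet_add, thet_lat, mul_inv_cancel]
  exact (QuotientGroup.eq_one_iff _).1 this

/-- The edge elements. -/
noncomputable def cc (e : Edg d) : KK d := ⟨_, cc_mem e⟩

lemma kv_cc (e : Edg d) : kv (cc e) = tau e.1 * gen e.2 * (tau (e.1 + latE d e.2))⁻¹ := rfl

/-- The product of edge elements along a flow. -/
noncomputable def Psi (f : Edg d →₀ ℤ) : KK d :=
  Additive.toMul (Finsupp.liftAddHom (fun e : Edg d => zmultiplesHom (Additive (KK d))
    (Additive.ofMul (cc e))) f)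

lemma Psi_add (f g : Edg d →₀ ℤ) : Psi (f + g) = Psi f * Psi g := by
  unfold Psi
  rw [map_add]; rfl

lemma Psi_zero : Psi (0 : Edg d →₀ ℤ) = 1 := by
  unfold Psi
  rw [map_zero]; rfl

lemma Psi_single (e : Edg d) : Psi (Finsupp.single e 1) = cc e := by
  unfold Psi
  rw [Finsupp.liftAddHom_apply_single]
  simp

lemma Psi_single_neg (e : Edg d) : Psi (Finsupp.single e (-1)) = (cc e)⁻¹ := by
  have h := Psi_add (Finsupp.single e (-1)) (Finsupp.single e 1)
  rw [← Finsupp.single_add, Psi_single] at h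
  simp only [neg_add_cancel, Finsupp.single_zero, Psi_zero] at h
  exact eq_inv_of_mul_eq_one_left h.symm

lemma word_psi (w : List (Fin d × Bool)) (p : Pt d) :
    tau p * (QuotientGroup.mk (FreeGroup.mk w) : Sold d) =
      kv (Psi (crossFrom d p w)) * tau (w.foldl (stepFn d) p) := by
  induction w generalizing p with
  | nil =>
    simp only [crossFrom, Psi_zero, List.foldl_nil, map_one]
    rw [show FreeGroup.mk ([] : List (Fin d × Bool)) = 1 from rfl]
    exact (mul_one _).trans (one_mul _).symm
  | cons s w ih =>
    have e1 : FreeGroup.mk (s :: w) = FreeGroup.mk [s] * FreeGroup.mk w := by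
      rw [FreeGroup.mul_mk]; rfl
    have e2 : (QuotientGroup.mk (FreeGroup.mk [s]) : Sold d) = lett s := by
      obtain ⟨i, b⟩ := s
      cases b
      · simp only [lett, gen]
        rw [if_neg (by simp), ← QuotientGroup.mk_inv]; rfl
      · rfl
    rw [e1, QuotientGroup.mk_mul, e2, List.foldl_cons, crossFrom, Psi_add]
    have ih' := ih (stepFn d p s)
    rw [map_mul, mul_assoc, ← ih', ← mul_assoc, ← mul_assoc]
    congr 1
    obtain ⟨i, b⟩ := s
    cases b
    · simp only [Bool.false_eq_true, if_false, Psi_single_neg, lett, stepFn, map_inv, kv_cc]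
      rw [sub_add_cancel, sub_eq_add_neg]
      group
    · simp only [if_true, Psi_single, lett, stepFn, kv_cc]
      group

lemma solWalk_eq (n : ℕ) (ω : ℕ → Fin d × Bool) :
    solWalk d ω n = (tau 0)⁻¹ * (kv (Psi (crossFrom d 0 (List.ofFn fun k : Fin n => ω (k : ℕ))))
      * tau (pos n ω)) := by
  have := word_psi (List.ofFn fun k : Fin n => ω (k : ℕ)) 0
  rw [foldl_ofFn] at this
  rw [← this]
  exact (inv_mul_cancel_left _ _).symm

lemma solWalk_of_hh {n : ℕ} {ω ω' : ℕ → Fin d × Bool} (h : hh n ω = hh n ω') :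
    solWalk d ω n = solWalk d ω' n := by
  simp only [hh, Prod.mk.injEq] at h
  have : crossFrom d 0 (List.ofFn fun k : Fin n => ω (k : ℕ)) =
      crossFrom d 0 (List.ofFn fun k : Fin n => ω' (k : ℕ)) := by
    ext e; rw [crossFrom_ofFn, crossFrom_ofFn, h.2]
  rw [solWalk_eq, solWalk_eq, this, h.1]

lemma solWalk_add (n j : ℕ) (ω : ℕ → Fin d × Bool) :
    solWalk d ω (n + j) = solWalk d ω n * solWalk d (sh n ω) j := by
  simp only [solWalk]
  rw [← QuotientGroup.mk_mul, FreeGroup.mul_mk, List.ofFn_add]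
  rfl

/-- Tail events at level `N` depend on `hh N` and the shifted path. -/
lemma tail_rep (N : ℕ) {A : Set (ℕ → Fin d × Bool)} (hA : @MeasurableSet _ (solTail d) A) :
    ∃ T : Pt d × (Edg d → ℤ) → Set (ℕ → Fin d × Bool), (∀ h, MeasurableSet (T h)) ∧
      ∀ ω, ω ∈ A ↔ sh N ω ∈ T (hh N ω) := by
  have hw : ∀ n, FM (fun ω : ℕ → Fin d × Bool => solWalk d ω n) := fun n =>
    (fm_pre n).of_factor fun ω ω' h => solWalk_of_hh (hh_of_pre h)
  have h1 : @MeasurableSet _ (⨆ n : ℕ, MeasurableSpace.comap (fun ω => solWalk d ω (N + n)) ⊤) A := by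
    have : solTail d ≤ ⨆ n : ℕ, MeasurableSpace.comap (fun ω => solWalk d ω (N + n)) ⊤ :=
      iInf_le _ N
    exact this _ hA
  -- sections for each group element
  have key : ∃ T : Sold d → Set (ℕ → Fin d × Bool), (∀ h, MeasurableSet (T h)) ∧
      ∀ ω, ω ∈ A ↔ sh N ω ∈ T (solWalk d ω N) := by
    clear hA
    rw [MeasurableSpace.measurableSet_iSup] at h1
    induction h1 with
    | basic u hu =>
      obtain ⟨n, s, -, rfl⟩ := hu
      refine ⟨fun g => (fun ω => solWalk d ω n) ⁻¹' {x | g * x ∈ s}, fun g => (hw n).preimage _,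
        fun ω => ?_⟩
      simp only [mem_preimage, mem_ofPred_eq, solWalk_add]
    | empty => exact ⟨fun _ => ∅, fun _ => MeasurableSet.empty, fun ω => by simp⟩
    | compl t ht ih =>
      obtain ⟨T, hT, h⟩ := ih
      exact ⟨fun g => (T g)ᶜ, fun g => (hT g).compl, fun ω => by
        simp only [mem_compl_iff, h]⟩
    | iUnion f hf ih =>
      choose T hT h using ih
      exact ⟨fun g => ⋃ n, T n g, fun g => MeasurableSet.iUnion fun n => hT n g, fun ω => by
        simp only [mem_iUnion, h]⟩
  obtain ⟨T, hT, h⟩ := key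
  classical
  refine ⟨fun x => if hx : ∃ ω, hh N ω = x then T (solWalk d hx.choose N) else ∅, fun x => ?_,
    fun ω => ?_⟩
  · dsimp only
    split_ifs
    · exact hT _
    · exact MeasurableSet.empty
  · have hx : ∃ ω', hh N ω' = hh N ω := ⟨ω, rfl⟩
    dsimp only
    rw [dif_pos hx, solWalk_of_hh hx.choose_spec]
    exact h ω

end Magnus

end SolTail


namespace SolTail

open MeasureTheory Set

section Stab

set_option linter.unusedSectionVars false
set_option linter.unusedVariables false

variable {d : ℕ}

/-- The stabilized crossing function. -/
noncomputable def Phi (ω : ℕ → Fin d × Bool) : Edg d → ℤ := fun e => stabCross d ω e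

lemma ev_ne {p : Pt d} {s : Fin d × Bool} {e : Edg d} (h : ev p s e ≠ 0) :
    p = e.1 ∨ p = e.1 + latE d e.2 := by
  classical
  unfold ev at h
  split_ifs at h
  · rw [Finsupp.single_apply] at h
    simp only [ne_eq, ite_eq_right_iff, one_ne_zero, imp_false, not_not] at h
    left; rw [← h]
  · rw [Finsupp.single_apply] at h
    simp only [ne_eq, ite_eq_right_iff, neg_eq_zero, one_ne_zero, imp_false, not_not] at h
    right; rw [← h]; simp

lemma cr_stable {n : ℕ} {ω : ℕ → Fin d × Bool} {e : Edg d}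
    (h : ∀ m ≥ n, pos m ω ≠ e.1 ∧ pos m ω ≠ e.1 + latE d e.2) :
    ∀ m ≥ n, cr m ω e = cr n ω e := by
  intro m hm
  induction m, hm using Nat.le_induction with
  | base => rfl
  | succ m hm ih =>
    rw [cr, ih]
    have : ev (pos m ω) (ω m) e = 0 := by
      by_contra hne
      rcases ev_ne hne with h1 | h1
      · exact (h m hm).1 h1
      · exact (h m hm).2 h1
    rw [this, add_zero]

lemma Phi_eq {n : ℕ} {ω : ℕ → Fin d × Bool} {e : Edg d} {z : ℤ}
    (h : ∀ m ≥ n, cr m ω e = z) : Phi ω e = z := by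
  have hex : ∃ N : ℕ, ∀ n : ℕ, N ≤ n →
      crossFrom d 0 (List.ofFn fun k : Fin n => ω (k : ℕ)) e
        = crossFrom d 0 (List.ofFn fun k : Fin N => ω (k : ℕ)) e := by
    refine ⟨n, fun m hm => ?_⟩
    rw [crossFrom_ofFn, crossFrom_ofFn, h m hm, h n le_rfl]
  unfold Phi stabCross
  rw [dif_pos hex]
  have h1 := hex.choose_spec (max n hex.choose) (le_max_right _ _)
  rw [← h1, crossFrom_ofFn]
  exact h _ (le_max_left _ _)

lemma Phi_iff (ω : ℕ → Fin d × Bool) (e : Edg d) (z : ℤ) :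
    Phi ω e = z ↔ (∃ N, ∀ n ≥ N, cr n ω e = z) ∨
      (z = 0 ∧ ¬ ∃ N, ∀ n ≥ N, cr n ω e = cr N ω e) := by
  constructor
  · intro h
    by_cases hs : ∃ N, ∀ n ≥ N, cr n ω e = cr N ω e
    · left
      obtain ⟨N, hN⟩ := hs
      refine ⟨N, ?_⟩
      rw [← h, Phi_eq hN]; exact hN
    · right
      refine ⟨?_, hs⟩
      rw [← h]
      unfold Phi stabCross
      rw [dif_neg]
      simpa only [crossFrom_ofFn] using hs
  · rintro (⟨N, hN⟩ | ⟨rfl, hs⟩)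
    · exact Phi_eq hN
    · unfold Phi stabCross
      rw [dif_neg]
      simpa only [crossFrom_ofFn] using hs

lemma fm_hh (n : ℕ) : FM (hh n : (ℕ → Fin d × Bool) → _) :=
  (fm_pre n).of_factor fun _ _ h => hh_of_pre h

lemma fm_cr (n : ℕ) (e : Edg d) : FM (fun ω : ℕ → Fin d × Bool => cr n ω e) :=
  (fm_hh n).comp fun h => h.2 e

lemma measurable_Phi : Measurable (Phi : (ℕ → Fin d × Bool) → Edg d → ℤ) := by
  refine measurable_pi_lambda _ fun e => ?_
  refine measurable_to_countable' fun z => ?_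
  have hm : ∀ n, Measurable (fun ω : ℕ → Fin d × Bool => cr n ω e) := fun n =>
    measurable_to_countable' fun z => (fm_cr n e).2 z
  have : (fun ω : ℕ → Fin d × Bool => Phi ω e) ⁻¹' {z} = {ω | (∃ N, ∀ n ≥ N, cr n ω e = z) ∨
      (z = 0 ∧ ¬ ∃ N, ∀ n ≥ N, cr n ω e = cr N ω e)} := by
    ext ω; exact Phi_iff ω e z
  rw [this]
  refine MeasurableSet.union ?_ (MeasurableSet.inter (MeasurableSet.const _) (MeasurableSet.compl ?_))
  · have : {ω : ℕ → Fin d × Bool | ∃ N, ∀ n ≥ N, cr n ω e = z} =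
      ⋃ N, ⋂ n, ⋂ (_ : n ≥ N), {ω | cr n ω e = z} := by
      ext ω; simp
    refine (this ▸ ?_ : MeasurableSet {ω : ℕ → Fin d × Bool | ∃ N, ∀ n ≥ N, cr n ω e = z})
    exact MeasurableSet.iUnion fun N => MeasurableSet.iInter fun n => MeasurableSet.iInter fun _ =>
      measurableSet_eq_fun (hm n) measurable_const
  · have : {ω : ℕ → Fin d × Bool | ∃ N, ∀ n ≥ N, cr n ω e = cr N ω e} =
      ⋃ N, ⋂ n, ⋂ (_ : n ≥ N), {ω | cr n ω e = cr N ω e} := by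
      ext ω; simp
    refine (this ▸ ?_ : MeasurableSet {ω : ℕ → Fin d × Bool | ∃ N, ∀ n ≥ N, cr n ω e = cr N ω e})
    exact MeasurableSet.iUnion fun N => MeasurableSet.iInter fun n => MeasurableSet.iInter fun _ =>
      measurableSet_eq_fun (hm n) (hm N)

/-- Reconstruction of the flow from the state and the future flow. -/
def rec' (h : Pt d × (Edg d → ℤ)) (φ : Edg d → ℤ) : Edg d → ℤ := fun e => h.2 e + φ (e.1 - h.1, e.2)

lemma measurable_rec (h : Pt d × (Edg d → ℤ)) : Measurable (rec' h) :=
  measurable_pi_lambda _ fun e => measurable_const.add (measurable_pi_apply _)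

lemma Phi_shift {ω : ℕ → Fin d × Bool} (hω : ∀ x : Pt d, ∃ N, ∀ n ≥ N, pos n ω ≠ x) (k : ℕ) :
    Phi ω = rec' (hh k ω) (Phi (sh k ω)) := by
  funext e
  obtain ⟨N1, h1⟩ := hω e.1
  obtain ⟨N2, h2⟩ := hω (e.1 + latE d e.2)
  have hst : ∀ m ≥ max N1 N2, cr m ω e = cr (max N1 N2) ω e := cr_stable fun m hm =>
    ⟨h1 m (le_trans (le_max_left _ _) hm), h2 m (le_trans (le_max_right _ _) hm)⟩
  rw [Phi_eq hst]
  simp only [rec', hh]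
  rw [Phi_eq (n := max N1 N2) (z := cr (max N1 N2) ω e - cr k ω e)]
  · ring
  · intro m hm
    have := cr_add k m ω e
    rw [hst (k + m) (by omega)] at this
    linarith

variable {μ : Measure (ℕ → Fin d × Bool)} {α β : Type*}

lemma FM.map {Ω Ω' : Type*} [MeasurableSpace Ω] [MeasurableSpace Ω'] {ψ : Ω' → α} (hψ : FM ψ)
    {f : Ω → Ω'} (hf : Measurable f) : FM (fun ω => ψ (f ω)) :=
  ⟨hψ.1.subset (by rintro _ ⟨ω, rfl⟩; exact ⟨_, rfl⟩), fun a => hf (hψ.2 a)⟩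

lemma hh_sub {k n : ℕ} {ω ω' : ℕ → Fin d × Bool} (h1 : hh k ω = hh k ω')
    (h2 : hh (k + n) ω = hh (k + n) ω') : hh n (sh k ω) = hh n (sh k ω') := by
  simp only [hh, Prod.mk.injEq] at *
  obtain ⟨p1, c1⟩ := h1
  obtain ⟨p2, c2⟩ := h2
  constructor
  · rw [pos_add, pos_add, p1] at p2; exact add_left_cancel p2
  · funext e
    have := congrFun c2 (e.1 + pos k ω, e.2)
    rw [cr_add, cr_add, c1] at this
    have := add_left_cancel this
    simp only [add_sub_cancel_right] at this
    rw [p1] at this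
    simpa using this

/-- Lower bound for conditional entropy given a tail variable. -/
lemma L_bound (hμ : IsUniformBernoulli (Fin d × Bool) μ) (k m : ℕ)
    (q : Pt d × (Edg d → ℤ) → (ℕ → Fin d × Bool) → α) (hq : ∀ h, FM (q h))
    (Q : (ℕ → Fin d × Bool) → α) (hQ : ∀ ω, Q ω = q (hh (k + m) ω) (sh (k + m) ω)) :
    FM Q ∧ ent μ (pre k : (ℕ → Fin d × Bool) → _) + ent μ (hh m : (ℕ → Fin d × Bool) → _) + ent μ Q ≤
      ent μ (hh (k + m) : (ℕ → Fin d × Bool) → _) + ent μ (fun ω => (pre k ω, Q ω)) := by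
  have := hμ.1
  set N := k + m with hN
  have hfin : Finite (Set.range (hh N : (ℕ → Fin d × Bool) → _)) := (fm_hh N).1
  set V : (ℕ → Fin d × Bool) → (Set.range (hh N : (ℕ → Fin d × Bool) → _)) → α :=
    fun η h => q h η with hV
  have fV : FM V := FM.pi fun h => hq h
  have fX : FM (pre k : (ℕ → Fin d × Bool) → _) := fm_pre k
  have fY : FM (fun ω => (hh N ω, V (sh N ω))) := (fm_hh N).pair (fV.sh N)
  have hYQ : ∀ ω ω', (hh N ω, V (sh N ω)) = (hh N ω', V (sh N ω')) → Q ω = Q ω' := by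
    intro ω ω' h
    simp only [Prod.mk.injEq] at h
    have h2 := congrFun h.2 ⟨hh N ω, ω, rfl⟩
    simp only [hV] at h2
    rw [hQ, hQ, h2, h.1]
  have fQ : FM Q := fY.of_factor hYQ
  refine ⟨fQ, ?_⟩
  have s1 := ent_submod μ fX fY fQ
  have s2 : ent μ (fun ω => ((hh N ω, V (sh N ω)), Q ω)) ≤ ent μ (fun ω => (hh N ω, V (sh N ω))) := by
    refine ent_le_of_factor μ fY fun ω ω' h => ?_
    exact Prod.ext h (hYQ ω ω' h)
  rw [ent_indep hμ N (fun _ _ h => hh_of_pre h) fV] at s2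
  have s3 : ent μ (fun ω => ((pre k ω, hh N ω), V (sh N ω))) ≤
      ent μ (fun ω => (pre k ω, (hh N ω, V (sh N ω)), Q ω)) := by
    refine ent_le_of_factor μ (fX.pair (fY.pair fQ)) fun ω ω' h => ?_
    simp only [Prod.mk.injEq] at h ⊢
    exact ⟨⟨h.1, h.2.1.1⟩, h.2.1.2⟩
  rw [ent_indep hμ N (X := fun ω => (pre k ω, hh N ω)) (fun ω ω' h => by
    refine Prod.ext ?_ (hh_of_pre h)
    rw [pre_eq_iff] at *
    intro n hn; exact h n (by omega)) fV] at s3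
  have s4 : ent μ (fun ω => (pre k ω, hh m (sh k ω))) ≤ ent μ (fun ω => (pre k ω, hh N ω)) := by
    refine ent_le_of_factor μ (fX.pair (fm_hh N)) fun ω ω' h => ?_
    simp only [Prod.mk.injEq] at h ⊢
    exact ⟨h.1, hh_sub (hh_of_pre h.1) h.2⟩
  rw [ent_indep hμ k (fun _ _ h => h) (fm_hh m)] at s4
  linarith

/-- The future version of a flow observable. -/
def psiJ (n : ℕ) (ψ : (Edg d → ℤ) → α) (φ : Edg d → ℤ) :
    (Set.range (hh n : (ℕ → Fin d × Bool) → _)) → α := fun h => ψ (rec' h φ)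

lemma fm_psiJ (n : ℕ) {ψ : (Edg d → ℤ) → α} (hψ : FM ψ) : FM (psiJ n ψ) := by
  have hfin : Finite (Set.range (hh n : (ℕ → Fin d × Bool) → _)) := (fm_hh n).1
  exact FM.pi (X := fun (h : (Set.range (hh n : (ℕ → Fin d × Bool) → _))) φ => ψ (rec' h φ))
    fun h => hψ.map (measurable_rec h.1)

lemma chain_bound (hd : 3 ≤ d) (hμ : IsUniformBernoulli (Fin d × Bool) μ) (n k : ℕ)
    {ψ : (Edg d → ℤ) → α} (hψ : FM ψ) :
    ent μ (fun ω => (pre k ω, psiJ n ψ (Phi ω))) + ent μ (fun ω => (pre n ω, ψ (Phi ω))) ≤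
      ent μ (fun ω => psiJ n ψ (Phi ω)) + ent μ (fun ω => (pre (n + k) ω, ψ (Phi ω))) := by
  have := hμ.1
  have fX : FM (pre k : (ℕ → Fin d × Bool) → _) := fm_pre k
  have fP : FM (pre n : (ℕ → Fin d × Bool) → _) := fm_pre n
  have fJ : FM (fun ω : ℕ → Fin d × Bool => psiJ n ψ (Phi ω)) := (fm_psiJ n hψ).map measurable_Phi
  set Z : (ℕ → Fin d × Bool) → α := fun ω => ψ (rec' (hh n ω) (Phi (sh n ω))) with hZ
  have hae : ∀ᵐ ω ∂μ, ψ (Phi ω) = Z ω := by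
    filter_upwards [ae_transient hd hμ] with ω hω
    simp only [hZ]
    rw [← Phi_shift hω n]
  have hfac : ∀ ω ω' : ℕ → Fin d × Bool, pre n ω = pre n ω' → psiJ n ψ (Phi (sh n ω)) =
      psiJ n ψ (Phi (sh n ω')) → Z ω = Z ω' := by
    intro ω ω' h1 h2
    have h3 := congrFun h2 ⟨hh n ω, ω, rfl⟩
    simp only [psiJ] at h3
    simp only [hZ]
    rw [h3, hh_of_pre h1]
  have fZ : FM Z := (fP.pair (fJ.sh n)).of_factor fun ω ω' h => by
    simp only [Prod.mk.injEq] at h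
    exact hfac ω ω' h.1 h.2
  rw [ent_congr μ (X := fun ω => (pre n ω, ψ (Phi ω))) (X' := fun ω => (pre n ω, Z ω))
      (by filter_upwards [hae] with ω h; rw [h]),
    ent_congr μ (X := fun ω => (pre (n + k) ω, ψ (Phi ω))) (X' := fun ω => (pre (n + k) ω, Z ω))
      (by filter_upwards [hae] with ω h; rw [h])]
  have s1 := ent_submod μ (fX.sh n) (fJ.sh n) (fP.pair fZ)
  have s2 : ent μ (fun ω => (pre n ω, (fun ω => (pre k ω, psiJ n ψ (Phi ω))) (sh n ω))) ≤
      ent μ (fun ω => (pre k (sh n ω), psiJ n ψ (Phi (sh n ω)), pre n ω, Z ω)) := by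
    refine ent_le_of_factor μ ((fX.sh n).pair ((fJ.sh n).pair (fP.pair fZ))) fun ω ω' h => ?_
    simp only [Prod.mk.injEq] at h ⊢
    tauto
  have s3 : ent μ (fun ω => (psiJ n ψ (Phi (sh n ω)), pre n ω, Z ω)) ≤
      ent μ (fun ω => (pre n ω, (fun ω => psiJ n ψ (Phi ω)) (sh n ω))) := by
    refine ent_le_of_factor μ (fP.pair (fJ.sh n)) fun ω ω' h => ?_
    simp only [Prod.mk.injEq] at h ⊢
    exact ⟨h.2, h.1, hfac ω ω' h.1 h.2⟩
  have s4 : ent μ (fun ω => (pre k (sh n ω), pre n ω, Z ω)) ≤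
      ent μ (fun ω => (pre (n + k) ω, Z ω)) := by
    refine ent_le_of_factor μ ((fm_pre (n + k)).pair fZ) fun ω ω' h => ?_
    simp only [Prod.mk.injEq, pre_eq_iff, sh] at h ⊢
    exact ⟨fun i hi => h.1 _ (by omega), fun i hi => h.1 _ (by omega), h.2⟩
  rw [ent_indep hμ n (fun _ _ h => h) (fX.pair fJ)] at s2
  rw [ent_indep hμ n (fun _ _ h => h) fJ] at s3
  linarith

end Stab

end SolTail


namespace SolTail

open MeasureTheory Set

section Upper

set_option linter.unusedSectionVars false
set_option linter.unusedVariables false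

variable {d : ℕ}

lemma abs_stp (s : Fin d × Bool) (i : Fin d) : |stp s i| ≤ 1 := by
  obtain ⟨j, b⟩ := s
  cases b
  · simp only [stp, latE, Bool.false_eq_true, if_false, Pi.neg_apply]
    split_ifs <;> simp
  · simp only [stp, latE, if_true]
    split_ifs <;> simp

lemma abs_pos_le (n : ℕ) (ω : ℕ → Fin d × Bool) (i : Fin d) : |pos n ω i| ≤ n := by
  induction n with
  | zero => simp [pos]
  | succ n ih =>
    simp only [pos, Pi.add_apply]
    have := abs_add_le (pos n ω i) (stp (ω n) i)
    have := abs_stp (ω n) i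
    push_cast; omega

lemma abs_ev (p : Pt d) (s : Fin d × Bool) (e : Edg d) : |ev p s e| ≤ 1 := by
  classical
  unfold ev
  split_ifs <;> rw [Finsupp.single_apply] <;> split_ifs <;> simp

lemma abs_cr_le (n : ℕ) (ω : ℕ → Fin d × Bool) (e : Edg d) : |cr n ω e| ≤ n := by
  induction n with
  | zero => simp [cr]
  | succ n ih =>
    simp only [cr]
    have := abs_add_le (cr n ω e) (ev (pos n ω) (ω n) e)
    have := abs_ev (pos n ω) (ω n) e
    push_cast; omega

lemma ev_ne' {p : Pt d} {s : Fin d × Bool} {e : Edg d} (h : ev p s e ≠ 0) :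
    e.1 = p ∨ e.1 = p + stp s := by
  classical
  unfold ev at h
  split_ifs at h with hs
  · rw [Finsupp.single_apply] at h
    simp only [ne_eq, ite_eq_right_iff, one_ne_zero, imp_false, not_not] at h
    left; rw [← h]
  · rw [Finsupp.single_apply] at h
    simp only [ne_eq, ite_eq_right_iff, neg_eq_zero, one_ne_zero, imp_false, not_not] at h
    right; rw [← h]; simp [stp, hs, sub_eq_add_neg]

lemma cr_ne {n : ℕ} {ω : ℕ → Fin d × Bool} {e : Edg d} (h : cr n ω e ≠ 0) :
    ∃ m ≤ n, e.1 = pos m ω := by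
  induction n with
  | zero => simp [cr] at h
  | succ n ih =>
    by_cases h1 : cr n ω e = 0
    · rw [cr, h1, zero_add] at h
      rcases ev_ne' h with h2 | h2
      · exact ⟨n, by omega, h2⟩
      · exact ⟨n + 1, le_rfl, h2⟩
    · obtain ⟨m, hm, h2⟩ := ih h1
      exact ⟨m, by omega, h2⟩

lemma cr_ne_block {M m : ℕ} (hM : 0 < M) (hm : 0 < m) {ω : ℕ → Fin d × Bool} {e : Edg d}
    (h : cr (M * m) ω e ≠ 0) :
    ∃ j < m, ∀ i, |(e.1 - pos (M * j) ω) i| ≤ M := by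
  obtain ⟨t, ht, he⟩ := cr_ne h
  have key : ∀ j, M * j ≤ t → t ≤ M * j + M → ∀ i, |(e.1 - pos (M * j) ω) i| ≤ M := by
    intro j h1 h2 i
    obtain ⟨r, rfl⟩ := Nat.exists_eq_add_of_le h1
    rw [he, pos_add, add_sub_cancel_left]
    have := abs_pos_le r (sh (M * j) ω) i
    have : (r : ℤ) ≤ M := by exact_mod_cast (by omega : r ≤ M)
    omega
  rcases ht.lt_or_eq with h1 | h1
  · refine ⟨t / M, Nat.div_lt_of_lt_mul h1, key _ (Nat.mul_div_le t M) ?_⟩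
    have := Nat.lt_mul_div_succ t hM
    rw [mul_add] at this
    omega
  · refine ⟨m - 1, by omega, key _ ?_ ?_⟩
    · rw [h1]; exact Nat.mul_le_mul_left _ (by omega)
    · rw [h1]
      obtain ⟨r, rfl⟩ : ∃ r, m = r + 1 := ⟨m - 1, by omega⟩
      simp [mul_add]

variable {μ : Measure (ℕ → Fin d × Bool)}

lemma fm_pos (n : ℕ) : FM (pos n : (ℕ → Fin d × Bool) → _) := (fm_hh n).comp Prod.fst

lemma card_IccZ (n : ℕ) : Fintype.card (Finset.Icc (-(n : ℤ)) n) = 2 * n + 1 := by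
  rw [Fintype.card_coe, Int.card_Icc]; omega

lemma ent_pos_le (hμ : IsUniformBernoulli (Fin d × Bool) μ) (M : ℕ) :
    ent μ (pos M : (ℕ → Fin d × Bool) → _) ≤ d * Real.log (2 * M + 1) := by
  have := hμ.1
  let X : (ℕ → Fin d × Bool) → (Fin d → Finset.Icc (-(M : ℤ)) M) := fun ω i =>
    ⟨pos M ω i, by rw [Finset.mem_Icc]; exact abs_le.1 (abs_pos_le M ω i)⟩
  have hX : ∀ ω ω', X ω = X ω' ↔ pos M ω = pos M ω' := by
    intro ω ω'
    simp only [X, funext_iff, Subtype.mk.injEq]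
  have fX : FM X := (fm_pos M).of_factor fun ω ω' h => (hX ω ω').2 h
  rw [ent_eq_of_factor μ fX hX]
  have : Nonempty (Fin d → Finset.Icc (-(M : ℤ)) M) := ⟨fun _ => ⟨0, by simp⟩⟩
  refine (ent_le_log_card μ fX).trans (le_of_eq ?_)
  rw [Fintype.card_fun, card_IccZ, Fintype.card_fin]
  push_cast
  rw [Real.log_pow]

/-- Truncation. -/
def clip (n : ℕ) (z : ℤ) : ℤ := max (-n) (min n z)

lemma clip_mem (n : ℕ) (z : ℤ) : clip n z ∈ Finset.Icc (-(n : ℤ)) n := by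
  rw [Finset.mem_Icc]; unfold clip; omega

lemma clip_eq {n : ℕ} {z : ℤ} (h : |z| ≤ n) : clip n z = z := by
  rw [abs_le] at h; unfold clip; omega

/-- The box of edges. -/
noncomputable def boxE (d n : ℕ) : Finset (Edg d) :=
  (Finset.Icc (fun _ : Fin d => -(n : ℤ)) (fun _ => (n : ℤ))) ×ˢ Finset.univ

lemma mem_boxE {n : ℕ} {e : Edg d} : e ∈ boxE d n ↔ ∀ i, |e.1 i| ≤ n := by
  simp only [boxE, Finset.mem_product, Finset.mem_univ, and_true, Finset.mem_Icc, Pi.le_def, abs_le]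
  exact ⟨fun h i => ⟨h.1 i, h.2 i⟩, fun h => ⟨fun i => (h i).1, fun i => (h i).2⟩⟩

/-- The observable. -/
def psi0 (n : ℕ) (φ : Edg d → ℤ) : boxE d n → ℤ := fun e => clip n (φ e)

lemma fm_psi0 (n : ℕ) : FM (psi0 n : (Edg d → ℤ) → _) := by
  refine FM.pi (X := fun (e : boxE d n) (φ : Edg d → ℤ) => clip n (φ e)) fun e => ⟨?_, fun a => ?_⟩
  · refine (Finset.Icc (-(n : ℤ)) n).finite_toSet.subset ?_
    rintro _ ⟨φ, rfl⟩; exact clip_mem _ _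
  · have : Measurable (fun φ : Edg d → ℤ => clip n (φ e)) :=
      (measurable_of_countable (clip n)).comp (measurable_pi_apply _)
    exact this (measurableSet_singleton _)

open Classical in
/-- The correction variable. -/
noncomputable def corr (M m : ℕ) (j : ℕ) (o : Pt d) (i : Fin d) (ω : ℕ → Fin d × Bool) :
    Option (Finset.Icc (-((M * m : ℕ) : ℤ)) (M * m : ℕ)) :=
  if cr (M * m) ω (pos (M * j) ω + o, i) = clip (M * m) (Phi ω (pos (M * j) ω + o, i)) then none
  else some ⟨cr (M * m) ω (pos (M * j) ω + o, i), by
    rw [Finset.mem_Icc]; exact abs_le.1 (abs_cr_le _ _ _)⟩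

lemma corr_box {M m j : ℕ} (hj : j < m) {o : Pt d} (ho : ∀ i, |o i| ≤ M) (i : Fin d)
    (ω : ℕ → Fin d × Bool) : (pos (M * j) ω + o, i) ∈ boxE d (M * m) := by
  rw [mem_boxE]
  intro i'
  simp only [Pi.add_apply]
  have h1 := abs_add_le (pos (M * j) ω i') (o i')
  have h2 := abs_pos_le (M * j) ω i'
  have h3 := ho i'
  have h4 : M * j + M ≤ M * m := by rw [← mul_add_one]; exact Nat.mul_le_mul_left _ hj
  have h5 : ((M * j : ℕ) : ℤ) + M ≤ (M * m : ℕ) := by exact_mod_cast h4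
  omega

lemma pre_mono {T : Type*} {k n : ℕ} (h : k ≤ n) {ω ω' : ℕ → T} (he : pre n ω = pre n ω') :
    pre k ω = pre k ω' := by
  rw [pre_eq_iff] at *
  intro i hi; exact he i (by omega)

lemma fm_corr {M m j : ℕ} (hj : j < m) {o : Pt d} (ho : ∀ i, |o i| ≤ M) (i : Fin d) :
    FM (corr M m j o i) := by
  refine ((fm_pre (M * m)).pair ((fm_psi0 (M * m)).map measurable_Phi)).of_factor fun ω ω' h => ?_
  simp only [Prod.mk.injEq] at h
  obtain ⟨h1, h2⟩ := h
  have h3 : pos (M * j) ω = pos (M * j) ω' :=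
    congrArg Prod.fst (hh_of_pre (pre_mono (Nat.mul_le_mul_left _ hj.le) h1))
  have h4 : cr (M * m) ω = cr (M * m) ω' := congrArg Prod.snd (hh_of_pre h1)
  have h5 := congrFun h2 ⟨_, corr_box hj ho i ω⟩
  simp only [psi0] at h5
  unfold corr
  rw [h3] at h5
  simp only [h3, h4, h5]

lemma corr_prob (hd : 3 ≤ d) (hμ : IsUniformBernoulli (Fin d × Bool) μ) {M m j : ℕ} (hj : j < m)
    (o : Pt d) (i : Fin d) :
    μ.real {ω | corr M m j o i ω ≠ none} ≤
      10 * (Aa (M * (m - j)) (-o) + Aa (M * (m - j)) (-(o + latE d i))) := by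
  have := hμ.1
  have hsub : {ω | corr M m j o i ω ≠ none} ⊆ sh (M * j) ⁻¹'
      ({η | ∃ s ≥ M * (m - j), (0 : Pt d) + pos s η = o} ∪
        {η | ∃ s ≥ M * (m - j), (0 : Pt d) + pos s η = o + latE d i}) := by
    intro ω hω
    by_contra hno
    apply hω
    simp only [mem_preimage, mem_union, mem_ofPred_eq, not_or, not_exists, not_and, zero_add] at hno
    unfold corr
    rw [if_pos]
    have hst : ∀ s ≥ M * m, cr s ω (pos (M * j) ω + o, i) = cr (M * m) ω (pos (M * j) ω + o, i) := by
      refine cr_stable fun s hs => ?_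
      have e1 : M * m = M * j + M * (m - j) := by rw [← mul_add]; congr 1; omega
      obtain ⟨r, rfl⟩ := Nat.exists_eq_add_of_le (show M * j ≤ s by omega)
      rw [pos_add]
      refine ⟨fun h => hno.1 r (by omega) (add_left_cancel h), fun h => hno.2 r (by omega) ?_⟩
      rw [add_assoc] at h
      exact add_left_cancel h
    rw [Phi_eq hst, clip_eq (abs_cr_le _ _ _)]
  refine (measureReal_mono hsub).trans ?_
  rw [real_sh hμ (M * j) ((measurable_late _ _ _).union (measurable_late _ _ _))]
  refine (measureReal_union_le _ _).trans ?_
  have h1 := visit_late hd hμ (M * (m - j)) o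
  have h2 := visit_late hd hμ (M * (m - j)) (o + latE d i)
  simp only [zero_add]
  linarith

lemma Aa_block (hd : 3 ≤ d) {M : ℕ} (hM : 0 < M) (m : ℕ) (x : Pt d) :
    ∑ j : Fin m, Aa (M * (m - j)) x ^ 5 ≤ 12 := by
  refine le_trans ?_ (Aa_sum hd (M * m + 1) x)
  have hinj : Function.Injective (fun j : Fin m => M * (m - j)) := by
    intro a b h
    have h' := Nat.eq_of_mul_eq_mul_left hM h
    ext; omega
  rw [← Finset.sum_image (s := Finset.univ) (g := fun j : Fin m => M * (m - j))
    (f := fun t => Aa t x ^ 5) hinj.injOn]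
  refine Finset.sum_le_sum_of_subset_of_nonneg ?_ fun t _ _ => pow_nonneg (Aa_nonneg t x) 5
  intro t ht
  simp only [Finset.mem_image, Finset.mem_univ, true_and, Finset.mem_range] at *
  obtain ⟨j, rfl⟩ := ht
  exact Nat.lt_succ_of_le (Nat.mul_le_mul_left _ (Nat.sub_le _ _))

lemma corr_sum (hd : 3 ≤ d) (hμ : IsUniformBernoulli (Fin d × Bool) μ) {M p : ℕ} (hM : 0 < M)
    (hp : 0 < p) (o : Pt d) (i : Fin d) :
    ∑ j : Fin (p ^ 10), √(μ.real {ω | corr M (p ^ 10) j o i ω ≠ none}) ≤ 6 * (p : ℝ) ^ 9 := by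
  set m := p ^ 10 with hm
  set q : Fin m → ℝ := fun j => μ.real {ω | corr M m j o i ω ≠ none} with hq
  have hq0 : ∀ j, 0 ≤ q j := fun j => measureReal_nonneg
  have h1 : ∀ j, q j ^ 5 ≤ 1600000 * (Aa (M * (m - j)) (-o) ^ 5 +
      Aa (M * (m - j)) (-(o + latE d i)) ^ 5) := by
    intro j
    have h := corr_prob hd hμ (M := M) j.2 o i
    set a := Aa (M * (m - j)) (-o)
    set b := Aa (M * (m - j)) (-(o + latE d i))
    have ha : 0 ≤ a := Aa_nonneg _ _
    have hb : 0 ≤ b := Aa_nonneg _ _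
    calc q j ^ 5 ≤ (10 * (a + b)) ^ 5 := pow_le_pow_left₀ (hq0 j) h 5
      _ = 100000 * (a + b) ^ 5 := by ring
      _ ≤ 100000 * (2 ^ (5 - 1) * (a ^ 5 + b ^ 5)) := by
        gcongr; exact add_pow_le ha hb 5
      _ = _ := by ring
  have h2 : ∑ j, q j ^ 5 ≤ 38400000 := by
    refine (Finset.sum_le_sum fun j _ => h1 j).trans ?_
    rw [← Finset.mul_sum, Finset.sum_add_distrib]
    have := Aa_block hd hM m (-o)
    have := Aa_block hd hM m (-(o + latE d i))
    linarith
  have h3 : (∑ j, √(q j)) ^ 10 ≤ (m : ℝ) ^ 9 * ∑ j, q j ^ 5 := by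
    have hm0 : (0 : ℝ) < m := by rw [hm]; exact_mod_cast pow_pos hp 10
    have h := pow_sum_div_card_le_sum_pow (s := Finset.univ) (f := fun j => √(q j))
      (fun j _ => Real.sqrt_nonneg _) 9
    rw [Finset.card_univ, Fintype.card_fin, div_le_iff₀ (by positivity)] at h
    have h' : ∀ j, √(q j) ^ (9 + 1) = q j ^ 5 := fun j => by
      rw [show 9 + 1 = 2 * 5 by norm_num, pow_mul, Real.sq_sqrt (hq0 j)]
    simp only [h'] at h
    rw [mul_comm]; exact h
  have hp' : (0 : ℝ) < p := by exact_mod_cast hp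
  refine le_of_pow_le_pow_left₀ (n := 10) (by norm_num) (by positivity) ?_
  refine h3.trans ?_
  have hm' : (m : ℝ) = (p : ℝ) ^ 10 := by rw [hm]; push_cast; rfl
  rw [hm']
  calc ((p : ℝ) ^ 10) ^ 9 * ∑ j, q j ^ 5 ≤ ((p : ℝ) ^ 10) ^ 9 * 38400000 := by gcongr
    _ ≤ ((p : ℝ) ^ 10) ^ 9 * 6 ^ 10 := by gcongr; norm_num
    _ = _ := by ring

lemma exists_big (a b δ : ℝ) (hδ : 0 < δ) : ∃ p : ℕ, 0 < p ∧ a + b * Real.log p ≤ δ * p := by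
  have h1 : (fun x : ℝ => a + b * Real.log x) =o[Filter.atTop] (fun x : ℝ => x) := by
    refine Asymptotics.IsLittleO.add ?_ (Real.isLittleO_log_id_atTop.const_mul_left b)
    exact Asymptotics.isLittleO_const_id_atTop a
  have h2 := (h1.bound hδ)
  have h3 := (tendsto_natCast_atTop_atTop (R := ℝ)).eventually h2
  obtain ⟨p, hp, hp0⟩ := (h3.and (Filter.eventually_gt_atTop 0)).exists
  refine ⟨p, hp0, ?_⟩
  have := le_trans (le_abs_self _) hp
  simpa using this

lemma U_step (hd : 3 ≤ d) (hμ : IsUniformBernoulli (Fin d × Bool) μ) {M p : ℕ} (hM : 0 < M)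
    (hp : 0 < p) :
    ent μ (fun ω => (hh (M * p ^ 10) ω, psi0 (M * p ^ 10) (Phi ω))) ≤
      ent μ (fun ω => psi0 (M * p ^ 10) (Phi ω)) + (p : ℝ) ^ 10 * (d * Real.log (2 * M + 1)) +
      (Fintype.card (Finset.Icc (fun _ : Fin d => -(M : ℤ)) (fun _ => (M : ℤ))) : ℝ) * d *
        (6 * (p : ℝ) ^ 9 * (3 + Real.log (2 * (M * p ^ 10 : ℕ) + 1))) := by
  have := hμ.1
  set m := p ^ 10 with hm
  have hm0 : 0 < m := by rw [hm]; exact pow_pos hp 10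
  set O := Finset.Icc (fun _ : Fin d => -(M : ℤ)) (fun _ => (M : ℤ)) with hO
  have hOm : ∀ o : Pt d, o ∈ O ↔ ∀ i, |o i| ≤ M := by
    intro o
    simp only [hO, Finset.mem_Icc, Pi.le_def, abs_le]
    exact ⟨fun h i => ⟨h.1 i, h.2 i⟩, fun h => ⟨fun i => (h i).1, fun i => (h i).2⟩⟩
  have fY : FM (fun (ω : ℕ → Fin d × Bool) (j : (Finset.univ : Finset (Fin m))) => pos M (sh (M * (j : Fin m)) ω)) :=
    FM.pi (X := fun (j : (Finset.univ : Finset (Fin m))) (ω : ℕ → Fin d × Bool) => pos M (sh (M * (j : Fin m)) ω))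
      fun j => (fm_pos M).sh _
  have eY := ent_pi_le μ (Finset.univ : Finset (Fin m))
    (X := fun j (ω : ℕ → Fin d × Bool) => pos M (sh (M * (j : Fin m)) ω)) (fun j => (fm_pos M).sh _)
  have hcorr : ∀ t : Fin m × O × Fin d, FM (corr M m t.1 t.2.1.1 t.2.2) := fun t =>
    fm_corr t.1.2 ((hOm _).1 t.2.1.2) t.2.2
  have fW : FM (fun ω (t : (Finset.univ : Finset (Fin m × O × Fin d))) =>
      corr M m t.1.1 t.1.2.1.1 t.1.2.2 ω) :=
    FM.pi (X := fun (t : (Finset.univ : Finset (Fin m × O × Fin d))) ω =>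
      corr M m t.1.1 t.1.2.1.1 t.1.2.2 ω) fun t => hcorr t.1
  have eW := ent_pi_le μ (Finset.univ : Finset (Fin m × O × Fin d))
    (X := fun t ω => corr M m t.1 t.2.1.1 t.2.2 ω) hcorr
  have fZ : FM (fun ω : ℕ → Fin d × Bool => psi0 (M * m) (Phi ω)) :=
    (fm_psi0 (M * m)).map measurable_Phi
  have s1 := ent_le_of_factor μ (X := fun ω => (hh (M * m) ω, psi0 (M * m) (Phi ω)))
    (fY.pair (fW.pair fZ)) (by
      intro ω ω' h
      simp only [Prod.mk.injEq] at h ⊢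
      obtain ⟨h1, h2, h3⟩ := h
      refine ⟨?_, h3⟩
      have hpos : ∀ j ≤ m, pos (M * j) ω = pos (M * j) ω' := by
        intro j
        induction j with
        | zero => intro _; rfl
        | succ j ih =>
          intro hj
          have hh1 := congrFun h1 ⟨⟨j, by omega⟩, Finset.mem_univ _⟩
          simp only at hh1
          rw [mul_add_one, pos_add, pos_add, ih (by omega), hh1]
      have hval : ∀ (j : ℕ) (hj : j < m) (e : Edg d), (∀ i, |(e.1 - pos (M * j) ω) i| ≤ M) →
          cr (M * m) ω e = cr (M * m) ω' e := by
        intro j hj e he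
        have hh2 := congrFun h2 ⟨(⟨j, hj⟩, ⟨e.1 - pos (M * j) ω, (hOm _).2 he⟩, e.2),
          Finset.mem_univ _⟩
        simp only at hh2
        have ee : (pos (M * j) ω + (e.1 - pos (M * j) ω), e.2) = e := by simp
        have ee' : (pos (M * j) ω' + (e.1 - pos (M * j) ω), e.2) = e := by
          rw [← hpos j hj.le]; exact ee
        have hbox := corr_box hj he e.2 ω
        rw [ee] at hbox
        have hz := congrFun h3 ⟨e, hbox⟩
        simp only [psi0] at hz
        simp only [corr, ee, ee'] at hh2
        split_ifs at hh2 with c1 c2 c2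
        · rw [c1, c2, hz]
        · simpa using hh2
      refine Prod.ext (hpos m le_rfl) (funext fun e => ?_)
      show cr (M * m) ω e = cr (M * m) ω' e
      by_cases c1 : cr (M * m) ω e = 0
      · by_cases c2 : cr (M * m) ω' e = 0
        · rw [c1, c2]
        · obtain ⟨j, hj, hb⟩ := cr_ne_block hM hm0 c2
          rw [← hpos j hj.le] at hb
          exact hval j hj e hb
      · obtain ⟨j, hj, hb⟩ := cr_ne_block hM hm0 c1
        exact hval j hj e hb)
  have s2 := ent_pair_le μ fY (fW.pair fZ)
  have s3 := ent_pair_le μ fW fZ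
  have bY : ∑ j : Fin m, ent μ (fun ω : ℕ → Fin d × Bool => pos M (sh (M * j) ω)) ≤
      (p : ℝ) ^ 10 * (d * Real.log (2 * M + 1)) := by
    have : ∀ j : Fin m, ent μ (fun ω : ℕ → Fin d × Bool => pos M (sh (M * j) ω)) ≤
        d * Real.log (2 * M + 1) := fun j => by
      rw [ent_sh hμ (fm_pos M)]; exact ent_pos_le hμ M
    refine (Finset.sum_le_sum fun j _ => this j).trans (le_of_eq ?_)
    rw [Finset.sum_const, Finset.card_univ, Fintype.card_fin, nsmul_eq_mul, hm]
    push_cast; rfl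
  have bW : ∑ t : Fin m × O × Fin d, ent μ (corr M m t.1 t.2.1.1 t.2.2) ≤
      (Fintype.card O : ℝ) * d * (6 * (p : ℝ) ^ 9 * (3 + Real.log (2 * (M * m : ℕ) + 1))) := by
    set L := 3 + Real.log (2 * (M * m : ℕ) + 1) with hL
    have hL0 : 0 ≤ L := by
      have : 0 ≤ Real.log (2 * (M * m : ℕ) + 1) := by
        apply Real.log_nonneg
        have : (0 : ℝ) ≤ (M * m : ℕ) := Nat.cast_nonneg _
        linarith
      linarith
    have one : ∀ t : Fin m × O × Fin d, ent μ (corr M m t.1 t.2.1.1 t.2.2) ≤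
        √(μ.real {ω | corr M m t.1 t.2.1.1 t.2.2 ω ≠ none}) * L := by
      intro t
      have : Nonempty (Finset.Icc (-((M * m : ℕ) : ℤ)) (M * m : ℕ)) := ⟨⟨0, by simp; positivity⟩⟩
      have h := ent_option_le μ (hcorr t)
      rw [card_IccZ] at h
      push_cast at h
      rw [hL]; push_cast; exact h
    refine (Finset.sum_le_sum fun t _ => one t).trans ?_
    rw [← Finset.sum_mul, Fintype.sum_prod_type, Finset.sum_comm]
    have two : ∀ y : O × Fin d, ∑ j : Fin m, √(μ.real {ω | corr M m j y.1.1 y.2 ω ≠ none}) ≤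
        6 * (p : ℝ) ^ 9 := fun y => corr_sum hd hμ hM hp y.1.1 y.2
    have three := Finset.sum_le_sum (s := (Finset.univ : Finset (O × Fin d))) fun y _ => two y
    rw [Finset.sum_const, Finset.card_univ, Fintype.card_prod, Fintype.card_fin, nsmul_eq_mul] at three
    push_cast at three
    calc _ ≤ ((Fintype.card O : ℝ) * d * (6 * (p : ℝ) ^ 9)) * L :=
          mul_le_mul_of_nonneg_right three hL0
      _ = _ := by ring
  linarith

lemma U_bound (hd : 3 ≤ d) (hμ : IsUniformBernoulli (Fin d × Bool) μ) {k : ℕ} (hk : 0 < k)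
    {ε : ℝ} (hε : 0 < ε) : ∃ J : ℕ, 0 < J ∧
    ent μ (fun ω => (hh (k * J) ω, psi0 (k * J) (Phi ω))) ≤
      ent μ (fun ω => psi0 (k * J) (Phi ω)) + ε * (k * J : ℕ) := by
  have hk' : (1 : ℝ) ≤ k := by exact_mod_cast hk
  obtain ⟨M', hM', hMb⟩ := exists_big (d * Real.log (3 * k)) d (ε / 2) (by positivity)
  set M := k * M' with hMdef
  have hM : 0 < M := Nat.mul_pos hk hM'
  have hM1 : (1 : ℝ) ≤ M := by exact_mod_cast hM
  have hM'1 : (1 : ℝ) ≤ M' := by exact_mod_cast hM'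
  have hMM : (M : ℝ) = k * M' := by rw [hMdef]; push_cast; rfl
  have b1 : d * Real.log (2 * M + 1) ≤ ε / 2 * M := by
    have : Real.log (2 * M + 1) ≤ Real.log (3 * k) + Real.log M' := by
      rw [← Real.log_mul (by positivity) (by positivity)]
      apply Real.log_le_log (by positivity)
      rw [mul_assoc, ← hMM]; linarith
    calc d * Real.log (2 * M + 1) ≤ d * (Real.log (3 * k) + Real.log M') := by gcongr
      _ = d * Real.log (3 * k) + d * Real.log M' := by ring
      _ ≤ ε / 2 * M' := hMb
      _ ≤ ε / 2 * M := by
        rw [hMM]; gcongr; nlinarith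
  set K : ℝ := (Fintype.card (Finset.Icc (fun _ : Fin d => -(M : ℤ)) (fun _ => (M : ℤ))) : ℝ) * d
    with hK
  have hK0 : 0 ≤ K := by positivity
  obtain ⟨p, hp, hpb⟩ := exists_big (K * 6 * (3 + Real.log (3 * M))) (K * 60) (ε / 2 * M)
    (by positivity)
  have hp1 : (1 : ℝ) ≤ p := by exact_mod_cast hp
  refine ⟨M' * p ^ 10, Nat.mul_pos hM' (pow_pos hp 10), ?_⟩
  rw [← mul_assoc, ← hMdef]
  refine (U_step hd hμ hM hp).trans ?_
  rw [← hK]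
  have b2 : Real.log (2 * (M * p ^ 10 : ℕ) + 1) ≤ Real.log (3 * M) + 10 * Real.log p := by
    have e : 10 * Real.log p = Real.log ((p : ℝ) ^ 10) := by rw [Real.log_pow]; norm_num
    rw [e, ← Real.log_mul (by positivity) (by positivity)]
    apply Real.log_le_log (by positivity)
    push_cast
    have : 1 ≤ (M : ℝ) * p ^ 10 := one_le_mul_of_one_le_of_one_le hM1 (one_le_pow₀ hp1)
    nlinarith
  have b3 : K * (6 * (p : ℝ) ^ 9 * (3 + Real.log (2 * (M * p ^ 10 : ℕ) + 1))) ≤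
      ε / 2 * M * (p : ℝ) ^ 10 := by
    calc K * (6 * (p : ℝ) ^ 9 * (3 + Real.log (2 * (M * p ^ 10 : ℕ) + 1)))
        ≤ K * (6 * (p : ℝ) ^ 9 * (3 + (Real.log (3 * M) + 10 * Real.log p))) := by gcongr
      _ = (p : ℝ) ^ 9 * (K * 6 * (3 + Real.log (3 * M)) + K * 60 * Real.log p) := by ring
      _ ≤ (p : ℝ) ^ 9 * (ε / 2 * M * p) := by gcongr
      _ = _ := by ring
  have b4 : (p : ℝ) ^ 10 * (d * Real.log (2 * M + 1)) ≤ (p : ℝ) ^ 10 * (ε / 2 * M) := by gcongr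
  have : ε * ((M * p ^ 10 : ℕ) : ℝ) = (p : ℝ) ^ 10 * (ε / 2 * M) + ε / 2 * M * (p : ℝ) ^ 10 := by
    push_cast; ring
  linarith

end Upper

end SolTail


namespace SolTail

open MeasureTheory Set

section Final

set_option linter.unusedSectionVars false
set_option linter.unusedVariables false

variable {d : ℕ} {μ : Measure (ℕ → Fin d × Bool)}

lemma FM.mem {Ω : Type*} [MeasurableSpace Ω] {A : Set Ω} (hA : MeasurableSet A) :
    FM (fun ω => ω ∈ A) := by
  refine ⟨Set.toFinite _, fun a => ?_⟩
  by_cases ha : a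
  · have : (fun ω => ω ∈ A) ⁻¹' {a} = A := by ext ω; simp [ha]
    rw [this]; exact hA
  · have : (fun ω => ω ∈ A) ⁻¹' {a} = Aᶜ := by ext ω; simp [ha]
    rw [this]; exact hA.compl

lemma ent_nonneg {Ω : Type*} [MeasurableSpace Ω] (μ : Measure Ω) [IsProbabilityMeasure μ]
    {α : Type*} {X : Ω → α} (hX : FM X) : 0 ≤ ent μ X := by
  have h := ent_le_of_factor μ (X := fun _ : Ω => ()) hX fun _ _ _ => rfl
  rwa [ent_const] at h

lemma tail_meas {A : Set (ℕ → Fin d × Bool)} (hA : @MeasurableSet _ (solTail d) A) :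
    MeasurableSet A := by
  obtain ⟨T, hT, h⟩ := tail_rep 0 hA
  have : A = ⋃ g ∈ Set.range (hh 0 : (ℕ → Fin d × Bool) → _), (hh 0 ⁻¹' {g} ∩ sh 0 ⁻¹' (T g)) := by
    ext ω
    simp only [mem_iUnion, mem_inter_iff, mem_preimage, mem_singleton_iff, exists_prop, h ω]
    constructor
    · intro hω
      exact ⟨hh 0 ω, ⟨ω, rfl⟩, rfl, hω⟩
    · rintro ⟨g, -, hg, hω⟩
      rw [hg]; exact hω
  rw [this]
  refine MeasurableSet.biUnion (fm_hh 0).1.countable fun g _ => ?_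
  exact ((fm_hh 0).2 g).inter (measurable_sh 0 (hT g))

lemma L_tail (hd : 3 ≤ d) (hμ : IsUniformBernoulli (Fin d × Bool) μ) (k m : ℕ) {α : Type*}
    {ψ : (Edg d → ℤ) → α} (hψ : FM ψ) {A : Set (ℕ → Fin d × Bool)}
    (hA : @MeasurableSet _ (solTail d) A) :
    ent μ (pre k : (ℕ → Fin d × Bool) → _) + ent μ (hh m : (ℕ → Fin d × Bool) → _) +
      ent μ (fun ω => (ψ (Phi ω), ω ∈ A)) ≤
      ent μ (hh (k + m) : (ℕ → Fin d × Bool) → _) +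
        ent μ (fun ω => (pre k ω, ψ (Phi ω), ω ∈ A)) := by
  obtain ⟨T, hT, hTA⟩ := tail_rep (k + m) hA
  have h := (L_bound hμ k m (fun h η => (ψ (rec' h (Phi η)), η ∈ T h))
    (fun h => (hψ.map ((measurable_rec h).comp measurable_Phi)).pair (FM.mem (hT h)))
    (fun ω => (ψ (rec' (hh (k + m) ω) (Phi (sh (k + m) ω))), sh (k + m) ω ∈ T (hh (k + m) ω)))
    (fun ω => rfl)).2
  have hae : ∀ᵐ ω ∂μ, (ψ (Phi ω), ω ∈ A) =
      (ψ (rec' (hh (k + m) ω) (Phi (sh (k + m) ω))), sh (k + m) ω ∈ T (hh (k + m) ω)) := by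
    filter_upwards [ae_transient hd hμ] with ω hω
    rw [← Phi_shift hω (k + m), ← hTA ω]
  rw [ent_congr μ hae, ent_congr μ (X := fun ω => (pre k ω, ψ (Phi ω), ω ∈ A))
    (X' := fun ω => (pre k ω, ψ (rec' (hh (k + m) ω) (Phi (sh (k + m) ω))),
      sh (k + m) ω ∈ T (hh (k + m) ω)))]
  · exact h
  · filter_upwards [hae] with ω hω
    rw [hω]

lemma mi_small (hd : 3 ≤ d) (hμ : IsUniformBernoulli (Fin d × Bool) μ)
    {A : Set (ℕ → Fin d × Bool)} (hA : @MeasurableSet _ (solTail d) A) {k : ℕ} (hk : 0 < k)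
    {ε : ℝ} (hε : 0 < ε) : ∃ (δ : Type) (ψ : (Edg d → ℤ) → δ), FM ψ ∧
      ent μ (fun ω => (pre k ω, ψ (Phi ω))) - ent μ (fun ω => ψ (Phi ω)) -
        ent μ (fun ω => (pre k ω, ψ (Phi ω), ω ∈ A)) + ent μ (fun ω => (ψ (Phi ω), ω ∈ A)) ≤ ε := by
  have := hμ.1
  have hk' : (0 : ℝ) < k := by exact_mod_cast hk
  obtain ⟨J, hJ, hU⟩ := U_bound hd hμ hk (ε := ε / k) (by positivity)
  set Z0 : (ℕ → Fin d × Bool) → _ := fun ω => psi0 (k * J) (Phi ω) with hZ0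
  have fZ0 : FM Z0 := (fm_psi0 (k * J)).map measurable_Phi
  have fh : FM (hh (k * J) : (ℕ → Fin d × Bool) → _) := fm_hh _
  have fX : FM (pre (k * J) : (ℕ → Fin d × Bool) → _) := fm_pre _
  set a : ℕ → ℝ := fun j => ent μ (hh (k * j) : (ℕ → Fin d × Bool) → _) with ha
  set b : ℕ → ℝ := fun j => ent μ (fun ω => (pre (k * j) ω, Z0 ω)) with hb
  set u : ℕ → ℝ := fun j => ent μ (fun ω => (pre k ω, psiJ (k * j) (psi0 (k * J)) (Phi ω))) -
    ent μ (fun ω => psiJ (k * j) (psi0 (k * J)) (Phi ω)) with hu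
  set v : ℕ → ℝ := fun j =>
    ent μ (fun ω => (pre k ω, psiJ (k * j) (psi0 (k * J)) (Phi ω), ω ∈ A)) -
    ent μ (fun ω => (psiJ (k * j) (psi0 (k * J)) (Phi ω), ω ∈ A)) with hv
  set x := ent μ (pre k : (ℕ → Fin d × Bool) → _) with hx
  have h1 : ∀ j, u j ≤ b (j + 1) - b j := by
    intro j
    have h : _ + b j ≤ _ + b (j + 1) := chain_bound hd hμ (k * j) k (fm_psi0 (k * J))
    simp only [hu]
    linarith
  have h2 : ∀ j, x - (a (j + 1) - a j) ≤ v j := by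
    intro j
    have h := L_tail hd hμ k (k * j) (fm_psiJ (k * j) (fm_psi0 (k * J))) hA
    have e : k + k * j = k * (j + 1) := by ring
    rw [e] at h
    simp only [hv, ha, hx]
    linarith
  have h3 : b J ≤ J * x - a J + (ent μ Z0 + ε * J) := by
    have s := ent_submod μ fX fZ0 fh
    have e1 := ent_le_of_factor μ (X := fun ω => (pre (k * J) ω, Z0 ω)) (fX.pair (fZ0.pair fh)) (by
      intro ω ω' h
      simp only [Prod.mk.injEq] at h ⊢
      exact ⟨h.1, h.2.1⟩)
    have e2 := ent_le_of_factor μ (X := fun ω => (pre (k * J) ω, hh (k * J) ω)) fX (by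
      intro ω ω' h
      simp only [Prod.mk.injEq]
      exact ⟨h, hh_of_pre h⟩)
    have e3 := ent_le_of_factor μ (X := fun ω => (Z0 ω, hh (k * J) ω)) (fh.pair fZ0) (by
      intro ω ω' h
      simp only [Prod.mk.injEq] at h ⊢
      exact ⟨h.2, h.1⟩)
    have e4 := ent_pre_mul hμ k J
    have e5 : ε / k * ((k * J : ℕ) : ℝ) = ε * J := by push_cast; field_simp
    rw [e5] at hU
    simp only [hb, ha, hx]
    linarith
  have h4 : ent μ Z0 ≤ b 0 := ent_le_of_factor μ ((fm_pre (k * 0)).pair fZ0) (by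
    intro ω ω' h
    simp only [Prod.mk.injEq] at h
    exact h.2)
  have h5 : 0 ≤ a 0 := ent_nonneg μ (fm_hh _)
  have s1 : ∑ j ∈ Finset.range J, u j ≤ b J - b 0 := by
    rw [← Finset.sum_range_sub]; exact Finset.sum_le_sum fun j _ => h1 j
  have s2 : J * x - (a J - a 0) ≤ ∑ j ∈ Finset.range J, v j := by
    have := Finset.sum_le_sum (s := Finset.range J) fun j _ => h2 j
    rw [Finset.sum_sub_distrib, Finset.sum_range_sub, Finset.sum_const, Finset.card_range,
      nsmul_eq_mul] at this
    exact this
  obtain ⟨j, -, hj⟩ := Finset.exists_le_of_sum_le (s := Finset.range J) (f := fun j => u j - v j)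
    (g := fun _ => ε) (Finset.nonempty_range_iff.2 hJ.ne') (by
      rw [Finset.sum_sub_distrib, Finset.sum_const, Finset.card_range, nsmul_eq_mul]
      linarith)
  refine ⟨_, psiJ (k * j) (psi0 (k * J)), fm_psiJ _ (fm_psi0 _), ?_⟩
  simp only [hu, hv] at hj
  linarith

lemma approx_cyl (hμ : IsUniformBernoulli (Fin d × Bool) μ)
    {A : Set (ℕ → Fin d × Bool)} (hA : MeasurableSet A) {ε : ℝ} (hε : 0 < ε) :
    ∃ (k : ℕ) (E : Set (Fin k → Fin d × Bool)), 0 < k ∧ μ.real (symmDiff A (pre k ⁻¹' E)) < ε := by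
  have := hμ.1
  set 𝒜 : Set (Set (ℕ → Fin d × Bool)) := {C | ∃ (k : ℕ) (E : Set (Fin k → Fin d × Bool)), C = pre k ⁻¹' E}
    with h𝒜
  have hmono : ∀ (k l : ℕ) (E : Set (Fin k → Fin d × Bool)), k ≤ l →
      ∃ E' : Set (Fin l → Fin d × Bool), (pre k ⁻¹' E : Set (ℕ → Fin d × Bool)) = pre l ⁻¹' E' := by
    intro k l E hkl
    exact ⟨(fun f i => f (Fin.castLE hkl i)) ⁻¹' E, rfl⟩
  have halg : IsSetAlgebra 𝒜 := by
    refine ⟨⟨0, ∅, by simp⟩, ?_, ?_⟩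
    · rintro _ ⟨k, E, rfl⟩; exact ⟨k, Eᶜ, rfl⟩
    · rintro _ _ ⟨k, E, rfl⟩ ⟨l, E', rfl⟩
      obtain ⟨E1, h1⟩ := hmono k (max k l) E (le_max_left _ _)
      obtain ⟨E2, h2⟩ := hmono l (max k l) E' (le_max_right _ _)
      exact ⟨max k l, E1 ∪ E2, by rw [h1, h2]; rfl⟩
  have hgen : (MeasurableSpace.pi : MeasurableSpace (ℕ → Fin d × Bool)) =
      MeasurableSpace.generateFrom 𝒜 := by
    apply le_antisymm
    · rw [cyls_gen]
      refine MeasurableSpace.generateFrom_mono ?_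
      rintro C (hC | ⟨n, f, rfl⟩)
      · exact ⟨0, ∅, by simpa using hC⟩
      · exact ⟨n, {f}, rfl⟩
    · refine MeasurableSpace.generateFrom_le ?_
      rintro _ ⟨k, E, rfl⟩
      exact (fm_pre k).preimage E
  obtain ⟨_, ⟨k, E, rfl⟩, hE⟩ := (Measure.MeasureDense.of_generateFrom_isSetAlgebra_finite
    μ halg hgen).approx A hA (measure_ne_top _ _) ε hε
  obtain ⟨E', h'⟩ := hmono k (k + 1) E (Nat.le_succ k)
  refine ⟨k + 1, E', Nat.succ_pos k, ?_⟩
  rw [← h', measureReal_def]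
  exact (ENNReal.toReal_lt_of_lt_ofReal hE)

lemma ent_symm (hμ : IsUniformBernoulli (Fin d × Bool) μ)
    {A : Set (ℕ → Fin d × Bool)} (hA : MeasurableSet A) (k : ℕ) (E : Set (Fin k → Fin d × Bool)) :
    ent μ (fun ω => (ω ∈ A, pre k ω)) ≤
      ent μ (pre k : (ℕ → Fin d × Bool) → _) + √(μ.real (symmDiff A (pre k ⁻¹' E))) * 3 := by
  classical
  have := hμ.1
  have hC : MeasurableSet (pre k ⁻¹' E : Set (ℕ → Fin d × Bool)) := (fm_pre k).preimage E
  set D := symmDiff A (pre k ⁻¹' E) with hD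
  have hDm : MeasurableSet D := hA.symmDiff hC
  have fV : FM (fun ω => if ω ∈ D then some () else none) :=
    (FM.mem hDm).comp (fun P => if P then some () else none)
  have h1 := ent_option_le μ fV
  have e : {ω | (if ω ∈ D then some () else none) ≠ none} = D := by ext ω; simp
  rw [e] at h1
  simp only [Fintype.card_unit, Nat.cast_one, Real.log_one, add_zero] at h1
  have h2 := ent_pair_le μ fV (fm_pre k)
  have h3 := ent_le_of_factor μ (X := fun ω => (ω ∈ A, pre k ω)) (fV.pair (fm_pre k)) (by
    intro ω ω' h
    simp only [Prod.mk.injEq] at h ⊢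
    obtain ⟨ha, hb⟩ := h
    refine ⟨?_, hb⟩
    have hd1 : ω ∈ D ↔ ω' ∈ D := by
      by_cases c : ω ∈ D <;> by_cases c' : ω' ∈ D <;> simp [c, c'] at ha ⊢
    have hd2 : ω ∈ (pre k ⁻¹' E : Set (ℕ → Fin d × Bool)) ↔ ω' ∈ pre k ⁻¹' E := by
      simp only [mem_preimage, hb]
    simp only [hD, mem_symmDiff] at hd1
    apply propext
    tauto)
  linarith

lemma approx_Phi (hd : 3 ≤ d) (hμ : IsUniformBernoulli (Fin d × Bool) μ)
    {A : Set (ℕ → Fin d × Bool)} (hA : @MeasurableSet _ (solTail d) A) {ε : ℝ} (hε : 0 < ε) :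
    ∃ B : Set (Edg d → ℤ), MeasurableSet B ∧ μ.real (symmDiff A (Phi ⁻¹' B)) ≤ ε := by
  have := hμ.1
  have hAm := tail_meas hA
  obtain ⟨k, E, hk, hE⟩ := approx_cyl hμ hAm (ε := (ε / 6) ^ 2) (by positivity)
  obtain ⟨δ, ψ, hψ, hmi⟩ := mi_small hd hμ hA hk (ε := ε / 2) (by positivity)
  have fZ : FM (fun ω : ℕ → Fin d × Bool => ψ (Phi ω)) := hψ.map measurable_Phi
  have fX : FM (pre k : (ℕ → Fin d × Bool) → _) := fm_pre k
  have fA := FM.mem hAm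
  obtain ⟨G, hG⟩ := exists_approx μ A hAm fZ
  refine ⟨ψ ⁻¹' G, hψ.preimage G, ?_⟩
  refine (show μ.real (symmDiff A (Phi ⁻¹' (ψ ⁻¹' G))) ≤ _ from hG).trans ?_
  have h1 := ent_symm hμ hAm k E
  have h2 : √(μ.real (symmDiff A (pre k ⁻¹' E))) ≤ ε / 6 :=
    Real.sqrt_le_iff.2 ⟨by positivity, hE.le⟩
  have h3 := ent_submod μ fA fZ fX
  have e1 := ent_le_of_factor μ (X := fun ω => (pre k ω, ψ (Phi ω), ω ∈ A)) (fA.pair (fZ.pair fX)) (by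
    intro ω ω' h
    simp only [Prod.mk.injEq] at h ⊢
    exact ⟨h.2.2, h.2.1, h.1⟩)
  have e2 := ent_le_of_factor μ (X := fun ω => (ψ (Phi ω), pre k ω)) (fX.pair fZ) (by
    intro ω ω' h
    simp only [Prod.mk.injEq] at h ⊢
    exact ⟨h.2, h.1⟩)
  have e3 := ent_le_of_factor μ (X := fun ω => (ω ∈ A, ψ (Phi ω))) (fZ.pair fA) (by
    intro ω ω' h
    simp only [Prod.mk.injEq] at h ⊢
    exact ⟨h.2, h.1⟩)
  linarith

lemma tail_set (hd : 3 ≤ d) (hμ : IsUniformBernoulli (Fin d × Bool) μ)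
    {A : Set (ℕ → Fin d × Bool)} (hA : @MeasurableSet _ (solTail d) A) :
    ∃ B : Set (Edg d → ℤ), MeasurableSet B ∧ ∀ᵐ ω ∂μ, ω ∈ A ↔ Phi ω ∈ B := by
  have := hμ.1
  have h : ∀ n : ℕ, ∃ B : Set (Edg d → ℤ), MeasurableSet B ∧
      μ.real (symmDiff A (Phi ⁻¹' B)) ≤ (1 / 2 : ℝ) ^ n := fun n =>
    approx_Phi hd hμ hA (by positivity)
  choose B hB hBm using h
  refine ⟨{x | ∃ N, ∀ n ≥ N, x ∈ B n}, ?_, ?_⟩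
  · have : {x | ∃ N, ∀ n ≥ N, x ∈ B n} = ⋃ N, ⋂ n, ⋂ (_ : n ≥ N), B n := by
      ext x; simp
    rw [this]
    exact MeasurableSet.iUnion fun N => MeasurableSet.iInter fun n => MeasurableSet.iInter fun _ => hB n
  · have hsum : ∑' n, μ (symmDiff A (Phi ⁻¹' B n)) ≠ ⊤ := by
      have h1 : ∀ n, μ (symmDiff A (Phi ⁻¹' B n)) ≤ ENNReal.ofReal ((1 / 2 : ℝ) ^ n) := by
        intro n
        rw [← ofReal_measureReal]
        exact ENNReal.ofReal_le_ofReal (hBm n)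
      refine ne_top_of_le_ne_top ?_ (ENNReal.tsum_le_tsum h1)
      exact summable_geometric_two.tsum_ofReal_ne_top
    filter_upwards [ae_eventually_notMem hsum] with ω hω
    obtain ⟨N, hN⟩ := Filter.eventually_atTop.1 hω
    have hN' : ∀ n ≥ N, (ω ∈ A ↔ Phi ω ∈ B n) := by
      intro n hn
      have := hN n hn
      simp only [mem_symmDiff, mem_preimage] at this
      tauto
    constructor
    · intro ha
      exact ⟨N, fun n hn => (hN' n hn).1 ha⟩
    · rintro ⟨M, hM⟩
      exact (hN' (max N M) (le_max_left _ _)).2 (hM _ (le_max_right _ _))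

open Classical in
lemma tail_fun (hd : 3 ≤ d) (hμ : IsUniformBernoulli (Fin d × Bool) μ)
    (F : (ℕ → Fin d × Bool) → ℝ) (hFm : @Measurable _ _ (solTail d) _ F) :
    ∃ G : (Edg d → ℤ) → ℝ, Measurable G ∧ ∀ᵐ ω ∂μ, F ω = G (Phi ω) := by
  have h : ∀ q : ℚ, ∃ B : Set (Edg d → ℤ), MeasurableSet B ∧
      ∀ᵐ ω ∂μ, ω ∈ F ⁻¹' (Iio (q : ℝ)) ↔ Phi ω ∈ B := fun q =>
    tail_set hd hμ (hFm measurableSet_Iio)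
  choose B hB hBm using h
  refine ⟨fun x => (⨅ q : ℚ, if x ∈ B q then ((q : ℝ) : EReal) else ⊤).toReal, ?_, ?_⟩
  · refine measurable_ereal_toReal.comp ?_
    exact Measurable.iInf fun q => Measurable.ite (hB q) measurable_const measurable_const
  · filter_upwards [ae_all_iff.2 hBm] with ω hω
    have : (⨅ q : ℚ, if Phi ω ∈ B q then ((q : ℝ) : EReal) else ⊤) = (F ω : EReal) := by
      apply le_antisymm
      · refine le_of_forall_gt fun c hc => ?_
        obtain ⟨q, hq1, hq2⟩ := EReal.lt_iff_exists_rat_btwn.1 hc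
        refine lt_of_le_of_lt (iInf_le _ q) ?_
        rw [if_pos ((hω q).1 (by simpa using hq1))]
        exact hq2
      · refine le_iInf fun q => ?_
        split_ifs with hq
        · have := (hω q).2 hq
          simp only [mem_preimage, mem_Iio] at this
          exact_mod_cast this.le
        · exact le_top
    rw [this, EReal.toReal_coe]

end Final

end SolTail


/-- For `d ≥ 3`, every bounded tail-measurable function of the simple
random walk on the free metabelian group `Sol_d` coincides almost everywhere with a
measurable function of the stabilized edge-count function `Φ(ω)`; i.e. the stabilized
crossing counts generate the Poisson boundary. -/
theorem tail_functions_factor_through_stabilized_crossings (d : ℕ) (hd : 3 ≤ d)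
    (μ : MeasureTheory.Measure (ℕ → Fin d × Bool))
    (hμ : IsUniformBernoulli (Fin d × Bool) μ)
    (F : (ℕ → Fin d × Bool) → ℝ)
    (hFb : ∃ C : ℝ, ∀ ω, |F ω| ≤ C)
    (hFm : @Measurable _ _ (solTail d) _ F) :
    ∃ G : (Edg d → ℤ) → ℝ, Measurable G ∧
      ∀ᵐ ω ∂μ, F ω = G (fun e => stabCross d ω e) := by
  exact SolTail.tail_fun hd hμ F hFm
end
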